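/- arXiv:2403.05737 — 2 statements merged into one kernel-verified Lean document; each statement's English description precedes it below -/
import Mathlib

section
/- Let F be a class of finite simple graphs that is hereditary and degree-bounded. Then F has a polynomial degree-bounding function: there exists a polynomial p with natural-number coefficients such that every graph G in F satisfies δ(G) ≤ p(τ(G)). -/
open SimpleGraph
open scoped Classical

noncomputable section

/-- Minimum degree of a finite simple graph. -/
def minDeg {V : Type} [Fintype V] (G : SimpleGraph V) : ℕ :=
  G.minDegree

/-- Average degree of a finite simple graph. -/
def avgDeg {V : Type} [Fintype V] (G : SimpleGraph V) : ℝ :=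
  (∑ v, (G.degree v : ℝ)) / (Fintype.card V)

/-- `G` contains `K_{t,t}` as a (not necessarily induced) subgraph. -/
def HasBicliqueSub {V : Type} (G : SimpleGraph V) (t : ℕ) : Prop :=
  ∃ A B : Finset V, Disjoint A B ∧ A.card = t ∧ B.card = t ∧
    ∀ a ∈ A, ∀ b ∈ B, G.Adj a b

/-- The biclique number of `G`. -/
def bicliqueNum {V : Type} [Fintype V] (G : SimpleGraph V) : ℕ :=
  sSup {t | HasBicliqueSub G t}

/-- A class of finite simple graphs. -/
def GraphClass := ∀ (V : Type) [Fintype V], SimpleGraph V → Prop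

/-- Hereditary: closed under isomorphism and nonempty induced subgraphs. -/
def Hereditary (F : GraphClass) : Prop :=
  (∀ (V W : Type) [Fintype V] [Fintype W] (G : SimpleGraph V) (H : SimpleGraph W),
      Nonempty (G ≃g H) → F V G → F W H) ∧
  (∀ (V : Type) [Fintype V] (G : SimpleGraph V) (s : Set V), s.Nonempty →
      F V G → F s (G.induce s))

/-- Degree-bounded class. -/
def DegBounded (F : GraphClass) : Prop :=
  ∃ f : ℕ → ℕ, ∀ (V : Type) [Fintype V] (G : SimpleGraph V),
    F V G → minDeg G ≤ f (bicliqueNum G)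



def NoBic {V : Type} (G : SimpleGraph V) (s : ℕ) : Prop := ¬ HasBicliqueSub G s

def IndepF {V : Type} (G : SimpleGraph V) (A : Finset V) : Prop :=
  ∀ a ∈ A, ∀ a' ∈ A, ¬ G.Adj a a'

/-- Every induced bipartite `C₄`-free pair has a vertex of degree less than `K`. -/
def NW {V : Type} (G : SimpleGraph V) (K : ℕ) : Prop :=
  ∀ A B : Finset V, Disjoint A B → IndepF G A → IndepF G B →
    (∀ b ∈ B, ∀ b' ∈ B, b ≠ b' → (A.filter (fun a => G.Adj a b ∧ G.Adj a b')).card ≤ 1) →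
    (A ∪ B).Nonempty →
    (∃ a ∈ A, (B.filter (fun b => G.Adj a b)).card < K) ∨
    (∃ b ∈ B, (A.filter (fun a => G.Adj a b)).card < K)

lemma lemma9 {V : Type} [Fintype V] (G : SimpleGraph V) (K : ℕ) (h : NW G K) (n : ℕ) :
    ∀ A B : Finset V, A.card + B.card = n → Disjoint A B → IndepF G A → IndepF G B →
    (∀ b ∈ B, ∀ b' ∈ B, b ≠ b' → (A.filter (fun a => G.Adj a b ∧ G.Adj a b')).card ≤ 1) →
    ∑ b ∈ B, (A.filter (fun a => G.Adj a b)).card ≤ K * n := by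
  induction n with
  | zero =>
    intro A B hn _ _ _ _
    have : B = ∅ := by rw [← Finset.card_eq_zero]; omega
    simp [this]
  | succ n ih =>
    intro A B hn hd hA hB hC
    have hne : (A ∪ B).Nonempty := by
      rw [← Finset.card_pos, Finset.card_union_of_disjoint hd]; omega
    rcases h A B hd hA hB hC hne with ⟨a, ha, hlt⟩ | ⟨b, hb, hlt⟩
    · have h1 := ih (A.erase a) B (by rw [Finset.card_erase_of_mem ha]; have := Finset.card_pos.2 ⟨a, ha⟩; omega)
        (hd.mono_left (Finset.erase_subset _ _))
        (fun x hx y hy => hA x (Finset.mem_of_mem_erase hx) y (Finset.mem_of_mem_erase hy)) hB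
        (fun b hb b' hb' hne => le_trans (Finset.card_le_card (Finset.filter_subset_filter _ (Finset.erase_subset _ _))) (hC b hb b' hb' hne))
      have h2 : ∑ b ∈ B, (A.filter (fun a => G.Adj a b)).card
          ≤ ∑ b ∈ B, (((A.erase a).filter (fun a => G.Adj a b)).card + if G.Adj a b then 1 else 0) := by
        apply Finset.sum_le_sum
        intro b _
        have : A.filter (fun a => G.Adj a b) ⊆ (A.erase a).filter (fun a => G.Adj a b) ∪ (if G.Adj a b then {a} else ∅) := by
          intro x hx
          simp only [Finset.mem_filter] at hx
          by_cases hxa : x = a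
          · subst hxa; simp [hx.2]
          · simp [hxa, hx.1, hx.2]
        refine (Finset.card_le_card this).trans ((Finset.card_union_le _ _).trans ?_)
        gcongr
        split_ifs <;> simp
      rw [Finset.sum_add_distrib, ← Finset.card_filter] at h2
      nlinarith
    · have h1 := ih A (B.erase b) (by rw [Finset.card_erase_of_mem hb]; have := Finset.card_pos.2 ⟨b, hb⟩; omega)
        (hd.mono_right (Finset.erase_subset _ _)) hA
        (fun x hx y hy => hB x (Finset.mem_of_mem_erase hx) y (Finset.mem_of_mem_erase hy))
        (fun b hb b' hb' hne => (hC b (Finset.mem_of_mem_erase hb) b' (Finset.mem_of_mem_erase hb') hne))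
      rw [← Finset.add_sum_erase _ _ hb]
      nlinarith

/-- incidence pattern. -/
structure Pat (K D q : ℕ) where
  I : Fin D → Fin q → Prop
  two : 2 ≤ K
  line : ∀ l, K ≤ (Finset.univ.filter (fun i => I i l)).card
  pt : ∀ i, K ≤ (Finset.univ.filter (fun l => I i l)).card
  meet : ∀ l l', l ≠ l' → (Finset.univ.filter (fun i => I i l ∧ I i l')).card ≤ 1
  Dpos : 1 ≤ D

lemma lemma3 {V : Type} [Fintype V] (G : SimpleGraph V) {K D q : ℕ} (P : Pat K D q) (h : NW G K)
    (y : Fin D → V) (b : Fin q → V) (hI : ∀ i l, G.Adj (y i) (b l) ↔ P.I i l)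
    (hy : ∀ i j, ¬ G.Adj (y i) (y j)) (hb : ∀ i j, ¬ G.Adj (b i) (b j)) : False := by
  have hK := P.two
  have hbi : Function.Injective b := by
    intro l l' hll
    by_contra hne
    have h1 := P.meet l l' hne
    have h2 := P.line l
    have : (Finset.univ.filter (fun i => P.I i l)) ⊆ (Finset.univ.filter (fun i => P.I i l ∧ P.I i l')) := by
      intro i hi
      simp only [Finset.mem_filter, Finset.mem_univ, true_and] at hi ⊢
      exact ⟨hi, by rw [← hI, ← hll, hI]; exact hi⟩
    have := Finset.card_le_card this
    omega
  have hyi : Function.Injective y := by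
    intro i i' hii
    by_contra hne
    have h2 := P.pt i
    obtain ⟨l, hl, l', hl', hll⟩ := Finset.one_lt_card.1 (by omega : 1 < (Finset.univ.filter (fun l => P.I i l)).card)
    simp only [Finset.mem_filter, Finset.mem_univ, true_and] at hl hl'
    have h1 := P.meet l l' hll
    have hk : ∀ l, P.I i l → P.I i' l := fun l hl => by rw [← hI, ← hii, hI]; exact hl
    have := Finset.card_le_one.1 h1 i (by simp [hl, hl']) i' (by simp [hk _ hl, hk _ hl'])
    exact hne this
  have cA : ∀ (p : V → Prop) [DecidablePred p], ((Finset.univ.image y).filter p).card = (Finset.univ.filter (fun i => p (y i))).card := by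
    intro p _
    rw [Finset.filter_image, Finset.card_image_of_injective _ hyi]
  have cB : ∀ (p : V → Prop) [DecidablePred p], ((Finset.univ.image b).filter p).card = (Finset.univ.filter (fun i => p (b i))).card := by
    intro p _
    rw [Finset.filter_image, Finset.card_image_of_injective _ hbi]
  have := h (Finset.univ.image y) (Finset.univ.image b) ?_ ?_ ?_ ?_ ?_
  · rcases this with ⟨a, ha, hlt⟩ | ⟨a, ha, hlt⟩
    · simp only [Finset.mem_image, Finset.mem_univ, true_and] at ha
      obtain ⟨i, rfl⟩ := ha
      rw [cB] at hlt
      simp only [hI] at hlt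
      have := P.pt i; omega
    · simp only [Finset.mem_image, Finset.mem_univ, true_and] at ha
      obtain ⟨i, rfl⟩ := ha
      rw [cA] at hlt
      simp only [hI] at hlt
      have := P.line i; omega
  · rw [Finset.disjoint_left]
    intro v hv hv'
    simp only [Finset.mem_image, Finset.mem_univ, true_and] at hv hv'
    obtain ⟨i, rfl⟩ := hv
    obtain ⟨l, hl⟩ := hv'
    have h2 := P.pt i
    obtain ⟨l', hl'⟩ := Finset.card_pos.1 (by omega : 0 < (Finset.univ.filter (fun l => P.I i l)).card)
    simp only [Finset.mem_filter, Finset.mem_univ, true_and] at hl'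
    rw [← hI, ← hl] at hl'
    exact hb _ _ hl'
  · intro a ha a' ha'
    simp only [Finset.mem_image, Finset.mem_univ, true_and] at ha ha'
    obtain ⟨i, rfl⟩ := ha
    obtain ⟨j, rfl⟩ := ha'
    exact hy _ _
  · intro a ha a' ha'
    simp only [Finset.mem_image, Finset.mem_univ, true_and] at ha ha'
    obtain ⟨i, rfl⟩ := ha
    obtain ⟨j, rfl⟩ := ha'
    exact hb _ _
  · intro a ha a' ha' hne
    simp only [Finset.mem_image, Finset.mem_univ, true_and] at ha ha'
    obtain ⟨i, rfl⟩ := ha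
    obtain ⟨j, rfl⟩ := ha'
    rw [cA]
    simp only [hI]
    exact P.meet i j (fun h => hne (by rw [h]))
  · exact ⟨y ⟨0, P.Dpos⟩, by simp⟩

lemma lemma1 {V : Type} [Fintype V] (G : SimpleGraph V) {s : ℕ} (h1s : 1 ≤ s) (h : NoBic G s) (Q : Finset V)
    (hQ : 2 * s ≤ Q.card) :
    (Finset.univ.filter (fun v => 2 * s * (Q.filter (fun u => ¬ G.Adj v u)).card < Q.card)).card < s := by
  by_contra hc
  push Not at hc
  obtain ⟨T, hT, hTs⟩ := Finset.exists_subset_card_eq hc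
  have hb : (T.biUnion (fun v => Q.filter (fun u => ¬ G.Adj v u))).card * 2 ≤ Q.card := by
    have h1 : 2 * s * ∑ v ∈ T, (Q.filter (fun u => ¬ G.Adj v u)).card ≤ s * Q.card := by
      rw [Finset.mul_sum, ← hTs, ← smul_eq_mul T.card]
      apply Finset.sum_le_card_nsmul
      intro v hv
      have := hT hv
      simp only [Finset.mem_filter, Finset.mem_univ, true_and] at this
      rw [hTs]; exact this.le
    have h2 := Finset.card_biUnion_le (s := T) (t := fun v => Q.filter (fun u => ¬ G.Adj v u))
    have h3 : s * (2 * ∑ v ∈ T, (Q.filter (fun u => ¬ G.Adj v u)).card) ≤ s * Q.card := by linarith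
    have := Nat.le_of_mul_le_mul_left h3 h1s
    omega
  have hR : s ≤ (Q \ (T.biUnion (fun v => Q.filter (fun u => ¬ G.Adj v u)))).card := by
    have := Finset.le_card_sdiff (T.biUnion (fun v => Q.filter (fun u => ¬ G.Adj v u))) Q
    omega
  obtain ⟨R, hR1, hR2⟩ := Finset.exists_subset_card_eq hR
  have hadj : ∀ a ∈ T, ∀ b ∈ R, G.Adj a b := by
    intro a ha b hb
    have := hR1 hb
    simp only [Finset.mem_sdiff, Finset.mem_biUnion, Finset.mem_filter, not_exists, not_and, not_not] at this
    exact this.2 a ha this.1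
  exact h ⟨T, R, by
    rw [Finset.disjoint_left]; intro a ha hb; exact (G.loopless.irrefl a) (hadj a ha a hb), hTs, hR2, hadj⟩


def indT {V : Type} [Fintype V] (G : SimpleGraph V) {m : ℕ} (P : Fin m → Finset V) : Finset (Fin m → V) :=
  (Fintype.piFinset P).filter (fun x => ∀ i j, ¬ G.Adj (x i) (x j))

lemma mem_indT {V : Type} [Fintype V] (G : SimpleGraph V) {m : ℕ} (P : Fin m → Finset V) (x : Fin m → V) :
    x ∈ indT G P ↔ (∀ i, x i ∈ P i) ∧ ∀ i j, ¬ G.Adj (x i) (x j) := by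
  simp [indT]

lemma lemma2 {V : Type} [Fintype V] (G : SimpleGraph V) {s : ℕ} (h1s : 1 ≤ s) (h : NoBic G s) (m : ℕ) :
    ∀ P : Fin m → Finset V, (∀ i, m * (4 * s) ^ (m + 1) ≤ (P i).card) →
    ∏ i, (P i).card ≤ (4 * s) ^ (m ^ 2) * (indT G P).card := by
  induction m with
  | zero =>
    intro P _
    simp [indT]
  | succ m ih =>
    intro P hP
    have hs4 : 1 ≤ 4 * s := by omega
    have hpow : 1 ≤ (4 * s) ^ (m + 1) := Nat.one_le_pow _ _ hs4
    have hbig : (m + 1) * (4 * s) ^ (m + 1 + 1) = (m + 1) * (4 * s) * (4 * s) ^ (m + 1) := by ring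
    have hbig2 : (m + 1) * (4 * s) ≤ (m + 1) * (4 * s) ^ (m + 1 + 1) := by
      rw [hbig]; exact Nat.le_mul_of_pos_right _ hpow
    let bad : Fin m → Finset V := fun i =>
      (Finset.univ.filter (fun v => 2 * s * ((P i.succ).filter (fun u => ¬ G.Adj v u)).card < (P i.succ).card))
    let Good : Finset V := P 0 \ Finset.univ.biUnion bad
    have hGood : (P 0).card ≤ 2 * Good.card := by
      have h1 : (Finset.univ.biUnion bad).card ≤ m * s := by
        refine Finset.card_biUnion_le.trans ?_
        have : ∑ i : Fin m, (bad i).card ≤ (Finset.univ : Finset (Fin m)).card • s := by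
          apply Finset.sum_le_card_nsmul
          intro i _
          refine (lemma1 G h1s h (P i.succ) ?_).le
          have := hP i.succ
          nlinarith
        simpa using this
      have h2 := Finset.le_card_sdiff (Finset.univ.biUnion bad) (P 0)
      have h3 := hP 0
      have h4 : 2 * (m * s) ≤ (m + 1) * (4 * s) := by nlinarith
      have : Good.card = (P 0 \ Finset.univ.biUnion bad).card := rfl
      omega
    let P' : V → Fin m → Finset V := fun v i => (P i.succ).filter (fun u => ¬ G.Adj v u)
    have hgm : ∀ v ∈ Good, ∀ i, (P i.succ).card ≤ 2 * s * (P' v i).card := by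
      intro v hv i
      simp only [Good, bad, Finset.mem_sdiff, Finset.mem_biUnion, Finset.mem_filter, Finset.mem_univ, true_and, not_exists, not_lt] at hv
      exact hv.2 i
    have hstep : ∀ v ∈ Good, ∏ i : Fin m, (P i.succ).card ≤ (2 * s) ^ m * ((4 * s) ^ (m ^ 2) * (indT G (P' v)).card) := by
      intro v hv
      calc ∏ i : Fin m, (P i.succ).card ≤ ∏ i : Fin m, (2 * s * (P' v i).card) :=
            Finset.prod_le_prod' (fun i _ => hgm v hv i)
        _ = (2 * s) ^ m * ∏ i, (P' v i).card := by
            rw [Finset.prod_mul_distrib]; simp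
        _ ≤ _ := by
            apply Nat.mul_le_mul_left
            apply ih
            intro i
            have h1 := hgm v hv i
            have h2 := hP i.succ
            rw [hbig] at h2
            have h3 : 2 * s * (m * (4 * s) ^ (m + 1)) ≤ 2 * s * (P' v i).card := by
              refine le_trans ?_ (h2.trans h1)
              have : 2 * s * (m * (4 * s) ^ (m + 1)) = (m * (2 * s)) * (4 * s) ^ (m + 1) := by ring
              rw [this]
              apply Nat.mul_le_mul_right
              nlinarith
            exact Nat.le_of_mul_le_mul_left h3 (by omega)
    have hcount : ∑ v ∈ Good, (indT G (P' v)).card ≤ (indT G P).card := by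
      rw [← Finset.card_sigma]
      apply Finset.card_le_card_of_injOn (fun z : (Σ _ : V, (Fin m → V)) => (Fin.cons z.1 z.2 : Fin (m+1) → V))
      · intro z hz
        simp only [Finset.coe_sigma, Set.mem_sigma_iff, Finset.mem_coe, mem_indT] at hz ⊢
        obtain ⟨hz1, hz2, hz3⟩ := hz
        refine ⟨?_, ?_⟩
        · intro i
          refine Fin.cases ?_ ?_ i
          · exact (Finset.mem_sdiff.1 hz1).1
          · intro j; exact (Finset.mem_filter.1 (hz2 j)).1
        · intro i j
          refine Fin.cases ?_ ?_ i <;> refine Fin.cases ?_ ?_ j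
          · simp
          · intro j; exact (Finset.mem_filter.1 (hz2 j)).2
          · intro j hh; exact (Finset.mem_filter.1 (hz2 j)).2 hh.symm
          · intro j i; exact hz3 i j
      · rintro ⟨v, x⟩ _ ⟨w, y⟩ _ hxy
        obtain ⟨h1, h2⟩ := Fin.cons_injective2 hxy
        simp only at h1 h2
        subst h1 h2
        rfl
    rw [Fin.prod_univ_succ]
    have hsum : Good.card * ∏ i : Fin m, (P i.succ).card ≤ (2 * s) ^ m * ((4 * s) ^ (m ^ 2) * (indT G P).card) := by
      calc Good.card * ∏ i : Fin m, (P i.succ).card = ∑ v ∈ Good, ∏ i : Fin m, (P i.succ).card := by simp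
        _ ≤ ∑ v ∈ Good, (2 * s) ^ m * ((4 * s) ^ (m ^ 2) * (indT G (P' v)).card) := Finset.sum_le_sum hstep
        _ = (2 * s) ^ m * ((4 * s) ^ (m ^ 2) * ∑ v ∈ Good, (indT G (P' v)).card) := by
            simp_rw [Finset.mul_sum]
        _ ≤ _ := by gcongr
    calc (P 0).card * ∏ i : Fin m, (P i.succ).card ≤ 2 * Good.card * ∏ i : Fin m, (P i.succ).card := by gcongr
      _ = 2 * (Good.card * ∏ i : Fin m, (P i.succ).card) := by ring
      _ ≤ 2 * ((2 * s) ^ m * ((4 * s) ^ (m ^ 2) * (indT G P).card)) := by gcongr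
      _ ≤ (4 * s) * ((4 * s) ^ m * ((4 * s) ^ (m ^ 2) * (indT G P).card)) := by
          gcongr <;> omega
      _ = (4 * s) ^ (m ^ 2 + m + 1) * (indT G P).card := by ring
      _ ≤ _ := by
          gcongr
          nlinarith

lemma lemma2e {V : Type} [Fintype V] (G : SimpleGraph V) {s : ℕ} (h1s : 1 ≤ s) (h : NoBic G s) (m : ℕ)
    (P : Fin m → Finset V) (hP : ∀ i, m * (4 * s) ^ (m + 1) ≤ (P i).card) :
    ∃ x : Fin m → V, (∀ i, x i ∈ P i) ∧ ∀ i j, ¬ G.Adj (x i) (x j) := by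
  have h1 := lemma2 G h1s h m P hP
  have h2 : 0 < ∏ i, (P i).card := by
    apply Finset.prod_pos
    intro i _
    refine lt_of_lt_of_le ?_ (hP i)
    have : 0 < m := Fin.pos i
    positivity
  have h3 : 0 < (indT G P).card := by
    by_contra h0
    have : (indT G P).card = 0 := by omega
    rw [this] at h1; omega
  obtain ⟨x, hx⟩ := Finset.card_pos.1 h3
  exact ⟨x, (mem_indT G P x).1 hx⟩


def Qs {V : Type} [Fintype V] (G : SimpleGraph V) (B : Finset V) {D q : ℕ} (I : Fin D → Fin q → Prop)
    (y : Fin D → V) (l : Fin q) : Finset V :=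
  B.filter (fun v => ∀ i, G.Adj (y i) v ↔ I i l)

def tr {V : Type} (G : SimpleGraph V) {t : ℕ} (Y : Fin t → V) (v : V) : Finset (Fin t) :=
  Finset.univ.filter (fun i => G.Adj (Y i) v)

lemma sum_choose_le (t D : ℕ) : ∑ k ∈ Finset.range D, t.choose k ≤ (t + 1) ^ D := by
  induction D with
  | zero => simp
  | succ D ih =>
    rw [Finset.sum_range_succ, pow_succ]
    have h1 : t.choose D ≤ t ^ D := Nat.choose_le_pow t D
    have h2 : t ^ D ≤ (t + 1) ^ D := Nat.pow_le_pow_left (by omega) D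
    rcases Nat.eq_zero_or_pos t with h | h
    · subst h
      rcases Nat.eq_zero_or_pos D with h' | h'
      · subst h'; simp
      · rw [Nat.choose_eq_zero_of_lt h']; omega
    · nlinarith

lemma lemma4 {V : Type} [Fintype V] (G : SimpleGraph V) {s : ℕ} (h1s : 1 ≤ s) (h : NoBic G s)
    {D q : ℕ} (I : Fin D → Fin q → Prop) {t : ℕ} (Y : Fin t → V) (hY : Function.Injective Y)
    (B : Finset V) (μ : ℕ) (hD : 1 ≤ D)
    (hno : ∀ e : Fin D → Fin t, Function.Injective e → ∃ l, (Qs G B I (Y ∘ e) l).card < μ) :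
    ∃ 𝒜 : Finset (Finset (Fin t)), 𝒜.card ≤ (t + 1) ^ D ∧ (∀ S ∈ 𝒜, S.card < s) ∧
      ∀ M ⊆ B, t ^ D * q * μ + (t + 1) ^ D * s ≤ M.card → ∃ v ∈ M, tr G Y v ∈ 𝒜 := by
  let ix : Finset ((Fin D → Fin t) × Fin q) := Finset.univ.filter (fun z => (Qs G B I (Y ∘ z.1) z.2).card < μ)
  let Bad : Finset V := ix.biUnion (fun z => Qs G B I (Y ∘ z.1) z.2)
  have hBad : Bad.card ≤ t ^ D * q * μ := by
    refine Finset.card_biUnion_le.trans ?_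
    have h1 : ∑ z ∈ ix, (Qs G B I (Y ∘ z.1) z.2).card ≤ ix.card • μ := by
      apply Finset.sum_le_card_nsmul
      intro z hz
      exact (Finset.mem_filter.1 hz).2.le
    have h2 : ix.card ≤ t ^ D * q := by
      refine (Finset.card_le_univ _).trans ?_
      simp
    refine h1.trans ?_
    rw [smul_eq_mul]
    gcongr
  let 𝒯 : Finset (Finset (Fin t)) := (B \ Bad).image (tr G Y)
  have hvc : 𝒯.vcDim < D := by
    by_contra hc
    push Not at hc
    obtain ⟨X0, hX0, hX0c⟩ := Finset.exists_mem_eq_sup 𝒯.shatterer (by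
      by_contra hemp
      rw [Finset.not_nonempty_iff_eq_empty] at hemp
      have : 𝒯.vcDim = 0 := by simp [Finset.vcDim, hemp]
      omega) Finset.card
    have hX0c' : D ≤ X0.card := by
      rw [← hX0c]; exact hc
    obtain ⟨X, hXX, hXc⟩ := Finset.exists_subset_card_eq hX0c'
    have hsh : 𝒯.Shatters X := (Finset.mem_shatterer.1 hX0).mono_right hXX
    let e := X.orderEmbOfFin hXc
    obtain ⟨l, hl⟩ := hno e e.injective
    obtain ⟨T, hT, hTX⟩ := hsh (t := X.filter (fun j => ∃ i, e i = j ∧ I i l)) (Finset.filter_subset _ _)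
    obtain ⟨v, hv, rfl⟩ := Finset.mem_image.1 hT
    have hv' := Finset.mem_sdiff.1 hv
    apply hv'.2
    refine Finset.mem_biUnion.2 ⟨(e, l), by simpa [ix] using hl, ?_⟩
    refine Finset.mem_filter.2 ⟨hv'.1, ?_⟩
    intro i
    have hei : e i ∈ X := Finset.orderEmbOfFin_mem X hXc i
    have h1 : e i ∈ X ∩ tr G Y v ↔ e i ∈ X.filter (fun j => ∃ i, e i = j ∧ I i l) := by rw [hTX]
    simp only [Finset.mem_inter, hei, true_and, Finset.mem_filter, tr, Finset.mem_univ] at h1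
    rw [Function.comp_apply, h1]
    constructor
    · rintro ⟨i', hi', hI⟩
      rwa [e.injective hi'] at hI
    · intro hI; exact ⟨i, rfl, hI⟩
  have h𝒯 : 𝒯.card ≤ (t + 1) ^ D := by
    refine (Finset.card_le_card_shatterer 𝒯).trans ((Finset.card_shatterer_le_sum_vcDim).trans ?_)
    refine le_trans ?_ (sum_choose_le t D)
    rw [Fintype.card_fin]
    apply Finset.sum_le_sum_of_subset
    intro k hk
    simp only [Finset.mem_Iic, Finset.mem_range] at hk ⊢
    omega
  refine ⟨𝒯.filter (fun S => S.card < s), (Finset.card_le_card (Finset.filter_subset _ _)).trans h𝒯,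
    fun S hS => (Finset.mem_filter.1 hS).2, ?_⟩
  intro M hM hMc
  have h1 := Finset.le_card_sdiff Bad M
  have h2 : 𝒯.card * s ≤ (M \ Bad).card := by
    have : 𝒯.card * s ≤ (t+1)^D * s := by gcongr
    omega
  have h3 : ∀ v ∈ M \ Bad, tr G Y v ∈ 𝒯 := by
    intro v hv
    apply Finset.mem_image_of_mem
    exact Finset.sdiff_subset_sdiff hM le_rfl hv
  have h4 : 𝒯.Nonempty := by
    have : 0 < (t+1)^D * s := by positivity
    obtain ⟨v, hv⟩ := Finset.card_pos.1 (by omega : 0 < (M \ Bad).card)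
    exact ⟨_, h3 v hv⟩
  obtain ⟨T, hT, hTs⟩ := Finset.exists_le_card_fiber_of_mul_le_card_of_maps_to h3 h4 h2
  have hTsm : T.card < s := by
    by_contra hc
    push Not at hc
    obtain ⟨T', hT', hT'c⟩ := Finset.exists_subset_card_eq hc
    obtain ⟨R, hR, hRc⟩ := Finset.exists_subset_card_eq hTs
    have hadj : ∀ a ∈ T'.image Y, ∀ b ∈ R, G.Adj a b := by
      intro a ha b hb
      obtain ⟨i, hi, rfl⟩ := Finset.mem_image.1 ha
      have h5 := (Finset.mem_filter.1 (hR hb)).2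
      have h6 := hT' hi
      rw [← h5] at h6
      simpa [tr] using h6
    exact h ⟨T'.image Y, R, by
      rw [Finset.disjoint_left]; intro a ha hb; exact (G.loopless.irrefl a) (hadj a ha a hb),
      by rw [Finset.card_image_of_injective _ hY, hT'c], hRc, hadj⟩
  obtain ⟨v, hv⟩ := Finset.card_pos.1 (lt_of_lt_of_le h1s hTs)
  have hv' := Finset.mem_filter.1 hv
  exact ⟨v, (Finset.mem_sdiff.1 hv'.1).1, by rw [hv'.2]; exact Finset.mem_filter.2 ⟨hT, hTsm⟩⟩


/-- polynomially bounded -/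
def PB (h : ℕ → ℕ) : Prop := ∃ C : ℕ, ∀ x, 1 ≤ x → h x ≤ C * x ^ C

lemma PB.const (c : ℕ) : PB (fun _ => c) := ⟨c, fun x hx => by
  have : 1 ≤ x ^ c := Nat.one_le_pow _ _ hx
  nlinarith⟩

lemma PB.id : PB (fun x => x) := ⟨1, fun x _ => by simp⟩

lemma PB.add {f g : ℕ → ℕ} (hf : PB f) (hg : PB g) : PB (fun x => f x + g x) := by
  obtain ⟨a, ha⟩ := hf
  obtain ⟨b, hb⟩ := hg
  refine ⟨a + b, fun x hx => ?_⟩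
  have h1 : x ^ a ≤ x ^ (a + b) := Nat.pow_le_pow_right hx (by omega)
  have h2 : x ^ b ≤ x ^ (a + b) := Nat.pow_le_pow_right hx (by omega)
  have := ha x hx
  have := hb x hx
  nlinarith [Nat.mul_le_mul_left a h1, Nat.mul_le_mul_left b h2]

lemma PB.mul {f g : ℕ → ℕ} (hf : PB f) (hg : PB g) : PB (fun x => f x * g x) := by
  obtain ⟨a, ha⟩ := hf
  obtain ⟨b, hb⟩ := hg
  refine ⟨a * b + a + b, fun x hx => ?_⟩
  calc f x * g x ≤ (a * x ^ a) * (b * x ^ b) := Nat.mul_le_mul (ha x hx) (hb x hx)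
    _ = a * b * x ^ (a + b) := by ring
    _ ≤ (a * b + a + b) * x ^ (a * b + a + b) := by
        apply Nat.mul_le_mul (by omega)
        exact Nat.pow_le_pow_right hx (by omega)

lemma PB.pow {f : ℕ → ℕ} (hf : PB f) (k : ℕ) : PB (fun x => f x ^ k) := by
  induction k with
  | zero => simpa using PB.const 1
  | succ k ih => simpa [pow_succ] using ih.mul hf

lemma PB.comp {f g : ℕ → ℕ} (hf : PB f) (hg : PB g) (hg1 : ∀ x, 1 ≤ x → 1 ≤ g x) : PB (fun x => f (g x)) := by
  obtain ⟨a, ha⟩ := hf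
  obtain ⟨C, hC⟩ := (PB.const a).mul (hg.pow a)
  exact ⟨C, fun x hx => (ha _ (hg1 x hx)).trans (hC x hx)⟩

def pw {V : Type} (U : Finset V) (t : ℕ) : Finset (Fin t → V) := Fintype.piFinset (fun _ => U)

lemma mem_pw {V : Type} {U : Finset V} {t : ℕ} {Y : Fin t → V} : Y ∈ pw U t ↔ ∀ i, Y i ∈ U := by
  simp [pw]

lemma card_pw {V : Type} (U : Finset V) (t : ℕ) : (pw U t).card = U.card ^ t := by
  simp [pw, Fintype.card_piFinset]

lemma cyl {V : Type} (U : Finset V) {D t : ℕ} (e : Fin D → Fin t) (he : Function.Injective e)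
    (p : (Fin D → V) → Prop) [DecidablePred p] :
    ((pw U t).filter (fun Y => p (Y ∘ e))).card * U.card ^ D = ((pw U D).filter p).card * U.card ^ t := by
  have hfib : ∀ y ∈ pw U D, ((pw U t).filter (fun Y => Y ∘ e = y)).card * U.card ^ D = U.card ^ t := by
    intro y hy
    have h1 : (pw U t).filter (fun Y => Y ∘ e = y) =
        Fintype.piFinset (fun j => if h : ∃ i, e i = j then {y h.choose} else U) := by
      ext Y
      simp only [Finset.mem_filter, mem_pw, Fintype.mem_piFinset]
      constructor
      · rintro ⟨hY, rfl⟩ j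
        split_ifs with h
        · have := h.choose_spec
          simp [this]
        · exact hY j
      · intro hY
        have h2 : Y ∘ e = y := by
          funext i
          have := hY (e i)
          have hex : ∃ i', e i' = e i := ⟨i, rfl⟩
          rw [dif_pos hex] at this
          have h3 := he hex.choose_spec
          rw [h3] at this
          simpa using this
        refine ⟨?_, h2⟩
        intro j
        by_cases h : ∃ i, e i = j
        · obtain ⟨i, rfl⟩ := h
          have := congrFun h2 i
          simp only [Function.comp_apply] at this
          rw [this]; exact mem_pw.1 hy i
        · have := hY j
          rwa [dif_neg h] at this
    rw [h1, Fintype.card_piFinset]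
    have h2 : ∀ j, ((if h : ∃ i, e i = j then {y h.choose} else U : Finset V)).card =
        if j ∈ Finset.univ.image e then 1 else U.card := by
      intro j
      by_cases h : ∃ i, e i = j
      · simp [h]
      · simp [h]
    simp_rw [h2]
    rw [Finset.prod_ite]
    simp only [Finset.prod_const_one, one_mul, Finset.prod_const]
    rw [← pow_add]
    congr 1
    have h3 : (Finset.univ.image e).card = D := by
      rw [Finset.card_image_of_injective _ he]; simp
    have h4 := Finset.card_filter_add_card_filter_not (s := (Finset.univ : Finset (Fin t))) (fun j => j ∈ Finset.univ.image e)
    rw [Finset.filter_mem_eq_inter, Finset.univ_inter, h3] at h4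
    simp at h4 ⊢
    omega
  have h1 : ((pw U t).filter (fun Y => p (Y ∘ e))).card =
      ∑ y ∈ (pw U D).filter p, ((pw U t).filter (fun Y => Y ∘ e = y)).card := by
    rw [Finset.card_eq_sum_card_fiberwise (f := fun Y => Y ∘ e) (t := (pw U D).filter p)]
    · apply Finset.sum_congr rfl
      intro y hy
      congr 1
      ext Y
      simp only [Finset.mem_filter] at hy ⊢
      constructor
      · rintro ⟨⟨h1, h2⟩, h3⟩; exact ⟨h1, h3⟩
      · rintro ⟨h1, h3⟩; exact ⟨⟨h1, by rw [h3]; exact hy.2⟩, h3⟩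
    · intro Y hY
      simp only [Finset.coe_filter, Set.mem_ofPred_eq, mem_pw] at hY ⊢
      exact ⟨fun i => hY.1 _, hY.2⟩
  rw [h1, Finset.sum_mul, Finset.sum_congr rfl (fun y hy => hfib y (Finset.mem_filter.1 hy).1)]
  simp

lemma cyl1 {V : Type} (U : Finset V) {t : ℕ} (i : Fin t) (p : V → Prop) [DecidablePred p] :
    ((pw U t).filter (fun Y => p (Y i))).card * U.card = (U.filter p).card * U.card ^ t := by
  have h := cyl U (fun _ : Fin 1 => i) (fun a b _ => Subsingleton.elim a b) (fun y => p (y 0))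
  simp only [pow_one, Function.comp_apply] at h
  rw [h]
  congr 1
  apply Finset.card_bij (fun y _ => y 0)
  · intro y hy
    simp only [Finset.mem_filter, mem_pw] at hy ⊢
    exact ⟨hy.1 0, hy.2⟩
  · intro y _ y' _ h
    funext j
    rw [Subsingleton.elim j 0]; exact h
  · intro v hv
    refine ⟨fun _ => v, ?_, rfl⟩
    simp only [Finset.mem_filter, mem_pw] at hv ⊢
    exact ⟨fun _ => hv.1, hv.2⟩

lemma cyl2 {V : Type} (U : Finset V) {t : ℕ} (i j : Fin t) (hij : i ≠ j) (p : V → V → Prop) :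
    ((pw U t).filter (fun Y => p (Y i) (Y j))).card * U.card ^ 2 =
      ((U ×ˢ U).filter (fun z => p z.1 z.2)).card * U.card ^ t := by
  have h := cyl U (D := 2) (![i, j] : Fin 2 → Fin t) (by
    intro a b hab
    fin_cases a <;> fin_cases b <;> simp_all) (fun y => p (y 0) (y 1))
  simp only [Function.comp_apply, Matrix.cons_val_zero, Matrix.cons_val_one] at h
  trans ((pw U 2).filter (fun y => p (y 0) (y 1))).card * U.card ^ t
  · convert h using 2
    congr 1
  congr 1
  apply Finset.card_bij (fun y _ => (y 0, y 1))
  · intro y hy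
    simp only [Finset.mem_filter, mem_pw, Finset.mem_product] at hy ⊢
    exact ⟨⟨hy.1 0, hy.1 1⟩, hy.2⟩
  · intro y _ y' _ h
    simp only [Prod.mk.injEq] at h
    funext j
    fin_cases j
    · exact h.1
    · exact h.2
  · intro v hv
    refine ⟨![v.1, v.2], ?_, rfl⟩
    simp only [Finset.mem_filter, mem_pw, Finset.mem_product] at hv ⊢
    refine ⟨fun k => ?_, hv.2⟩
    fin_cases k
    · exact hv.1.1
    · exact hv.1.2

/-- number of ordered adjacent pairs -/
def e2 {V : Type} (G : SimpleGraph V) (U : Finset V) : ℕ :=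
  ((U ×ˢ U).filter (fun z => G.Adj z.1 z.2)).card

lemma e2_eq {V : Type} (G : SimpleGraph V) (U : Finset V) :
    e2 G U = ∑ v ∈ U, (U.filter (fun w => G.Adj w v)).card := by
  unfold e2
  rw [Finset.card_filter, Finset.sum_product_right]
  simp_rw [Finset.card_filter]

lemma noninj {V : Type} (U : Finset V) (hU : U.Nonempty) (t : ℕ) :
    ((pw U t).filter (fun Y => ¬ Function.Injective Y)).card * U.card ≤ t ^ 2 * U.card ^ t := by
  have hu : 0 < U.card := Finset.card_pos.2 hU
  have h1 : (pw U t).filter (fun Y => ¬ Function.Injective Y) ⊆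
      ((Finset.univ : Finset (Fin t × Fin t)).filter (fun z => z.1 ≠ z.2)).biUnion
        (fun z => (pw U t).filter (fun Y => Y z.1 = Y z.2)) := by
    intro Y hY
    simp only [Finset.mem_filter, Function.Injective, not_forall] at hY
    obtain ⟨hY, i, j, hij, hne⟩ := hY
    exact Finset.mem_biUnion.2 ⟨(i, j), by simpa using hne, by simp [hY, hij]⟩
  have h2 : ∀ z : Fin t × Fin t, z.1 ≠ z.2 → ((pw U t).filter (fun Y => Y z.1 = Y z.2)).card * U.card = U.card ^ t := by
    intro z hz
    have := cyl2 U z.1 z.2 hz (fun a b => a = b)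
    have h3 : ((U ×ˢ U).filter (fun z => z.1 = z.2)).card = U.card := by
      apply Finset.card_bij (fun z _ => z.1)
      · intro a ha; exact (Finset.mem_product.1 (Finset.mem_filter.1 ha).1).1
      · rintro ⟨a, b⟩ ha ⟨a', b'⟩ ha' h
        have := (Finset.mem_filter.1 ha).2
        have := (Finset.mem_filter.1 ha').2
        simp_all
      · intro b hb; exact ⟨(b, b), by simp [hb], rfl⟩
    rw [h3] at this
    have h4 : U.card * (((pw U t).filter (fun Y => Y z.1 = Y z.2)).card * U.card) = U.card * U.card ^ t := by
      rw [← this]; ring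
    exact Nat.eq_of_mul_eq_mul_left hu h4
  calc _ ≤ (∑ z ∈ (Finset.univ : Finset (Fin t × Fin t)).filter (fun z => z.1 ≠ z.2),
        ((pw U t).filter (fun Y => Y z.1 = Y z.2)).card) * U.card :=
        Nat.mul_le_mul_right _ ((Finset.card_le_card h1).trans Finset.card_biUnion_le)
    _ = ∑ z ∈ (Finset.univ : Finset (Fin t × Fin t)).filter (fun z => z.1 ≠ z.2), U.card ^ t := by
        rw [Finset.sum_mul]
        exact Finset.sum_congr rfl (fun z hz => h2 z (Finset.mem_filter.1 hz).2)
    _ ≤ t ^ 2 * U.card ^ t := by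
        rw [Finset.sum_const, smul_eq_mul]
        apply Nat.mul_le_mul_right
        refine (Finset.card_le_univ _).trans ?_
        simp [sq]


/-- first part of Lemma 5: many robust tuples. -/
lemma lemma5a {V : Type} [Fintype V] (G : SimpleGraph V) {x : ℕ} (h1 : 1 ≤ x) (h : NoBic G x)
    {D q : ℕ} (hD : 1 ≤ D) (I : Fin D → Fin q → Prop) (U : Finset V) (μ t : ℕ) (ht : t = 4 * x ^ 2)
    (hu3 : t ^ 3 ≤ U.card) (hN : t * (t ^ D * q * μ + (t + 1) ^ D * x) ≤ U.card)
    (hd : U.card ^ 2 ≤ e2 G U * x) :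
    U.card ^ D ≤ t ^ (D + 1) * ((pw U D).filter (fun y => ∀ l, μ ≤ (Qs G U I y l).card)).card := by
  set u := U.card with hu
  have ht1 : 1 ≤ t := by rw [ht]; nlinarith
  have hupos : 0 < u := lt_of_lt_of_le (by positivity) hu3
  set R := (pw U D).filter (fun y => ∀ l, μ ≤ (Qs G U I y l).card) with hR
  set Ω := pw U t with hΩ
  let g : (Fin t → V) → ℕ := fun Y => ∑ v ∈ U, (tr G Y v).card
  -- total
  have htot : 4 * x * u * u ^ t ≤ ∑ Y ∈ Ω, g Y := by
    have e1 : (∑ Y ∈ Ω, g Y) * u = t * e2 G U * u ^ t := by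
      have : ∑ Y ∈ Ω, g Y = ∑ v ∈ U, ∑ i : Fin t, (Ω.filter (fun Y => G.Adj (Y i) v)).card := by
        simp only [g]
        rw [Finset.sum_comm]
        apply Finset.sum_congr rfl
        intro v _
        simp only [tr, Finset.card_filter]
        rw [Finset.sum_comm]
      rw [this, Finset.sum_mul]
      simp_rw [Finset.sum_mul]
      have h2 : ∀ v, ∀ i : Fin t, (Ω.filter (fun Y => G.Adj (Y i) v)).card * u =
          (U.filter (fun w => G.Adj w v)).card * u ^ t := fun v i => cyl1 U i (fun w => G.Adj w v)
      simp_rw [h2]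
      rw [e2_eq]
      simp only [Finset.sum_const, Finset.card_univ, Fintype.card_fin, smul_eq_mul]
      rw [Finset.mul_sum, Finset.sum_mul]
      apply Finset.sum_congr rfl
      intros; ring
    have e3 : (x * u) * (4 * x * u * u ^ t) ≤ (x * u) * ∑ Y ∈ Ω, g Y := by
      calc (x * u) * (4 * x * u * u ^ t) = t * (u ^ 2) * u ^ t := by rw [ht]; ring
        _ ≤ t * (e2 G U * x) * u ^ t := by gcongr
        _ = x * (t * e2 G U * u ^ t) := by ring
        _ = x * ((∑ Y ∈ Ω, g Y) * u) := by rw [e1]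
        _ = _ := by ring
    exact Nat.le_of_mul_le_mul_left e3 (by positivity)
  have hgle : ∀ Y, g Y ≤ t * u := by
    intro Y
    have : g Y ≤ U.card • t := Finset.sum_le_card_nsmul _ _ _ (fun v _ => (Finset.card_le_univ _).trans (by simp))
    rw [smul_eq_mul] at this
    linarith
  let NI := Ω.filter (fun Y => ¬ Function.Injective Y)
  let Rob := Finset.univ.biUnion (fun e : Fin D → Fin t => if Function.Injective e then Ω.filter (fun Y => Y ∘ e ∈ R) else ∅)
  have hNI : NI.card * u ≤ t ^ 2 * u ^ t := noninj U (Finset.card_pos.1 hupos) t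
  have hRob : Rob.card * u ^ D ≤ t ^ D * R.card * u ^ t := by
    have e1 : Rob.card ≤ ∑ e : Fin D → Fin t, (if Function.Injective e then Ω.filter (fun Y => Y ∘ e ∈ R) else ∅).card :=
      Finset.card_biUnion_le
    have e2 : ∀ e : Fin D → Fin t, (if Function.Injective e then Ω.filter (fun Y => Y ∘ e ∈ R) else ∅).card * u ^ D
        ≤ R.card * u ^ t := by
      intro e
      split_ifs with he
      · have := cyl U e he (fun y => y ∈ R)
        refine this.trans_le ?_
        gcongr
        intro y hy
        exact (Finset.mem_filter.1 hy).2
      · simp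
    calc Rob.card * u ^ D ≤ (∑ e : Fin D → Fin t, (if Function.Injective e then Ω.filter (fun Y => Y ∘ e ∈ R) else ∅).card) * u ^ D := by
          gcongr
      _ ≤ ∑ e : Fin D → Fin t, R.card * u ^ t := by
          rw [Finset.sum_mul]; exact Finset.sum_le_sum (fun e _ => e2 e)
      _ = _ := by simp [mul_assoc]
  have hnorob : ∀ Y ∈ Ω, Y ∉ NI → Y ∉ Rob → g Y ≤ 2 * x * u := by
    intro Y hY hni hrob
    have hinj : Function.Injective Y := by
      by_contra hc
      exact hni (Finset.mem_filter.2 ⟨hY, hc⟩)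
    have hno : ∀ e : Fin D → Fin t, Function.Injective e → ∃ l, (Qs G U I (Y ∘ e) l).card < μ := by
      intro e he
      by_contra hc
      push Not at hc
      apply hrob
      refine Finset.mem_biUnion.2 ⟨e, Finset.mem_univ _, ?_⟩
      rw [if_pos he]
      refine Finset.mem_filter.2 ⟨hY, Finset.mem_filter.2 ⟨mem_pw.2 (fun i => mem_pw.1 hY _), hc⟩⟩
    obtain ⟨𝒜, -, hs, hM⟩ := lemma4 G h1 h I Y hinj U μ hD hno
    let M := U.filter (fun v => x ≤ (tr G Y v).card)
    have hMc : M.card < t ^ D * q * μ + (t + 1) ^ D * x := by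
      by_contra hc
      push Not at hc
      obtain ⟨v, hv, hv2⟩ := hM M (Finset.filter_subset _ _) hc
      have := hs _ hv2
      have := (Finset.mem_filter.1 hv).2
      omega
    have e1 : g Y ≤ ∑ v ∈ U, (x + if x ≤ (tr G Y v).card then t else 0) := by
      apply Finset.sum_le_sum
      intro v _
      have : (tr G Y v).card ≤ t := (Finset.card_le_univ _).trans (by simp)
      split_ifs <;> omega
    rw [Finset.sum_add_distrib, ← Finset.sum_filter] at e1
    simp only [Finset.sum_const, smul_eq_mul] at e1
    have e2 : M.card * t ≤ u := by
      refine le_trans ?_ hN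
      rw [mul_comm]
      gcongr
    have e3 : u ≤ x * u := Nat.le_mul_of_pos_left _ h1
    have e4 : g Y ≤ u * x + M.card * t := e1
    nlinarith
  have hsum : ∑ Y ∈ Ω, g Y ≤ NI.card * (t * u) + Rob.card * (t * u) + u ^ t * (2 * x * u) := by
    have e1 : ∑ Y ∈ Ω, g Y ≤ ∑ Y ∈ Ω, ((if Y ∈ NI then t * u else 0) + (if Y ∈ Rob then t * u else 0) + 2 * x * u) := by
      apply Finset.sum_le_sum
      intro Y hY
      have := hgle Y
      by_cases c1 : Y ∈ NI
      · simp only [c1, if_true]; omega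
      · by_cases c2 : Y ∈ Rob
        · simp only [c2, if_true]; omega
        · have := hnorob Y hY c1 c2; omega
    refine e1.trans ?_
    rw [Finset.sum_add_distrib, Finset.sum_add_distrib, ← Finset.sum_filter, ← Finset.sum_filter]
    simp only [Finset.sum_const, smul_eq_mul]
    rw [show Ω.card = u ^ t from card_pw U t]
    gcongr
    · intro Y hY; exact (Finset.mem_filter.1 hY).2
    · intro Y hY; exact (Finset.mem_filter.1 hY).2
  -- combine
  have hA : 2 * x * u * u ^ t ≤ NI.card * (t * u) + Rob.card * (t * u) := by nlinarith
  have hB : NI.card * (t * u) ≤ x * u * u ^ t := by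
    calc NI.card * (t * u) = t * (NI.card * u) := by ring
      _ ≤ t * (t ^ 2 * u ^ t) := by gcongr
      _ = t ^ 3 * u ^ t := by ring
      _ ≤ u * u ^ t := by gcongr
      _ ≤ x * u * u ^ t := by
          apply Nat.mul_le_mul_right; exact Nat.le_mul_of_pos_left _ h1
  have hC : x * u * u ^ t ≤ Rob.card * (t * u) := by nlinarith
  have hD' : (u * u ^ t) * (u ^ D) ≤ (u * u ^ t) * (t ^ (D + 1) * R.card) := by
    calc (u * u ^ t) * (u ^ D) ≤ (x * u * u ^ t) * u ^ D := by
          apply Nat.mul_le_mul_right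
          rw [mul_assoc]
          exact Nat.le_mul_of_pos_left _ h1
      _ ≤ Rob.card * (t * u) * u ^ D := by gcongr
      _ = (Rob.card * u ^ D) * (t * u) := by ring
      _ ≤ (t ^ D * R.card * u ^ t) * (t * u) := by gcongr
      _ = _ := by ring
  exact Nat.le_of_mul_le_mul_left hD' (by positivity)


lemma lemma5b {V : Type} [Fintype V] (G : SimpleGraph V) {x : ℕ} (h1 : 1 ≤ x) (h : NoBic G x)
    {K D q : ℕ} (P : Pat K D q) (hNW : NW G K) (U : Finset V) (μ a w : ℕ)
    (hR : U.card ^ D ≤ a * ((pw U D).filter (fun y => ∀ l, μ ≤ (Qs G U P.I y l).card)).card)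
    (hμ : q * (4 * x) ^ (q + 1) ≤ μ) (hw : U.card ≤ w * μ)
    (hX : (4 * x) ^ (q ^ 2) * a * w ^ q * (D * (4 * x) ^ (D + 1)) ≤ U.card) (hU : 0 < U.card) : False := by
  set u := U.card with hu
  set R := (pw U D).filter (fun y => ∀ l, μ ≤ (Qs G U P.I y l).card) with hRdef
  set Z := (4 * x) ^ (q ^ 2) with hZ
  have hZ1 : 1 ≤ Z := Nat.one_le_pow _ _ (by omega)
  -- lower bound on pairs
  have hlow : R.card * μ ^ q ≤ Z * ∑ y ∈ R, (indT G (Qs G U P.I y)).card := by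
    rw [Finset.mul_sum, ← smul_eq_mul R.card]
    apply Finset.card_nsmul_le_sum
    intro y hy
    have hy' := (Finset.mem_filter.1 hy).2
    refine le_trans ?_ (lemma2 G h1 h q (Qs G U P.I y) (fun l => hμ.trans (hy' l)))
    calc μ ^ q = ∏ l : Fin q, μ := by simp
      _ ≤ _ := Finset.prod_le_prod' (fun l _ => hy' l)
  have hdc : ∑ y ∈ R, (indT G (Qs G U P.I y)).card = ∑ b ∈ pw U q, (R.filter (fun y => b ∈ indT G (Qs G U P.I y))).card := by
    have : ∀ y, indT G (Qs G U P.I y) = (pw U q).filter (fun b => b ∈ indT G (Qs G U P.I y)) := by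
      intro y
      ext b
      simp only [Finset.mem_filter, mem_pw]
      constructor
      · intro hb
        exact ⟨fun l => (Finset.mem_filter.1 (((mem_indT _ _ _).1 hb).1 l)).1, hb⟩
      · exact fun hb => hb.2
    calc _ = ∑ y ∈ R, ((pw U q).filter (fun b => b ∈ indT G (Qs G U P.I y))).card := by
            apply Finset.sum_congr rfl
            intro y _
            rw [← this]
      _ = _ := by
            simp_rw [Finset.card_filter]
            rw [Finset.sum_comm]
  have hRpos : 0 < R.card := by
    by_contra hc
    have : R.card = 0 := by omega
    rw [this] at hR
    have : 0 < u ^ D := by positivity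
    omega
  have hμpos : 0 < μ := by
    by_contra hc
    have : μ = 0 := by omega
    rw [this] at hw; omega
  have hb : ∃ b ∈ pw U q, R.card * μ ^ q ≤ Z * u ^ q * (R.filter (fun y => b ∈ indT G (Qs G U P.I y))).card := by
    by_contra hc
    push Not at hc
    have hne : (pw U q).Nonempty := by
      rw [← Finset.card_pos, card_pw]; positivity
    have h2 : ∑ b ∈ pw U q, Z * u ^ q * (R.filter (fun y => b ∈ indT G (Qs G U P.I y))).card < ∑ b ∈ pw U q, R.card * μ ^ q :=
      Finset.sum_lt_sum_of_nonempty hne hc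
    rw [← Finset.mul_sum, ← hdc, Finset.sum_const, smul_eq_mul, card_pw, ← hu] at h2
    have h3 := Nat.mul_le_mul_left (u ^ q) hlow
    nlinarith
  obtain ⟨b, hbU, hb⟩ := hb
  set Yb := R.filter (fun y => b ∈ indT G (Qs G U P.I y)) with hYb
  have hYpos : 0 < Yb.card := by
    by_contra hc
    have : Yb.card = 0 := by omega
    rw [this] at hb
    have : 0 < R.card * μ ^ q := by positivity
    omega
  obtain ⟨y0, hy0⟩ := Finset.card_pos.1 hYpos
  have hbind := ((mem_indT _ _ _).1 (Finset.mem_filter.1 hy0).2).2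
  let Pi : Fin D → Finset V := fun i => U.filter (fun v => ∀ l, G.Adj v (b l) ↔ P.I i l)
  have hPi : ∀ i, D * (4 * x) ^ (D + 1) ≤ (Pi i).card := by
    intro i
    have hsub : Yb ⊆ Fintype.piFinset (fun j => if j = i then Pi i else U) := by
      intro y hy
      have hy1 := Finset.mem_filter.1 hy
      have hy2 := Finset.mem_filter.1 hy1.1
      have hy3 := ((mem_indT _ _ _).1 hy1.2).1
      rw [Fintype.mem_piFinset]
      intro j
      split_ifs with hji
      · subst hji
        refine Finset.mem_filter.2 ⟨mem_pw.1 hy2.1 j, fun l => ?_⟩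
        exact (Finset.mem_filter.1 (hy3 l)).2 j
      · exact mem_pw.1 hy2.1 j
    have hcard := Finset.card_le_card hsub
    rw [Fintype.card_piFinset] at hcard
    have h2 : ∏ j, (if j = i then Pi i else U).card = (Pi i).card * u ^ (D - 1) := by
      rw [← Finset.mul_prod_erase _ _ (Finset.mem_univ i)]
      simp only [if_true]
      congr 1
      rw [Finset.prod_congr rfl (g := fun _ => u)]
      · simp [Finset.card_erase_of_mem]
      · intro j hj
        rw [if_neg (Finset.ne_of_mem_erase hj)]
    rw [h2] at hcard
    have hDD : u ^ D = u ^ (D - 1) * u := by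
      rw [← pow_succ]; congr 1; have := P.Dpos; omega
    -- combine
    have h3 : (u ^ (D - 1) * u ^ q) * u ≤ (u ^ (D - 1) * u ^ q) * (Z * a * w ^ q * (Pi i).card) := by
      calc (u ^ (D - 1) * u ^ q) * u = u ^ D * u ^ q := by rw [hDD]; ring
        _ ≤ (a * R.card) * (w * μ) ^ q := by gcongr
        _ = a * w ^ q * (R.card * μ ^ q) := by ring
        _ ≤ a * w ^ q * (Z * u ^ q * Yb.card) := by gcongr
        _ ≤ a * w ^ q * (Z * u ^ q * ((Pi i).card * u ^ (D - 1))) := by gcongr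
        _ = _ := by ring
    have h4 := Nat.le_of_mul_le_mul_left h3 (by positivity)
    have h5 := hX.trans h4
    refine Nat.le_of_mul_le_mul_left h5 ?_
    rw [pos_iff_ne_zero]
    intro h0
    rw [h0] at h4
    omega
  obtain ⟨y, hy1, hy2⟩ := lemma2e G h1 h D Pi hPi
  exact lemma3 G P hNW y b (fun i l => (Finset.mem_filter.1 (hy1 i)).2 l) hy2 hbind

lemma lemma5 {K D q : ℕ} (P : Pat K D q) : ∃ h : ℕ → ℕ, PB h ∧ ∀ (V : Type) [Fintype V] (G : SimpleGraph V) (x : ℕ),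
    1 ≤ x → NoBic G x → NW G K → ∀ U : Finset V, h x ≤ U.card → e2 G U * x < U.card ^ 2 := by
  let T : ℕ → ℕ := fun x => 4 * x ^ 2
  let W : ℕ → ℕ := fun x => 2 * T x ^ (D + 1) * q
  have hT : PB T := (PB.const 4).mul (PB.id.pow 2)
  have hW : PB W := ((PB.const 2).mul (hT.pow _)).mul (PB.const q)
  have h4 : PB (fun x => 4 * x) := (PB.const 4).mul PB.id
  refine ⟨fun x => T x ^ 3 + 2 * (T x * ((T x + 1) ^ D * x)) + W x * (q * (4 * x) ^ (q + 1) + 1)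
    + (4 * x) ^ (q ^ 2) * T x ^ (D + 1) * (2 * W x) ^ q * (D * (4 * x) ^ (D + 1)), ?_, ?_⟩
  · exact (((hT.pow 3).add ((PB.const 2).mul (hT.mul (((hT.add (PB.const 1)).pow D).mul PB.id)))).add
      (hW.mul (((PB.const q).mul (h4.pow _)).add (PB.const 1)))).add
      ((((h4.pow _).mul (hT.pow _)).mul (((PB.const 2).mul hW).pow q)).mul ((PB.const D).mul (h4.pow _)))
  · intro V _ G x hx hB hNW U hU
    by_contra hc
    push Not at hc
    set u := U.card with hu
    beta_reduce at hU
    have hD := P.Dpos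
    have hq : 1 ≤ q := by
      have h2 := P.pt ⟨0, hD⟩
      have h3 := Finset.card_le_univ (Finset.univ.filter (fun l => P.I ⟨0, hD⟩ l))
      simp only [Fintype.card_fin] at h3
      have := P.two
      omega
    have hTpos : 0 < T x := by simp only [T]; positivity
    have hWpos : 0 < W x := by simp only [W]; positivity
    have hT3 : 0 < T x ^ 3 := by positivity
    have e1 : T x ^ 3 ≤ u := by omega
    have e2 : 2 * (T x * ((T x + 1) ^ D * x)) ≤ u := by omega
    have e3 : W x * (q * (4 * x) ^ (q + 1) + 1) ≤ u := by omega
    have e4 : (4 * x) ^ (q ^ 2) * T x ^ (D + 1) * (2 * W x) ^ q * (D * (4 * x) ^ (D + 1)) ≤ u := by omega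
    have hμ : q * (4 * x) ^ (q + 1) + 1 ≤ u / W x := by
      rw [Nat.le_div_iff_mul_le hWpos]; linarith
    have hmod := Nat.div_add_mod u (W x)
    have hmod2 := Nat.mod_lt u hWpos
    have h5 : W x * (u / W x) ≤ u := Nat.mul_div_le u (W x)
    have hR := lemma5a G hx hB hD P.I U (u / W x) (T x) rfl e1 (by
      have : T x * (T x ^ D * q * (u / W x) + (T x + 1) ^ D * x) * 2 = W x * (u / W x) + 2 * (T x * ((T x + 1) ^ D * x)) := by
        simp only [W]; ring
      omega) hc
    refine lemma5b G hx hB P hNW U (u / W x) (T x ^ (D + 1)) (2 * W x) hR (by omega) ?_ e4 (by omega)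
    have : W x ≤ W x * (u / W x) := Nat.le_mul_of_pos_right _ (by omega)
    have : 2 * W x * (u / W x) = 2 * (W x * (u / W x)) := by ring
    omega


lemma NoBic.mono {V : Type} {G : SimpleGraph V} {x y : ℕ} (h : NoBic G x) (hxy : x ≤ y) : NoBic G y := by
  rintro ⟨A, B, hd, hA, hB, hadj⟩
  obtain ⟨A', hA', hA'c⟩ := Finset.exists_subset_card_eq (hxy.trans hA.ge)
  obtain ⟨B', hB', hB'c⟩ := Finset.exists_subset_card_eq (hxy.trans hB.ge)
  exact h ⟨A', B', hd.mono hA' hB', hA'c, hB'c, fun a ha b hb => hadj a (hA' ha) b (hB' hb)⟩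

set_option maxHeartbeats 1600000 in
lemma lemma6 {K D q : ℕ} (P : Pat K D q) : ∃ h : ℕ → ℕ, PB h ∧ ∀ (V : Type) [Fintype V] (G : SimpleGraph V) (x : ℕ),
    1 ≤ x → NoBic G x → NW G K → ∀ (S B : Finset V) (T : ℕ), h x ≤ S.card → h x ≤ T →
    ((pw S (D + 1)).filter (fun y => T ≤ (B.filter (fun v => ∀ i, G.Adj (y i) v)).card)).card * x ≤ S.card ^ (D + 1) := by
  obtain ⟨h5, h5p, h5h⟩ := lemma5 P
  let tt : ℕ → ℕ := fun x => 2 ^ (D + 2) * x ^ (D + 2) + 2 * (D + 1)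
  let m' : ℕ → ℕ := fun x => 4 * x * tt x ^ 2
  let T0 : ℕ → ℕ := fun x => tt x ^ D * q * (q * (4 * x) ^ (q + 1)) + (tt x + 1) ^ D * x
  have htt : PB tt := ((PB.const _).mul (PB.id.pow _)).add (PB.const _)
  have hm' : PB m' := ((PB.const 4).mul PB.id).mul (htt.pow 2)
  have hT0 : PB T0 := (((htt.pow D).mul (PB.const q)).mul ((PB.const q).mul (((PB.const 4).mul PB.id).pow _))).add
    (((htt.add (PB.const 1)).pow D).mul PB.id)
  have httpos : ∀ x, 1 ≤ tt x := fun x => by simp only [tt]; omega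
  have hm'1 : ∀ x, 1 ≤ x → x ≤ m' x := by
    intro x hx
    have : 1 ≤ tt x ^ 2 := Nat.one_le_pow _ _ (httpos x)
    simp only [m']
    nlinarith
  refine ⟨fun x => m' x + T0 x + h5 (m' x), (hm'.add hT0).add (h5p.comp hm' (fun x hx => hx.trans (hm'1 x hx))), ?_⟩
  intro V _ G x hx hB hNW S B T hS hT
  by_contra hc
  push Not at hc
  beta_reduce at hS hT
  have hM1 : m' x ≤ S.card := by omega
  have hM2 : h5 (m' x) ≤ S.card := by omega
  have hTT : T0 x ≤ T := by omega
  have hxm := hm'1 x hx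
  set t := tt x with ht
  set σ := S.card with hσ
  have hσpos : 0 < σ := by omega
  set H := (pw S (D + 1)).filter (fun y => T ≤ (B.filter (fun v => ∀ i, G.Adj (y i) v)).card) with hH
  have hdens := h5h V G (m' x) (hx.trans hxm) (hB.mono hxm) hNW S hM2
  set Ω := pw S t with hΩ
  let E := Fintype.card (Fin (D + 1) ↪ Fin t)
  have hE : E = t.descFactorial (D + 1) := by simp [E, Fintype.card_embedding_eq]
  have hE2 : (t + 1) ^ (D + 1) ≤ 2 ^ (D + 1) * E := by
    rw [hE]
    refine le_trans ?_ (Nat.mul_le_mul_left _ (Nat.pow_sub_le_descFactorial t (D + 1)))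
    rw [← mul_pow]
    apply Nat.pow_le_pow_left
    have : 2 * (D + 1) ≤ t := by simp only [ht, tt]; omega
    omega
  let cnt : (Fin t → V) → ℕ := fun Y => (Finset.univ.filter (fun e : Fin (D + 1) ↪ Fin t => Y ∘ e ∈ H)).card
  have hcntE : ∀ Y, cnt Y ≤ E := fun Y => Finset.card_le_univ _
  have hsum : (∑ Y ∈ Ω, cnt Y) * σ ^ (D + 1) = E * (H.card * σ ^ t) := by
    have : ∑ Y ∈ Ω, cnt Y = ∑ e : Fin (D + 1) ↪ Fin t, (Ω.filter (fun Y => Y ∘ e ∈ H)).card := by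
      simp only [cnt, Finset.card_filter]
      rw [Finset.sum_comm]
    rw [this, Finset.sum_mul]
    have h2 : ∀ e : Fin (D + 1) ↪ Fin t, (Ω.filter (fun Y => Y ∘ e ∈ H)).card * σ ^ (D + 1) = H.card * σ ^ t := by
      intro e
      have := cyl S e e.injective (fun y => y ∈ H)
      refine this.trans ?_
      congr 2
      ext y
      simp only [Finset.mem_filter, and_iff_right_iff_imp]
      intro hy
      exact (Finset.mem_filter.1 hy).1
    rw [Finset.sum_congr rfl (fun e _ => h2 e)]
    simp [E]
  let N1 := Ω.filter (fun Y => ¬ Function.Injective Y)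
  let N2 := ((Finset.univ : Finset (Fin t × Fin t)).filter (fun z => z.1 ≠ z.2)).biUnion
        (fun z => Ω.filter (fun Y => G.Adj (Y z.1) (Y z.2)))
  have hN1 : 4 * x * N1.card ≤ σ ^ t := by
    have e1 : N1.card * σ ≤ t ^ 2 * σ ^ t := noninj S (Finset.card_pos.1 hσpos) t
    have e2 : σ * (4 * x * N1.card) ≤ σ * σ ^ t := by
      calc σ * (4 * x * N1.card) = 4 * x * (N1.card * σ) := by ring
        _ ≤ 4 * x * (t ^ 2 * σ ^ t) := by gcongr
        _ = m' x * σ ^ t := by simp only [m', ht]; ring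
        _ ≤ _ := by gcongr
    exact Nat.le_of_mul_le_mul_left e2 hσpos
  have hN2 : 4 * x * N2.card ≤ σ ^ t := by
    have e1 : N2.card * σ ^ 2 ≤ t ^ 2 * (e2 G S * σ ^ t) := by
      calc _ ≤ (∑ z ∈ (Finset.univ : Finset (Fin t × Fin t)).filter (fun z => z.1 ≠ z.2),
            (Ω.filter (fun Y => G.Adj (Y z.1) (Y z.2))).card) * σ ^ 2 :=
            Nat.mul_le_mul_right _ (Finset.card_biUnion_le)
        _ = ∑ z ∈ (Finset.univ : Finset (Fin t × Fin t)).filter (fun z => z.1 ≠ z.2), e2 G S * σ ^ t := by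
            rw [Finset.sum_mul]
            refine Finset.sum_congr rfl (fun z hz => ?_)
            exact cyl2 S z.1 z.2 (Finset.mem_filter.1 hz).2 (fun a b => G.Adj a b)
        _ ≤ _ := by
            rw [Finset.sum_const, smul_eq_mul]
            apply Nat.mul_le_mul_right
            refine (Finset.card_le_univ _).trans ?_
            simp [sq]
    have e2 : σ ^ 2 * (4 * x * N2.card) ≤ σ ^ 2 * σ ^ t := by
      calc σ ^ 2 * (4 * x * N2.card) = 4 * x * (N2.card * σ ^ 2) := by ring
        _ ≤ 4 * x * (t ^ 2 * (_root_.e2 G S * σ ^ t)) := by gcongr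
        _ = (_root_.e2 G S * m' x) * σ ^ t := by simp only [m', ht]; ring
        _ ≤ _ := by gcongr
    exact Nat.le_of_mul_le_mul_left e2 (by positivity)
  have hEpos : 0 < E := by
    by_contra hc0
    have : E = 0 := by omega
    rw [this] at hE2
    have : 0 < (t + 1) ^ (D + 1) := by positivity
    omega
  have hex : ∃ Y ∈ Ω, Y ∉ N1 ∧ Y ∉ N2 ∧ E < 2 * x * cnt Y := by
    by_contra hno
    push Not at hno
    have e1 : 2 * x * ∑ Y ∈ Ω, cnt Y ≤ 2 * x * (N1.card * E + N2.card * E) + σ ^ t * E := by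
      have : 2 * x * ∑ Y ∈ Ω, cnt Y ≤ ∑ Y ∈ Ω, ((if Y ∈ N1 then 2 * x * E else 0) + (if Y ∈ N2 then 2 * x * E else 0) + E) := by
        rw [Finset.mul_sum]
        apply Finset.sum_le_sum
        intro Y hY
        have := Nat.mul_le_mul_left (2 * x) (hcntE Y)
        by_cases c1 : Y ∈ N1
        · simp only [c1, if_true]; omega
        · by_cases c2 : Y ∈ N2
          · simp only [c2, if_true]; omega
          · have := hno Y hY c1 c2; omega
      refine this.trans ?_
      rw [Finset.sum_add_distrib, Finset.sum_add_distrib, ← Finset.sum_filter, ← Finset.sum_filter]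
      simp only [Finset.sum_const, smul_eq_mul]
      rw [show Ω.card = σ ^ t from card_pw S t]
      have f1 : (Ω.filter (fun Y => Y ∈ N1)).card ≤ N1.card := Finset.card_le_card (fun Y hY => (Finset.mem_filter.1 hY).2)
      have f2 : (Ω.filter (fun Y => Y ∈ N2)).card ≤ N2.card := Finset.card_le_card (fun Y hY => (Finset.mem_filter.1 hY).2)
      have f3 := Nat.mul_le_mul_right (2 * x * E) f1
      have f4 := Nat.mul_le_mul_right (2 * x * E) f2
      nlinarith
    have e3 : 2 * x * ∑ Y ∈ Ω, cnt Y ≤ 2 * (E * σ ^ t) := by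
      have f1 := Nat.mul_le_mul_right E hN1
      have f2 := Nat.mul_le_mul_right E hN2
      nlinarith
    have e4 : x * (∑ Y ∈ Ω, cnt Y) ≤ E * σ ^ t := by nlinarith
    have e5 : (E * σ ^ t) * (H.card * x) ≤ (E * σ ^ t) * σ ^ (D + 1) := by
      calc (E * σ ^ t) * (H.card * x) = x * (E * (H.card * σ ^ t)) := by ring
        _ = (x * ∑ Y ∈ Ω, cnt Y) * σ ^ (D + 1) := by rw [← hsum]; ring
        _ ≤ _ := by gcongr
    have e6 := Nat.le_of_mul_le_mul_left e5 (by positivity)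
    omega
  obtain ⟨Y, hY, hYN1, hYN2, hYc⟩ := hex
  have hinj : Function.Injective Y := by
    by_contra hc0
    exact hYN1 (Finset.mem_filter.2 ⟨hY, hc0⟩)
  have hind : ∀ i j, ¬ G.Adj (Y i) (Y j) := by
    intro i j hij
    apply hYN2
    refine Finset.mem_biUnion.2 ⟨(i, j), ?_, Finset.mem_filter.2 ⟨hY, hij⟩⟩
    simp only [Finset.mem_filter, Finset.mem_univ, true_and]
    rintro rfl
    exact G.loopless.irrefl _ hij
  obtain ⟨𝒜, h𝒜c, h𝒜s, h𝒜⟩ := lemma4 G hx hB P.I Y hinj B (q * (4 * x) ^ (q + 1)) P.Dpos (by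
    intro e he
    by_contra hc0
    push Not at hc0
    obtain ⟨b, hb1, hb2⟩ := lemma2e G hx hB q _ hc0
    exact lemma3 G P hNW (Y ∘ e) b (fun i l => (Finset.mem_filter.1 (hb1 l)).2 i) (fun i j => hind _ _) hb2)
  have hcnt : cnt Y ≤ (t + 1) ^ D * x ^ (D + 1) := by
    have e1 : cnt Y ≤ (𝒜.biUnion (fun A => pw A (D + 1))).card := by
      apply Finset.card_le_card_of_injOn (fun (e : Fin (D + 1) ↪ Fin t) (i : Fin (D + 1)) => e i)
      · intro e he
        have he0 := Finset.mem_coe.1 he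
        have he' := (Finset.mem_filter.1 (Finset.mem_filter.1 he0).2).2
        obtain ⟨v, hv, hv2⟩ := h𝒜 _ (Finset.filter_subset _ _) (hTT.trans he')
        refine Finset.mem_coe.2 (Finset.mem_biUnion.2 ⟨_, hv2, mem_pw.2 (fun i => ?_)⟩)
        have := (Finset.mem_filter.1 hv).2 i
        exact Finset.mem_filter.2 ⟨Finset.mem_univ _, this⟩
      · intro e _ e' _ hee
        ext i
        have := congrFun hee i
        simp only at this
        rw [this]
    refine e1.trans (Finset.card_biUnion_le.trans ?_)
    calc ∑ A ∈ 𝒜, (pw A (D + 1)).card ≤ 𝒜.card • x ^ (D + 1) := by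
          apply Finset.sum_le_card_nsmul
          intro A hA
          rw [card_pw]
          exact Nat.pow_le_pow_left (h𝒜s A hA).le _
      _ ≤ _ := by rw [smul_eq_mul]; gcongr
  have hfin : (t + 1) ^ D * (t + 1) < (t + 1) ^ D * (2 ^ (D + 2) * x ^ (D + 2)) := by
    calc (t + 1) ^ D * (t + 1) = (t + 1) ^ (D + 1) := by ring
      _ ≤ 2 ^ (D + 1) * E := hE2
      _ < 2 ^ (D + 1) * (2 * x * cnt Y) := by gcongr
      _ ≤ 2 ^ (D + 1) * (2 * x * ((t + 1) ^ D * x ^ (D + 1))) := by gcongr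
      _ = _ := by ring
  have h8 := lt_of_mul_lt_mul_left' hfin
  simp only [ht, tt] at h8
  omega


def wt {V : Type} [Fintype V] (p : ℝ) (R : Finset V) : ℝ := p ^ R.card * (1 - p) ^ (Fintype.card V - R.card)

lemma wt_nonneg {V : Type} [Fintype V] {p : ℝ} (h0 : 0 ≤ p) (h1 : p ≤ 1) (R : Finset V) : 0 ≤ wt p R := by
  have : 0 ≤ 1 - p := by linarith
  unfold wt; positivity

lemma wt_sum {V : Type} [Fintype V] (p : ℝ) (S : Finset V) :
    ∑ R : Finset V, (if S ⊆ R then wt p R else 0) = p ^ S.card := by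
  rw [← Finset.sum_filter]
  have h1 : ∑ R ∈ Finset.univ.filter (fun R : Finset V => S ⊆ R), wt p R =
      ∑ R ∈ (Sᶜ).powerset, p ^ S.card * (p ^ R.card * (1 - p) ^ ((Sᶜ).card - R.card)) := by
    symm
    apply Finset.sum_bij (fun R _ => S ∪ R)
    · intro R _; simp
    · intro R hR R' hR' h
      rw [Finset.mem_powerset] at hR hR'
      have d1 : Disjoint S R := by
        rw [Finset.disjoint_left]; intro a ha hb; exact (Finset.mem_compl.1 (hR hb)) ha
      have d2 : Disjoint S R' := by
        rw [Finset.disjoint_left]; intro a ha hb; exact (Finset.mem_compl.1 (hR' hb)) ha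
      rw [← Finset.union_sdiff_cancel_left d1, h, Finset.union_sdiff_cancel_left d2]
    · intro R hR
      have hR' := (Finset.mem_filter.1 hR).2
      refine ⟨R \ S, ?_, Finset.union_sdiff_of_subset hR'⟩
      rw [Finset.mem_powerset]
      intro a ha
      exact Finset.mem_compl.2 (Finset.mem_sdiff.1 ha).2
    · intro R hR
      rw [Finset.mem_powerset] at hR
      have d1 : Disjoint S R := by
        rw [Finset.disjoint_left]; intro a ha hb; exact (Finset.mem_compl.1 (hR hb)) ha
      unfold wt
      rw [Finset.card_union_of_disjoint d1, pow_add, Finset.card_compl, mul_assoc]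
      congr 3
      omega
  rw [h1, ← Finset.mul_sum, Finset.sum_pow_mul_eq_add_pow]
  simp

def Ex {V : Type} [Fintype V] (pA pB : ℝ) (f : Finset V → Finset V → ℝ) : ℝ :=
  ∑ RA : Finset V, ∑ RB : Finset V, wt pA RA * wt pB RB * f RA RB

lemma Ex_add {V : Type} [Fintype V] (pA pB : ℝ) (f g : Finset V → Finset V → ℝ) :
    Ex pA pB (fun a b => f a b + g a b) = Ex pA pB f + Ex pA pB g := by
  simp only [Ex, mul_add, Finset.sum_add_distrib]

lemma Ex_mono {V : Type} [Fintype V] {pA pB : ℝ} (hA0 : 0 ≤ pA) (hA1 : pA ≤ 1) (hB0 : 0 ≤ pB) (hB1 : pB ≤ 1)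
    (f g : Finset V → Finset V → ℝ) (h : ∀ a b, f a b ≤ g a b) : Ex pA pB f ≤ Ex pA pB g := by
  unfold Ex
  apply Finset.sum_le_sum; intro a _
  apply Finset.sum_le_sum; intro b _
  apply mul_le_mul_of_nonneg_left (h a b)
  exact mul_nonneg (wt_nonneg hA0 hA1 _) (wt_nonneg hB0 hB1 _)

/-- number of sampled members of a family -/
def smp {V ι : Type} (F : Finset ι) (S T : ι → Finset V) (RA RB : Finset V) : ℕ :=
  (F.filter (fun z => S z ⊆ RA ∧ T z ⊆ RB)).card

lemma Ex_smp {V ι : Type} [Fintype V] (pA pB : ℝ) (F : Finset ι) (S T : ι → Finset V) (a b : ℕ)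
    (hS : ∀ z ∈ F, (S z).card = a) (hT : ∀ z ∈ F, (T z).card = b) :
    Ex pA pB (fun RA RB => (smp F S T RA RB : ℝ)) = F.card * (pA ^ a * pB ^ b) := by
  unfold Ex smp
  have h1 : ∀ RA RB : Finset V, wt pA RA * wt pB RB * ((F.filter (fun z => S z ⊆ RA ∧ T z ⊆ RB)).card : ℝ) =
      ∑ z ∈ F, (if S z ⊆ RA then wt pA RA else 0) * (if T z ⊆ RB then wt pB RB else 0) := by
    intro RA RB
    rw [Finset.card_filter, Nat.cast_sum, Finset.mul_sum]
    apply Finset.sum_congr rfl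
    intro z _
    by_cases h1 : S z ⊆ RA <;> by_cases h2 : T z ⊆ RB <;> simp [h1, h2]
  simp_rw [h1]
  have h2 : ∀ RA : Finset V, ∑ RB : Finset V, ∑ z ∈ F, (if S z ⊆ RA then wt pA RA else 0) * (if T z ⊆ RB then wt pB RB else 0)
      = ∑ z ∈ F, (if S z ⊆ RA then wt pA RA else 0) * pB ^ (T z).card := by
    intro RA
    rw [Finset.sum_comm]
    apply Finset.sum_congr rfl
    intro z _
    rw [← Finset.mul_sum, wt_sum]
  simp_rw [h2]
  rw [Finset.sum_comm]
  have h3 : ∀ z ∈ F, ∑ RA : Finset V, (if S z ⊆ RA then wt pA RA else 0) * pB ^ (T z).card = pA ^ a * pB ^ b := by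
    intro z hz
    rw [← Finset.sum_mul, wt_sum, hS z hz, hT z hz]
  rw [Finset.sum_congr rfl h3]
  simp

section det
variable {V : Type} [Fintype V] (G : SimpleGraph V)

def nb (A1 : Finset V) (b : V) : Finset V := A1.filter (fun y => G.Adj b y)

def FG (A1 B1 : Finset V) (k : ℕ) : Finset (Σ _ : V, Finset V) :=
  B1.sigma (fun b => (nb G A1 b).powersetCard k)

def NP (A1 B1 : Finset V) (Hv : V → V → Prop) : Finset (V × V × V) :=
  (B1 ×ˢ A1 ×ˢ A1).filter (fun z => z.2.1 ≠ z.2.2 ∧ G.Adj z.1 z.2.1 ∧ G.Adj z.1 z.2.2 ∧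
    (Hv z.2.1 z.2.2 ∨ G.Adj z.2.1 z.2.2))

def NT (A1 B1 : Finset V) : Finset (V × V × V) :=
  (B1 ×ˢ B1 ×ˢ A1).filter (fun z => G.Adj z.1 z.2.1 ∧ G.Adj z.1 z.2.2 ∧ G.Adj z.2.1 z.2.2)

def F1 (A1 B1 : Finset V) (k : ℕ) (Hv : V → V → Prop) : Finset (Σ _ : V × V × V, Finset V) :=
  (NP G A1 B1 Hv).sigma (fun z => ((nb G A1 z.1).powersetCard k).filter (fun Z => {z.2.1, z.2.2} ⊆ Z))

def W3 (A1 : Finset V) (O : V → Finset V) (z : Σ _ : V, Finset V) : Finset V :=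
  (nb G A1 z.1 ∪ z.2.biUnion O) \ z.2

def F3 (A1 B1 : Finset V) (k : ℕ) (O : V → Finset V) : Finset (Σ _ : (Σ _ : V, Finset V), V) :=
  (FG G A1 B1 k).sigma (W3 G A1 O)

def W4 (B1 : Finset V) (Hv : V → V → Prop) (z : Σ _ : V, Finset V) : Finset V :=
  (z.2 ∪ ((z.2 ×ˢ z.2).filter (fun y => y.1 ≠ y.2 ∧ ¬ Hv y.1 y.2)).biUnion
    (fun y => B1.filter (fun b => G.Adj b y.1 ∧ G.Adj b y.2))).erase z.1

def F4 (A1 B1 : Finset V) (k : ℕ) (Hv : V → V → Prop) : Finset (Σ _ : (Σ _ : V, Finset V), V) :=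
  (FG G A1 B1 k).sigma (W4 G B1 Hv)

def F5 (A1 B1 : Finset V) (k : ℕ) : Finset (Σ _ : V × V, Finset V × Finset V) :=
  ((B1 ×ˢ B1).filter (fun z => G.Adj z.1 z.2)).sigma
    (fun z => ((nb G A1 z.1).powersetCard k ×ˢ (nb G A1 z.2).powersetCard k).filter (fun Z => Z.1 ∩ Z.2 = ∅))

def F6 (A1 B1 : Finset V) (k : ℕ) : Finset (Σ _ : V × V × V, Finset V × Finset V) :=
  (NT G A1 B1).sigma
    (fun z => ((nb G A1 z.1).powersetCard k ×ˢ (nb G A1 z.2.1).powersetCard k).filter (fun Z => Z.1 ∩ Z.2 = {z.2.2}))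

lemma det {K : ℕ} (hK : 1 ≤ K) (hNW : NW G K) (O : V → Finset V) (hO : ∀ u v, G.Adj u v → u ∈ O v ∨ v ∈ O u)
    (hOadj : ∀ u v, v ∈ O u → G.Adj u v)
    (A1 B1 : Finset V) (Hv : V → V → Prop) (RA RB : Finset V) :
    smp (FG G A1 B1 (2 * K)) (fun z => z.2) (fun z => {z.1}) RA RB ≤
      smp (F1 G A1 B1 (2 * K) Hv) (fun z => z.2) (fun z => {z.1.1}) RA RB
      + smp (F3 G A1 B1 (2 * K) O) (fun z => insert z.2 z.1.2) (fun z => {z.1.1}) RA RB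
      + smp (F4 G A1 B1 (2 * K) Hv) (fun z => z.1.2) (fun z => {z.1.1, z.2}) RA RB
      + smp (F5 G A1 B1 (2 * K)) (fun z => z.2.1 ∪ z.2.2) (fun z => {z.1.1, z.1.2}) RA RB
      + smp (F6 G A1 B1 (2 * K)) (fun z => z.2.1 ∪ z.2.2) (fun z => {z.1.1, z.1.2.1}) RA RB
      + smp A1 (fun y => {y}) (fun _ => ∅) RA RB := by
  by_contra hc
  push Not at hc
  unfold smp at hc
  set S0 := (FG G A1 B1 (2 * K)).filter (fun z => z.2 ⊆ RA ∧ {z.1} ⊆ RB) with hS0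
  set S1 := (F1 G A1 B1 (2 * K) Hv).filter (fun z => z.2 ⊆ RA ∧ {z.1.1} ⊆ RB) with hS1
  set S3 := (F3 G A1 B1 (2 * K) O).filter (fun z => insert z.2 z.1.2 ⊆ RA ∧ {z.1.1} ⊆ RB) with hS3
  set S4 := (F4 G A1 B1 (2 * K) Hv).filter (fun z => z.1.2 ⊆ RA ∧ {z.1.1, z.2} ⊆ RB) with hS4
  set S5 := (F5 G A1 B1 (2 * K)).filter (fun z => z.2.1 ∪ z.2.2 ⊆ RA ∧ {z.1.1, z.1.2} ⊆ RB) with hS5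
  set S6 := (F6 G A1 B1 (2 * K)).filter (fun z => z.2.1 ∪ z.2.2 ⊆ RA ∧ {z.1.1, z.1.2.1} ⊆ RB) with hS6
  set SA := A1.filter (fun y => {y} ⊆ RA ∧ ∅ ⊆ RB) with hSA
  let I1 : Finset (Σ _ : V, Finset V) := S1.image (fun z => ⟨z.1.1, z.2⟩)
  let I3 : Finset (Σ _ : V, Finset V) := S3.image (fun z => z.1)
  let I4 : Finset (Σ _ : V, Finset V) := S4.image (fun z => z.1)
  let I5 : Finset (Σ _ : V, Finset V) := S5.image (fun z => ⟨z.1.1, z.2.1⟩)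
  let I6 : Finset (Σ _ : V, Finset V) := S6.image (fun z => ⟨z.1.1, z.2.1⟩)
  let U := S0 \ (I1 ∪ I3 ∪ I4 ∪ I5 ∪ I6)
  have hUc : SA.card < U.card := by
    have h0 := Finset.le_card_sdiff (I1 ∪ I3 ∪ I4 ∪ I5 ∪ I6) S0
    have h1 := Finset.card_union_le (I1 ∪ I3 ∪ I4 ∪ I5) I6
    have h2 := Finset.card_union_le (I1 ∪ I3 ∪ I4) I5
    have h3 := Finset.card_union_le (I1 ∪ I3) I4
    have h4 := Finset.card_union_le I1 I3
    have g1 : I1.card ≤ S1.card := Finset.card_image_le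
    have g3 : I3.card ≤ S3.card := Finset.card_image_le
    have g4 : I4.card ≤ S4.card := Finset.card_image_le
    have g5 : I5.card ≤ S5.card := Finset.card_image_le
    have g6 : I6.card ≤ S6.card := Finset.card_image_le
    have : U.card = (S0 \ (I1 ∪ I3 ∪ I4 ∪ I5 ∪ I6)).card := rfl
    omega
  -- properties of U
  have hU0 : ∀ b Z, (⟨b, Z⟩ : Σ _ : V, Finset V) ∈ U → b ∈ B1 ∧ Z ⊆ nb G A1 b ∧ Z.card = 2 * K ∧ Z ⊆ RA ∧ b ∈ RB := by
    intro b Z h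
    have h1 := Finset.mem_filter.1 (Finset.mem_sdiff.1 h).1
    have h2 := Finset.mem_sigma.1 h1.1
    have h3 := Finset.mem_powersetCard.1 h2.2
    exact ⟨h2.1, h3.1, h3.2, h1.2.1, Finset.singleton_subset_iff.1 h1.2.2⟩
  have hnot : ∀ z ∈ U, z ∉ I1 ∧ z ∉ I3 ∧ z ∉ I4 ∧ z ∉ I5 ∧ z ∉ I6 := by
    intro z h
    have := (Finset.mem_sdiff.1 h).2
    simp only [Finset.mem_union, not_or] at this
    tauto
  have hnb : ∀ b y, y ∈ nb G A1 b ↔ y ∈ A1 ∧ G.Adj b y := fun b y => Finset.mem_filter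
  have hU1 : ∀ b Z, (⟨b, Z⟩ : Σ _ : V, Finset V) ∈ U → ∀ y ∈ Z, ∀ z ∈ Z, y ≠ z → ¬ Hv y z ∧ ¬ G.Adj y z := by
    intro b Z h y hy z hz hyz
    obtain ⟨hb, hZ, hZc, hZR, hbR⟩ := hU0 b Z h
    by_contra hcc
    apply (hnot _ h).1
    refine Finset.mem_image.2 ⟨⟨(b, y, z), Z⟩, Finset.mem_filter.2 ⟨Finset.mem_sigma.2 ⟨?_, ?_⟩, hZR, by simpa using hbR⟩, rfl⟩
    · have h1 := (hnb b y).1 (hZ hy)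
      have h2 := (hnb b z).1 (hZ hz)
      simp only [NP, Finset.mem_filter, Finset.mem_product]
      exact ⟨⟨hb, h1.1, h2.1⟩, hyz, h1.2, h2.2, by tauto⟩
    · simp only [Finset.mem_filter, Finset.mem_powersetCard]
      refine ⟨⟨hZ, hZc⟩, ?_⟩
      intro w hw
      simp only [Finset.mem_insert, Finset.mem_singleton] at hw
      rcases hw with rfl | rfl <;> assumption
  have hU3 : ∀ b Z, (⟨b, Z⟩ : Σ _ : V, Finset V) ∈ U → ∀ w ∈ RA, w ∉ Z → w ∉ nb G A1 b ∧ ∀ y ∈ Z, w ∉ O y := by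
    intro b Z h w hw hwZ
    obtain ⟨hb, hZ, hZc, hZR, hbR⟩ := hU0 b Z h
    by_contra hcc
    apply (hnot _ h).2.1
    refine Finset.mem_image.2 ⟨⟨⟨b, Z⟩, w⟩, Finset.mem_filter.2 ⟨Finset.mem_sigma.2 ⟨?_, ?_⟩, ?_, by simpa using hbR⟩, rfl⟩
    · exact (Finset.mem_filter.1 (Finset.mem_sdiff.1 h).1).1
    · simp only [W3, Finset.mem_sdiff, Finset.mem_union, Finset.mem_biUnion]
      refine ⟨?_, hwZ⟩
      by_contra h5
      push Not at h5
      exact hcc h5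
    · exact Finset.insert_subset hw hZR
  have hU4 : ∀ b Z, (⟨b, Z⟩ : Σ _ : V, Finset V) ∈ U → ∀ c ∈ RB, c ≠ b → c ∉ Z ∧
      (c ∈ B1 → ∀ y ∈ Z, ∀ z ∈ Z, y ≠ z → G.Adj c y → G.Adj c z → False) := by
    intro b Z h c hc' hcb
    obtain ⟨hb, hZ, hZc, hZR, hbR⟩ := hU0 b Z h
    have key : c ∉ W4 G B1 Hv ⟨b, Z⟩ := by
      intro hW
      apply (hnot _ h).2.2.1
      refine Finset.mem_image.2 ⟨⟨⟨b, Z⟩, c⟩, Finset.mem_filter.2 ⟨Finset.mem_sigma.2 ⟨?_, hW⟩, hZR, ?_⟩, rfl⟩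
      · exact (Finset.mem_filter.1 (Finset.mem_sdiff.1 h).1).1
      · intro w hw
        simp only [Finset.mem_insert, Finset.mem_singleton] at hw
        rcases hw with rfl | rfl <;> assumption
    constructor
    · intro hcZ
      exact key (Finset.mem_erase.2 ⟨hcb, Finset.mem_union_left _ hcZ⟩)
    · intro hcB y hy z hz hyz h1 h2
      apply key
      refine Finset.mem_erase.2 ⟨hcb, Finset.mem_union_right _ (Finset.mem_biUnion.2 ⟨(y, z), ?_, ?_⟩)⟩
      · simp only [Finset.mem_filter, Finset.mem_product]
        exact ⟨⟨hy, hz⟩, hyz, (hU1 b Z h y hy z hz hyz).1⟩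
      · simp only [Finset.mem_filter]; exact ⟨hcB, h1, h2⟩
  let B2 : Finset V := U.image (fun z => z.1)
  let A2 : Finset V := SA.filter (fun y => y ∉ RB ∧ ∀ y' ∈ SA, y' ∉ O y)
  have hSAm : ∀ y, y ∈ SA ↔ y ∈ A1 ∧ y ∈ RA := by
    intro y; simp [hSA]
  have hZA2 : ∀ b Z, (⟨b, Z⟩ : Σ _ : V, Finset V) ∈ U → Z ⊆ A2 := by
    intro b Z h y hy
    obtain ⟨hb, hZ, hZc, hZR, hbR⟩ := hU0 b Z h
    have h1 := (hnb b y).1 (hZ hy)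
    have hySA : y ∈ SA := (hSAm y).2 ⟨h1.1, hZR hy⟩
    refine Finset.mem_filter.2 ⟨hySA, ?_, ?_⟩
    · intro hyB
      have hne : y ≠ b := fun e => by rw [e] at h1; exact G.loopless.irrefl _ h1.2
      exact (hU4 b Z h y hyB hne).1 hy
    · intro y' hy' hyO
      have h2 := (hSAm y').1 hy'
      by_cases hyZ : y' ∈ Z
      · by_cases hee : y = y'
        · subst hee
          exact G.loopless.irrefl _ (hOadj y y hyO)
        · exact (hU1 b Z h y hy y' hyZ hee).2 (hOadj y y' hyO)
      · exact (hU3 b Z h y' h2.2 hyZ).2 y hy hyO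
  have hB2c : B2.card = U.card := by
    apply Finset.card_image_of_injOn
    rintro ⟨b, Z⟩ h ⟨b', Z'⟩ h' hbb
    simp only at hbb
    subst hbb
    have key : ∀ Z Z', (⟨b, Z⟩ : Σ _ : V, Finset V) ∈ U → (⟨b, Z'⟩ : Σ _ : V, Finset V) ∈ U → Z ⊆ Z' := by
      intro Z Z' h h' y hy
      by_contra hyZ
      obtain ⟨hb, hZ, hZc, hZR, hbR⟩ := hU0 b Z h
      exact (hU3 b Z' h' y (hZR hy) hyZ).1 (hZ hy)
    rw [Finset.Subset.antisymm (key Z Z' h h') (key Z' Z h' h)]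
  have hinZ : ∀ b Z, (⟨b, Z⟩ : Σ _ : V, Finset V) ∈ U → ∀ a ∈ A2, G.Adj a b → a ∈ Z := by
    intro b Z h a ha hab
    by_contra haZ
    have h1 := (hSAm a).1 (Finset.mem_filter.1 ha).1
    exact (hU3 b Z h a h1.2 haZ).1 ((hnb b a).2 ⟨h1.1, hab.symm⟩)
  have hfinal := lemma9 G K hNW (A2.card + B2.card) A2 B2 rfl ?_ ?_ ?_ ?_
  · have h1 : B2.card • (2 * K) ≤ ∑ b ∈ B2, (A2.filter (fun a => G.Adj a b)).card := by
      apply Finset.card_nsmul_le_sum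
      intro b hb
      obtain ⟨⟨b', Z⟩, hz, rfl⟩ := Finset.mem_image.1 hb
      obtain ⟨hb, hZ, hZc, hZR, hbR⟩ := hU0 b' Z hz
      rw [← hZc]
      apply Finset.card_le_card
      intro y hy
      exact Finset.mem_filter.2 ⟨hZA2 b' Z hz hy, ((hnb b' y).1 (hZ hy)).2.symm⟩
    rw [smul_eq_mul] at h1
    have h2 : A2.card ≤ SA.card := Finset.card_le_card (Finset.filter_subset _ _)
    have h3 : K * (A2.card + B2.card) < B2.card * (2 * K) := by
      have : A2.card < B2.card := by omega
      nlinarith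
    omega
  · rw [Finset.disjoint_left]
    intro a ha hb
    obtain ⟨⟨b', Z⟩, hz, rfl⟩ := Finset.mem_image.1 hb
    exact (Finset.mem_filter.1 ha).2.1 (hU0 b' Z hz).2.2.2.2
  · intro a ha a' ha' hadj
    have h1 := Finset.mem_filter.1 ha
    have h2 := Finset.mem_filter.1 ha'
    rcases hO a a' hadj with h | h
    · exact h2.2.2 a h1.1 h
    · exact h1.2.2 a' h2.1 h
  · intro b hb b' hb' hadj
    obtain ⟨⟨b, Z⟩, hz, rfl⟩ := Finset.mem_image.1 hb
    obtain ⟨⟨b', Z'⟩, hz', rfl⟩ := Finset.mem_image.1 hb'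
    simp only at hadj
    obtain ⟨hb1, hZ, hZc, hZR, hbR⟩ := hU0 b Z hz
    obtain ⟨hb1', hZ', hZc', hZR', hbR'⟩ := hU0 b' Z' hz'
    have hRR : ({b, b'} : Finset V) ⊆ RB := by
      intro w hw
      simp only [Finset.mem_insert, Finset.mem_singleton] at hw
      rcases hw with rfl | rfl <;> assumption
    rcases Nat.lt_or_ge 1 (Z ∩ Z').card with hlt | hle
    · obtain ⟨y, hy, z, hzz, hyz⟩ := Finset.one_lt_card.1 hlt
      simp only [Finset.mem_inter] at hy hzz
      exact (hU4 b Z hz b' hbR' hadj.ne').2 hb1' y hy.1 z hzz.1 hyz ((hnb _ _).1 (hZ' hy.2)).2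
        ((hnb _ _).1 (hZ' hzz.2)).2
    · rcases Nat.eq_zero_or_pos (Z ∩ Z').card with h0 | h0
      · rw [Finset.card_eq_zero] at h0
        apply (hnot _ hz).2.2.2.1
        refine Finset.mem_image.2 ⟨⟨(b, b'), (Z, Z')⟩, Finset.mem_filter.2 ⟨Finset.mem_sigma.2 ⟨?_, ?_⟩,
          Finset.union_subset hZR hZR', hRR⟩, rfl⟩
        · simp only [Finset.mem_filter, Finset.mem_product]
          exact ⟨⟨hb1, hb1'⟩, hadj⟩
        · simp only [Finset.mem_filter, Finset.mem_product, Finset.mem_powersetCard]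
          exact ⟨⟨⟨hZ, hZc⟩, hZ', hZc'⟩, h0⟩
      · obtain ⟨y, hy⟩ := Finset.card_eq_one.1 (by omega : (Z ∩ Z').card = 1)
        have hyy : y ∈ Z ∩ Z' := by rw [hy]; simp
        rw [Finset.mem_inter] at hyy
        apply (hnot _ hz).2.2.2.2
        refine Finset.mem_image.2 ⟨⟨(b, b', y), (Z, Z')⟩, Finset.mem_filter.2 ⟨Finset.mem_sigma.2 ⟨?_, ?_⟩,
          Finset.union_subset hZR hZR', hRR⟩, rfl⟩
        · simp only [NT, Finset.mem_filter, Finset.mem_product]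
          have g1 := (hnb _ _).1 (hZ hyy.1)
          have g2 := (hnb _ _).1 (hZ' hyy.2)
          exact ⟨⟨hb1, hb1', g1.1⟩, hadj, g1.2, g2.2⟩
        · simp only [Finset.mem_filter, Finset.mem_product, Finset.mem_powersetCard]
          exact ⟨⟨⟨hZ, hZc⟩, hZ', hZc'⟩, hy⟩
  · intro b hb b' hb' hne
    obtain ⟨⟨b, Z⟩, hz, rfl⟩ := Finset.mem_image.1 hb
    obtain ⟨⟨b', Z'⟩, hz', rfl⟩ := Finset.mem_image.1 hb'
    simp only at hne
    rw [Finset.card_le_one]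
    intro a ha a' ha'
    simp only [Finset.mem_filter] at ha ha'
    by_contra haa
    obtain ⟨hb1', hZ', hZc', hZR', hbR'⟩ := hU0 b' Z' hz'
    exact (hU4 b Z hz b' hbR' (Ne.symm hne)).2 hb1' a (hinZ b Z hz a ha.1 ha.2.1) a' (hinZ b Z hz a' ha'.1 ha'.2.1) haa
      ha.2.2.symm ha'.2.2.symm

end det


lemma card_sup {V : Type} (S W : Finset V) (k : ℕ) :
    ((S.powersetCard k).filter (fun Z => W ⊆ Z)).card ≤ S.card ^ (k - W.card) := by
  calc ((S.powersetCard k).filter (fun Z => W ⊆ Z)).card ≤ (S.powersetCard (k - W.card)).card := by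
        apply Finset.card_le_card_of_injOn (fun Z => Z \ W)
        · intro Z hZ
          have hZ := Finset.mem_coe.1 hZ
          rw [Finset.mem_filter, Finset.mem_powersetCard] at hZ
          refine Finset.mem_coe.2 ?_
          rw [Finset.mem_powersetCard]
          refine ⟨Finset.sdiff_subset.trans hZ.1.1, ?_⟩
          show (Z \ W).card = _
          rw [Finset.card_sdiff_of_subset hZ.2, hZ.1.2]
        · intro Z hZ Z' hZ' h
          have hZ := (Finset.mem_filter.1 (Finset.mem_coe.1 hZ)).2
          have hZ' := (Finset.mem_filter.1 (Finset.mem_coe.1 hZ')).2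
          have h : Z \ W = Z' \ W := h
          rw [← Finset.sdiff_union_of_subset hZ, h, Finset.sdiff_union_of_subset hZ']
    _ = S.card.choose (k - W.card) := Finset.card_powersetCard _ _
    _ ≤ _ := Nat.choose_le_pow _ _

set_option linter.unusedSectionVars false
section core
variable {V : Type} [Fintype V] (G : SimpleGraph V)

lemma FG_card (A1 B1 : Finset V) (k : ℕ) : (FG G A1 B1 k).card = ∑ b ∈ B1, (nb G A1 b).card.choose k := by
  unfold FG
  rw [Finset.card_sigma]
  exact Finset.sum_congr rfl (fun b _ => Finset.card_powersetCard _ _)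

lemma FG_le (A1 B1 : Finset V) (k Δ : ℕ) (h : ∀ b ∈ B1, (nb G A1 b).card ≤ Δ) :
    (FG G A1 B1 k).card ≤ B1.card * Δ ^ k := by
  rw [FG_card]
  refine (Finset.sum_le_card_nsmul _ _ (Δ ^ k) ?_).trans (by simp)
  intro b hb
  exact (Nat.choose_le_pow _ _).trans (Nat.pow_le_pow_left (h b hb) _)

lemma F1_le (A1 B1 : Finset V) (k Δ : ℕ) (Hv : V → V → Prop) (h : ∀ b ∈ B1, (nb G A1 b).card ≤ Δ) :
    (F1 G A1 B1 k Hv).card ≤ (NP G A1 B1 Hv).card * Δ ^ (k - 2) := by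
  unfold F1
  rw [Finset.card_sigma]
  refine (Finset.sum_le_card_nsmul _ _ (Δ ^ (k-2)) ?_).trans (by simp)
  intro z hz
  simp only [NP, Finset.mem_filter, Finset.mem_product] at hz
  refine (card_sup _ _ _).trans ?_
  rw [Finset.card_pair hz.2.1]
  exact Nat.pow_le_pow_left (h _ hz.1.1) _

lemma F3_le (A1 B1 : Finset V) (k Δ d : ℕ) (O : V → Finset V) (h : ∀ b ∈ B1, (nb G A1 b).card ≤ Δ)
    (hd : ∀ v, (O v).card ≤ d) :
    (F3 G A1 B1 k O).card ≤ B1.card * Δ ^ k * (Δ + k * d) := by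
  unfold F3
  rw [Finset.card_sigma]
  refine (Finset.sum_le_card_nsmul _ _ (Δ + k * d) ?_).trans ?_
  · intro z hz
    simp only [FG, Finset.mem_sigma, Finset.mem_powersetCard] at hz
    unfold W3
    refine (Finset.card_le_card Finset.sdiff_subset).trans ?_
    refine (Finset.card_union_le _ _).trans ?_
    refine Nat.add_le_add (h _ hz.1) ?_
    refine Finset.card_biUnion_le.trans ?_
    refine (Finset.sum_le_card_nsmul _ _ d (fun v _ => hd v)).trans ?_
    rw [hz.2.2]; simp
  · rw [smul_eq_mul]
    exact Nat.mul_le_mul_right _ (FG_le G A1 B1 k Δ h)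

lemma F4_le (A1 B1 : Finset V) (k Δ T : ℕ) (Hv : V → V → Prop) (h : ∀ b ∈ B1, (nb G A1 b).card ≤ Δ)
    (hT : ∀ y z, ¬ Hv y z → (B1.filter (fun b => G.Adj b y ∧ G.Adj b z)).card ≤ T) :
    (F4 G A1 B1 k Hv).card ≤ B1.card * Δ ^ k * (k + k ^ 2 * T) := by
  unfold F4
  rw [Finset.card_sigma]
  refine (Finset.sum_le_card_nsmul _ _ (k + k ^ 2 * T) ?_).trans ?_
  · intro z hz
    simp only [FG, Finset.mem_sigma, Finset.mem_powersetCard] at hz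
    unfold W4
    refine (Finset.card_le_card (Finset.erase_subset _ _)).trans ?_
    refine (Finset.card_union_le _ _).trans ?_
    refine Nat.add_le_add hz.2.2.le ?_
    refine Finset.card_biUnion_le.trans ?_
    refine (Finset.sum_le_card_nsmul _ _ T ?_).trans ?_
    · intro y hy
      exact hT _ _ (Finset.mem_filter.1 hy).2.2
    · rw [smul_eq_mul]
      refine Nat.mul_le_mul_right _ ((Finset.card_filter_le _ _).trans ?_)
      rw [Finset.card_product, hz.2.2, sq]
  · rw [smul_eq_mul]
    exact Nat.mul_le_mul_right _ (FG_le G A1 B1 k Δ h)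

lemma psc_le {S : Finset V} {k Δ : ℕ} (h : S.card ≤ Δ) : (S.powersetCard k).card ≤ Δ ^ k := by
  rw [Finset.card_powersetCard]
  exact (Nat.choose_le_pow _ _).trans (Nat.pow_le_pow_left h _)

lemma F5_le (A1 B1 : Finset V) (k Δ : ℕ) (h : ∀ b ∈ B1, (nb G A1 b).card ≤ Δ) :
    (F5 G A1 B1 k).card ≤ e2 G B1 * Δ ^ (2 * k) := by
  unfold F5
  rw [Finset.card_sigma]
  refine (Finset.sum_le_card_nsmul _ _ (Δ ^ (2 * k)) ?_).trans (by simp [e2])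
  intro z hz
  simp only [Finset.mem_filter, Finset.mem_product] at hz
  refine (Finset.card_filter_le _ _).trans ?_
  rw [Finset.card_product, two_mul, pow_add]
  exact Nat.mul_le_mul (psc_le (h _ hz.1.1)) (psc_le (h _ hz.1.2))

lemma F6_le (A1 B1 : Finset V) (k Δ : ℕ) (h : ∀ b ∈ B1, (nb G A1 b).card ≤ Δ) :
    (F6 G A1 B1 k).card ≤ (NT G A1 B1).card * Δ ^ (2 * (k - 1)) := by
  unfold F6
  rw [Finset.card_sigma]
  refine (Finset.sum_le_card_nsmul _ _ (Δ ^ (2 * (k - 1))) ?_).trans (by simp)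
  intro z hz
  simp only [NT, Finset.mem_filter, Finset.mem_product] at hz
  have hs : ((nb G A1 z.1).powersetCard k ×ˢ (nb G A1 z.2.1).powersetCard k).filter (fun Z => Z.1 ∩ Z.2 = {z.2.2}) ⊆
      ((nb G A1 z.1).powersetCard k).filter (fun Z => {z.2.2} ⊆ Z) ×ˢ
      ((nb G A1 z.2.1).powersetCard k).filter (fun Z => {z.2.2} ⊆ Z) := by
    intro Z hZ
    simp only [Finset.mem_filter, Finset.mem_product] at hZ ⊢
    refine ⟨⟨hZ.1.1, ?_⟩, hZ.1.2, ?_⟩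
    · rw [← hZ.2]; exact Finset.inter_subset_left
    · rw [← hZ.2]; exact Finset.inter_subset_right
  refine (Finset.card_le_card hs).trans ?_
  rw [Finset.card_product, two_mul, pow_add]
  refine Nat.mul_le_mul ((card_sup _ _ _).trans ?_) ((card_sup _ _ _).trans ?_)
  · rw [Finset.card_singleton]; exact Nat.pow_le_pow_left (h _ hz.1.1) _
  · rw [Finset.card_singleton]; exact Nat.pow_le_pow_left (h _ hz.1.2.1) _

lemma core8 {K : ℕ} (hK : 1 ≤ K) (hNW : NW G K) (O : V → Finset V) (hO : ∀ u v, G.Adj u v → u ∈ O v ∨ v ∈ O u)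
    (hOadj : ∀ u v, v ∈ O u → G.Adj u v)
    (A1 B1 : Finset V) (Hv : V → V → Prop) (k Δ d T : ℕ) (hk : k = 2 * K) (h : ∀ b ∈ B1, (nb G A1 b).card ≤ Δ)
    (hd : ∀ v, (O v).card ≤ d)
    (hT : ∀ y z, ¬ Hv y z → (B1.filter (fun b => G.Adj b y ∧ G.Adj b z)).card ≤ T)
    {pA pB : ℝ} (hA0 : 0 ≤ pA) (hA1 : pA ≤ 1) (hB0 : 0 ≤ pB) (hB1 : pB ≤ 1) :
    ((∑ b ∈ B1, (nb G A1 b).card.choose k : ℕ) : ℝ) * (pA ^ k * pB) ≤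
      (NP G A1 B1 Hv).card * (Δ:ℝ) ^ (k - 2) * (pA ^ k * pB)
      + B1.card * (Δ:ℝ) ^ k * (Δ + k * d) * (pA ^ (k + 1) * pB)
      + B1.card * (Δ:ℝ) ^ k * (k + k ^ 2 * T) * (pA ^ k * pB ^ 2)
      + e2 G B1 * (Δ:ℝ) ^ (2 * k) * (pA ^ (2 * k) * pB ^ 2)
      + (NT G A1 B1).card * (Δ:ℝ) ^ (2 * (k - 1)) * (pA ^ (2 * k - 1) * pB ^ 2)
      + A1.card * pA := by
  subst hk
  have hdet := Ex_mono hA0 hA1 hB0 hB1 _ _ (fun RA RB => (Nat.cast_le (α := ℝ)).2 (det G hK hNW O hO hOadj A1 B1 Hv RA RB))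
  simp only [Nat.cast_add] at hdet
  rw [Ex_add, Ex_add, Ex_add, Ex_add, Ex_add] at hdet
  have x0 := Ex_smp pA pB (FG G A1 B1 (2 * K)) (fun z => z.2) (fun z => {z.1}) (2 * K) 1
    (by
    intro z hz
    simp only [FG, Finset.mem_sigma, Finset.mem_powersetCard] at hz
    exact hz.2.2)
    (by
    intro z hz
    simp)
  have x1 := Ex_smp pA pB (F1 G A1 B1 (2 * K) Hv) (fun z => z.2) (fun z => {z.1.1}) (2 * K) 1
    (by
    intro z hz
    simp only [F1, Finset.mem_sigma, Finset.mem_powersetCard, Finset.mem_filter] at hz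
    exact hz.2.1.2)
    (by
    intro z hz
    simp)
  have x2 := Ex_smp pA pB (F3 G A1 B1 (2 * K) O) (fun z => insert z.2 z.1.2) (fun z => {z.1.1}) (2 * K + 1) 1
    (by
    intro z hz
    simp only [F3, FG, W3, Finset.mem_sigma, Finset.mem_powersetCard, Finset.mem_sdiff] at hz
    rw [Finset.card_insert_of_notMem hz.2.2, hz.1.2.2])
    (by
    intro z hz
    simp)
  have x3 := Ex_smp pA pB (F4 G A1 B1 (2 * K) Hv) (fun z => z.1.2) (fun z => {z.1.1, z.2}) (2 * K) 2
    (by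
    intro z hz
    simp only [F4, FG, Finset.mem_sigma, Finset.mem_powersetCard] at hz
    exact hz.1.2.2)
    (by
    intro z hz
    simp only [F4, W4, Finset.mem_sigma, Finset.mem_erase] at hz
    exact Finset.card_pair hz.2.1.symm)
  have x4 := Ex_smp pA pB (F5 G A1 B1 (2 * K)) (fun z => z.2.1 ∪ z.2.2) (fun z => {z.1.1, z.1.2}) (2 * (2 * K)) 2
    (by
    intro z hz
    simp only [F5, Finset.mem_sigma, Finset.mem_filter, Finset.mem_product, Finset.mem_powersetCard] at hz
    rw [Finset.card_union_of_disjoint (Finset.disjoint_iff_inter_eq_empty.2 hz.2.2), hz.2.1.1.2, hz.2.1.2.2]; omega)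
    (by
    intro z hz
    simp only [F5, Finset.mem_sigma, Finset.mem_filter, Finset.mem_product, Finset.mem_powersetCard] at hz
    exact Finset.card_pair hz.1.2.ne)
  have x5 := Ex_smp pA pB (F6 G A1 B1 (2 * K)) (fun z => z.2.1 ∪ z.2.2) (fun z => {z.1.1, z.1.2.1}) (2 * (2 * K) - 1) 2
    (by
    intro z hz
    simp only [F6, Finset.mem_sigma, Finset.mem_filter, Finset.mem_product, Finset.mem_powersetCard] at hz
    have := Finset.card_union_add_card_inter z.2.1 z.2.2
    rw [hz.2.2, Finset.card_singleton, hz.2.1.1.2, hz.2.1.2.2] at this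
    omega)
    (by
    intro z hz
    simp only [F6, NT, Finset.mem_sigma, Finset.mem_filter, Finset.mem_product, Finset.mem_powersetCard] at hz
    exact Finset.card_pair hz.1.2.1.ne)
  have x6 := Ex_smp pA pB A1 (fun y => {y}) (fun _ => ∅) 1 0
    (by
    intro z hz
    simp)
    (by
    intro z hz
    simp)
  rw [x0, x1, x2, x3, x4, x5, x6] at hdet
  · rw [FG_card] at hdet
    have i1 : ((F1 G A1 B1 (2 * K) Hv).card : ℝ) ≤ (NP G A1 B1 Hv).card * (Δ:ℝ) ^ (2 * K - 2) := by
      exact_mod_cast F1_le G A1 B1 (2 * K) Δ Hv h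
    have i3 : ((F3 G A1 B1 (2 * K) O).card : ℝ) ≤ B1.card * (Δ:ℝ) ^ (2 * K) * (Δ + (2 * K : ℕ) * d) := by
      exact_mod_cast F3_le G A1 B1 (2 * K) Δ d O h hd
    have i4 : ((F4 G A1 B1 (2 * K) Hv).card : ℝ) ≤ B1.card * (Δ:ℝ) ^ (2 * K) * ((2 * K : ℕ) + (2 * K : ℕ) ^ 2 * T) := by
      exact_mod_cast F4_le G A1 B1 (2 * K) Δ T Hv h hT
    have i5 : ((F5 G A1 B1 (2 * K)).card : ℝ) ≤ e2 G B1 * (Δ:ℝ) ^ (2 * (2 * K)) := by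
      exact_mod_cast F5_le G A1 B1 (2 * K) Δ h
    have i6 : ((F6 G A1 B1 (2 * K)).card : ℝ) ≤ (NT G A1 B1).card * (Δ:ℝ) ^ (2 * (2 * K - 1)) := by
      exact_mod_cast F6_le G A1 B1 (2 * K) Δ h
    rw [pow_one, pow_zero, pow_one, mul_one] at hdet
    refine hdet.trans ?_
    gcongr
end core


lemma small_ex (x y : ℝ) (hx : 0 ≤ x) (hy : 0 < y) : ∃ e : ℝ, 0 < e ∧ e * x ≤ y := by
  refine ⟨y / (x + 1), by positivity, ?_⟩
  rw [div_mul_eq_mul_div, div_le_iff₀ (by positivity)]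
  nlinarith

lemma consts8 (j : ℕ) (c τ : ℝ) (hc : 0 < c) (hτ : 0 < τ) : ∃ a b ε τ' : ℝ, 0 < a ∧ a ≤ 1 ∧ 0 < b ∧ 0 < ε ∧ 0 < τ' ∧
    ε * 8 ^ j ≤ c ∧ 8 ^ (j + 2) * (8 + (j + 2 : ℕ)) * a ≤ c ∧ 8 ^ (j+2) * (j + 2 : ℕ) ^ 2 * τ' * b ≤ c ∧
    2 * 8 ^ (2 * (j + 2)) * a ^ (j + 2) * b ≤ c ∧ ε * 8 ^ (2 * j + 2) * a ^ (j + 1) * b ≤ c ∧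
    8 / τ ≤ c * a ^ (j + 1) * b := by
  obtain ⟨a, ha, ha'⟩ := small_ex (1 + 8 ^ (j + 2) * (8 + (j + 2 : ℕ)) / c + 2 * 8 ^ (2 * (j + 2)) * (8 / τ / c) / c) 1
    (by positivity) one_pos
  have p1 : 0 ≤ a * (8 ^ (j + 2) * (8 + (j + 2 : ℕ)) / c) := by positivity
  have p2 : 0 ≤ a * (2 * 8 ^ (2 * (j + 2)) * (8 / τ / c) / c) := by positivity
  rw [mul_add, mul_add] at ha'
  have q1 : a * (8 ^ (j + 2) * (8 + (j + 2 : ℕ)) / c) ≤ 1 := by linarith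
  have q2 : a * (2 * 8 ^ (2 * (j + 2)) * (8 / τ / c) / c) ≤ 1 := by linarith
  obtain ⟨b, hbdef⟩ : ∃ b : ℝ, b = 8 / τ / c / a ^ (j + 1) := ⟨_, rfl⟩
  have hb : 0 < b := by rw [hbdef]; positivity
  obtain ⟨ε, hε, hε'⟩ := small_ex (8 ^ j + 8 ^ (2 * j + 2) * a ^ (j + 1) * b) c (by positivity) hc
  have p3 : 0 ≤ ε * 8 ^ j := by positivity
  have p4 : 0 ≤ ε * (8 ^ (2 * j + 2) * a ^ (j + 1) * b) := by positivity
  rw [mul_add] at hε'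
  obtain ⟨τ', hτ', hτ''⟩ := small_ex (8 ^ (j+2) * (j + 2 : ℕ) ^ 2 * b) c (by positivity) hc
  refine ⟨a, b, ε, τ', ha, by linarith, hb, hε, hτ', by linarith, ?_, ?_, ?_, ?_, ?_⟩
  · rw [← mul_div_assoc, div_le_one hc] at q1
    linarith
  · linarith
  · rw [← mul_div_assoc, div_le_one hc] at q2
    refine le_trans (le_of_eq ?_) q2
    rw [hbdef]
    field_simp
    ring
  · linarith
  · rw [hbdef]
    apply le_of_eq
    field_simp

lemma choose_lin (k n : ℕ) (u Δ : ℝ) (hΔ : (n:ℝ) ≤ Δ) (hΔ0 : 0 < Δ) (hu : 2 * (k:ℝ) ≤ u) :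
    (u / 2) ^ k / (k.factorial) / Δ * (n - u) ≤ (n.choose k : ℝ) := by
  have hu0 : 0 ≤ u := le_trans (by positivity) hu
  by_cases h : (n:ℝ) ≤ u
  · refine le_trans ?_ (Nat.cast_nonneg _)
    apply mul_nonpos_of_nonneg_of_nonpos
    · positivity
    · linarith
  · push Not at h
    have h1 : ((n + 1 - k : ℕ) ^ k / (k.factorial) : ℝ) ≤ (n.choose k : ℝ) := Nat.pow_le_choose k n
    have h3 : (2:ℝ) * k ≤ n := by linarith
    have h2 : k ≤ n := by
      have : ((2 * k : ℕ):ℝ) ≤ n := by push_cast; exact h3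
      have := Nat.cast_le.1 this
      omega
    have h4 : u / 2 ≤ ((n + 1 - k : ℕ):ℝ) := by
      rw [Nat.cast_sub (by omega)]
      push_cast
      linarith
    calc (u / 2) ^ k / (k.factorial) / Δ * (n - u) ≤ (u / 2) ^ k / (k.factorial) / Δ * Δ := by
          apply mul_le_mul_of_nonneg_left _ (by positivity)
          linarith
      _ = (u / 2) ^ k / (k.factorial) := by field_simp
      _ ≤ ((n + 1 - k : ℕ):ℝ) ^ k / (k.factorial) := by gcongr
      _ ≤ _ := h1

set_option maxHeartbeats 1600000 in
lemma lemma8 (K : ℕ) (hK : 1 ≤ K) (α τ : ℝ) (hα : 0 < α) (hτ : 0 < τ) :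
    ∃ τ' ε : ℝ, 0 < τ' ∧ 0 < ε ∧ ∃ d0 : ℕ, ∀ (V : Type) [Fintype V] (G : SimpleGraph V), NW G K →
    ∀ (O : V → Finset V) (d : ℕ), d0 ≤ d → (∀ u v, G.Adj u v → u ∈ O v ∨ v ∈ O u) →
    (∀ u v, v ∈ O u → G.Adj u v) → (∀ v, (O v).card ≤ d) →
    ∀ A1 B1 : Finset V, B1.Nonempty → (∀ b ∈ B1, (nb G A1 b).card ≤ 8 * d) →
    (∀ y ∈ A1, τ * d ≤ (B1.filter (fun b => G.Adj b y)).card) →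
    α * d * B1.card ≤ ((∑ b ∈ B1, (nb G A1 b).card : ℕ) : ℝ) →
    e2 G B1 ≤ 2 * d * B1.card →
    ((NP G A1 B1 (fun y z => τ' * d ≤ (B1.filter (fun b => G.Adj b y ∧ G.Adj b z)).card)).card : ℝ) ≤ ε * d ^ 2 * B1.card →
    ((NT G A1 B1).card : ℝ) ≤ ε * d ^ 2 * B1.card → False := by
  obtain ⟨j, hj⟩ : ∃ j, 2 * K = j + 2 := ⟨2 * K - 2, by omega⟩
  obtain ⟨c1, hc1⟩ : ∃ c1 : ℝ, c1 = (α / 4) ^ (j + 2) / ((j+2).factorial) * (α / 16) := ⟨_, rfl⟩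
  have hc1p : 0 < c1 := by rw [hc1]; positivity
  obtain ⟨a, b, ε, τ', ha, ha1, hb, hε, hτ', e1, e2', e3, e4, e5, e6⟩ := consts8 j (c1 / 10) τ (by positivity) hτ
  obtain ⟨d0, hd0⟩ := exists_nat_ge (1 + b + 4 * (j + 2 : ℕ) / α + 8 ^ (j+2) * (j + 2 : ℕ) * b / (c1 / 10))
  refine ⟨τ', ε, hτ', hε, d0, ?_⟩
  intro V _ G hNW O d hdd hO hOadj hOd A1 B1 hB1n hnb hA1 hE he2 hNP hNT
  have hdr : (d0 : ℝ) ≤ d := by exact_mod_cast hdd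
  have r1 : 0 ≤ 4 * ((j + 2 : ℕ):ℝ) / α := by positivity
  have r2 : 0 ≤ 8 ^ (j+2) * ((j + 2 : ℕ):ℝ) * b / (c1 / 10) := by positivity
  have d1 : (1:ℝ) ≤ d := by linarith
  have dpos : (0:ℝ) < d := by linarith
  have d2 : b ≤ d := by linarith
  have d3 : 4 * ((j + 2 : ℕ):ℝ) / α ≤ d := by linarith
  have d4 : 8 ^ (j+2) * ((j + 2 : ℕ):ℝ) * b / (c1 / 10) ≤ d := by linarith
  rw [div_le_iff₀ hα] at d3
  rw [div_le_iff₀ (by positivity)] at d4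
  have hm : (0:ℝ) < B1.card := by exact_mod_cast hB1n.card_pos
  obtain ⟨m, hmdef⟩ : ∃ m : ℝ, m = B1.card := ⟨_, rfl⟩
  rw [← hmdef] at hm hE hNP hNT
  -- |A1|
  have hA : (A1.card : ℝ) ≤ 8 / τ * m := by
    have h1 : ∑ y ∈ A1, (B1.filter (fun b => G.Adj b y)).card = ∑ b ∈ B1, (nb G A1 b).card := by
      unfold nb
      exact (Finset.sum_card_bipartiteAbove_eq_sum_card_bipartiteBelow (s := B1) (t := A1) (fun b y => G.Adj b y)).symm
    have h2 : (A1.card : ℝ) * (τ * d) ≤ ∑ y ∈ A1, ((B1.filter (fun b => G.Adj b y)).card : ℝ) := by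
      rw [← nsmul_eq_mul]
      exact Finset.card_nsmul_le_sum _ _ _ hA1
    have h3 : ∑ b ∈ B1, (nb G A1 b).card ≤ B1.card * (8 * d) := by
      rw [← smul_eq_mul]
      exact Finset.sum_le_card_nsmul _ _ _ hnb
    have h4 : ((∑ b ∈ B1, (nb G A1 b).card : ℕ):ℝ) ≤ m * (8 * d) := by
      rw [hmdef]; exact_mod_cast h3
    rw [← Nat.cast_sum, h1] at h2
    have h5 := h2.trans h4
    rw [div_mul_eq_mul_div, le_div_iff₀ hτ]
    nlinarith
  -- lower bound
  have hlow : c1 * m * d ^ (j + 2) ≤ ((∑ b ∈ B1, (nb G A1 b).card.choose (j + 2) : ℕ) : ℝ) := by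
    have h1 : ∀ b ∈ B1, (α * d / 2 / 2) ^ (j + 2) / ((j + 2).factorial) / (8 * d) * ((nb G A1 b).card - α * d / 2) ≤
        (((nb G A1 b).card.choose (j + 2) : ℕ) : ℝ) := by
      intro b hb
      apply choose_lin
      · exact_mod_cast hnb b hb
      · positivity
      · linarith
    have h2 := Finset.sum_le_sum h1
    rw [← Finset.mul_sum, Finset.sum_sub_distrib, ← Nat.cast_sum, ← Nat.cast_sum, Finset.sum_const, nsmul_eq_mul, ← hmdef] at h2
    refine le_trans ?_ h2
    have h3 : α * d * m / 2 ≤ ((∑ b ∈ B1, (nb G A1 b).card : ℕ) : ℝ) - m * (α * d / 2) := by linarith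
    refine le_trans (le_of_eq ?_) (mul_le_mul_of_nonneg_left h3 (by positivity))
    rw [hc1]
    have : α * d / 2 / 2 = α / 4 * d := by ring
    rw [this, mul_pow]
    field_simp
    ring
  obtain ⟨p, hap⟩ : ∃ p : ℝ, a = p * d := ⟨a / d, by field_simp⟩
  obtain ⟨r, hbr⟩ : ∃ r : ℝ, b = r * d := ⟨b / d, by field_simp⟩
  have hp0 : 0 ≤ p := by
    have : 0 < p * d := hap ▸ ha
    exact (pos_of_mul_pos_left this dpos.le).le
  have hrp : 0 < r := by
    have : 0 < r * d := hbr ▸ hb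
    exact pos_of_mul_pos_left this dpos.le
  have hr0 : 0 ≤ r := by
    have : 0 < r * d := hbr ▸ hb
    exact (pos_of_mul_pos_left this dpos.le).le
  have hp1 : p ≤ 1 := le_of_mul_le_mul_right (by rw [← hap]; linarith) dpos
  have hr1 : r ≤ 1 := le_of_mul_le_mul_right (by rw [← hbr]; linarith) dpos
  have d4' : 8 ^ (j+2) * ((j:ℝ) + 2) * r ≤ c1 / 10 := by
    have : 8 ^ (j+2) * ((j:ℝ) + 2) * r * d ≤ c1 / 10 * d := by
      push_cast at d4
      rw [hbr] at d4
      linarith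
    exact le_of_mul_le_mul_right this dpos
  have hcore := core8 G hK hNW O hO hOadj A1 B1
    (fun y z => τ' * d ≤ (B1.filter (fun b => G.Adj b y ∧ G.Adj b z)).card) (j + 2) (8 * d) d ⌊τ' * d⌋₊ hj.symm hnb hOd
    (by
      intro y z h
      push Not at h
      exact Nat.le_floor h.le) (pA := p) (pB := r) hp0
      hp1 hr0 hr1
  obtain ⟨Q, hQ⟩ : ∃ Q : ℝ, Q = m * a ^ (j + 2) * r := ⟨_, rfl⟩
  have hQp : 0 < Q := by rw [hQ]; positivity
  have hfl : ((⌊τ' * d⌋₊ : ℕ):ℝ) ≤ τ' * d := Nat.floor_le (by positivity)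
  have he2r : (e2 G B1 : ℝ) ≤ 2 * d * m := by rw [hmdef]; exact_mod_cast he2
  have hl : c1 * Q ≤ ((∑ b ∈ B1, (nb G A1 b).card.choose (j + 2) : ℕ) : ℝ) * (p ^ (j+2) * r) := by
    refine le_trans (le_of_eq ?_) (mul_le_mul_of_nonneg_right hlow (by positivity))
    simp only [hQ, hap, hbr]; ring
  have hl := hl.trans hcore
  rw [← hmdef] at hl
  push_cast at hl
  push_cast at e2' e3 d4
  simp only [show j + 2 - 2 = j by omega, show 2 * (j + 2 - 1) = 2 * j + 2 by omega, show 2 * (j + 2) - 1 = 2 * j + 3 by omega] at hl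
  have t1 : ((NP G A1 B1 (fun y z => τ' * d ≤ (B1.filter (fun b => G.Adj b y ∧ G.Adj b z)).card)).card : ℝ) *
      (8 * (d:ℝ)) ^ j * (p ^ (j + 2) * r) ≤ c1 / 10 * Q := by
    calc _ ≤ (ε * d ^ 2 * m) * (8 * (d:ℝ)) ^ j * (p ^ (j + 2) * r) := by gcongr
      _ = ε * 8 ^ j * Q := by simp only [hQ, hap, hbr]; ring
      _ ≤ _ := by gcongr
  have t2 : m * (8 * (d:ℝ)) ^ (j + 2) * (8 * d + (j + 2) * d) * (p ^ (j + 2 + 1) * r) ≤ c1 / 10 * Q := by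
    calc _ = 8 ^ (j + 2) * (8 + (j + 2)) * a * Q := by simp only [hQ, hap, hbr]; ring
      _ ≤ _ := by gcongr
  have t3 : m * (8 * (d:ℝ)) ^ (j + 2) * ((j + 2) + (j + 2) ^ 2 * (⌊τ' * d⌋₊ : ℕ)) * (p ^ (j + 2) * r ^ 2) ≤
      2 * (c1 / 10 * Q) := by
    calc _ ≤ m * (8 * (d:ℝ)) ^ (j + 2) * ((j + 2) + (j + 2) ^ 2 * (τ' * d)) * (p ^ (j + 2) * r ^ 2) := by gcongr
      _ = (8 ^ (j + 2) * (j + 2) * r) * Q + (8 ^ (j + 2) * (j + 2) ^ 2 * τ' * b) * Q := by simp only [hQ, hap, hbr]; ring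
      _ ≤ (c1 / 10) * Q + (c1 / 10) * Q := by gcongr
      _ = _ := by ring
  have t4 : (e2 G B1 : ℝ) * (8 * (d:ℝ)) ^ (2 * (j + 2)) * (p ^ (2 * (j + 2)) * r ^ 2) ≤ c1 / 10 * Q := by
    calc _ ≤ (2 * d * m) * (8 * (d:ℝ)) ^ (2 * (j + 2)) * (p ^ (2 * (j + 2)) * r ^ 2) := by gcongr
      _ = 2 * 8 ^ (2 * (j + 2)) * a ^ (j + 2) * b * Q := by simp only [hQ, hap, hbr]; ring
      _ ≤ _ := by gcongr
  have t5 : ((NT G A1 B1).card : ℝ) * (8 * (d:ℝ)) ^ (2 * (j + 1)) * (p ^ (2 * j + 3) * r ^ 2) ≤ c1 / 10 * Q := by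
    calc _ ≤ (ε * d ^ 2 * m) * (8 * (d:ℝ)) ^ (2 * (j + 1)) * (p ^ (2 * j + 3) * r ^ 2) := by gcongr
      _ = ε * 8 ^ (2 * j + 2) * a ^ (j + 1) * b * Q := by simp only [hQ, hap, hbr]; ring
      _ ≤ _ := by gcongr
  have t6 : (A1.card : ℝ) * p ≤ c1 / 10 * Q := by
    calc _ ≤ (8 / τ * m) * p := by gcongr
      _ ≤ ((c1 / 10 * a ^ (j + 1) * b) * m) * p := by gcongr
      _ = _ := by simp only [hQ, hap, hbr]; ring
  have : 0 < c1 * Q := by positivity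
  linarith


def nbd {V : Type} [Fintype V] (G : SimpleGraph V) (v : V) : Finset V := Finset.univ.filter (fun u => G.Adj u v)

structure Env {V : Type} [Fintype V] (G : SimpleGraph V) (K : ℕ) (O : V → Finset V) (d : ℕ) : Prop where
  nw : NW G K
  hO : ∀ u v, G.Adj u v → u ∈ O v ∨ v ∈ O u
  hOadj : ∀ u v, v ∈ O u → G.Adj u v
  hOd : ∀ v, (O v).card ≤ d
  hdeg : ∀ v, d ≤ (nbd G v).card

def Low {V : Type} [Fintype V] (G : SimpleGraph V) (d : ℕ) : Finset V :=
  Finset.univ.filter (fun v => (nbd G v).card ≤ 8 * d)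

def Bx {V : Type} (G : SimpleGraph V) (L : Finset V) {j : ℕ} (x : Fin j → V) : Finset V :=
  L.filter (fun b => ∀ i, G.Adj (x i) b)

def hv (T : ℝ) (n : ℕ) : ℝ := if T ≤ n then (n:ℝ) else 0

def HH {V : Type} [Fintype V] (G : SimpleGraph V) (L : Finset V) (j : ℕ) (T : ℝ) : ℝ :=
  ∑ x : Fin j → V, hv T (Bx G L x).card

def Tri {V : Type} [Fintype V] (G : SimpleGraph V) : Finset (V × V × V) :=
  Finset.univ.filter (fun z => G.Adj z.1 z.2.1 ∧ G.Adj z.1 z.2.2 ∧ G.Adj z.2.1 z.2.2)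

lemma Env.e2_le {V : Type} [Fintype V] {G : SimpleGraph V} {K : ℕ} {O : V → Finset V} {d : ℕ} (h : Env G K O d)
    (S : Finset V) : e2 G S ≤ 2 * d * S.card := by
  have h1 : (S ×ˢ S).filter (fun z : V × V => G.Adj z.1 z.2) ⊆
      (S.sigma O).image (fun z => (z.1, z.2)) ∪ (S.sigma O).image (fun z => (z.2, z.1)) := by
    intro z hz
    rw [Finset.mem_filter, Finset.mem_product] at hz
    rw [Finset.mem_union, Finset.mem_image, Finset.mem_image]
    rcases h.hO _ _ hz.2 with h' | h'
    · right; exact ⟨⟨z.2, z.1⟩, Finset.mem_sigma.2 ⟨hz.1.2, h'⟩, rfl⟩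
    · left; exact ⟨⟨z.1, z.2⟩, Finset.mem_sigma.2 ⟨hz.1.1, h'⟩, rfl⟩
  have h2 : (S.sigma O).card ≤ S.card * d := by
    rw [Finset.card_sigma, ← smul_eq_mul]
    exact Finset.sum_le_card_nsmul _ _ _ (fun v _ => h.hOd v)
  unfold e2
  have h3 := Finset.card_le_card h1
  have h4 := Finset.card_union_le ((S.sigma O).image (fun z => (z.1, z.2))) ((S.sigma O).image (fun z => (z.2, z.1)))
  have h5 := Finset.card_image_le (s := S.sigma O) (f := fun z => (z.1, z.2))
  have h6 := Finset.card_image_le (s := S.sigma O) (f := fun z => (z.2, z.1))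
  nlinarith

lemma Env.low {V : Type} [Fintype V] {G : SimpleGraph V} {K : ℕ} {O : V → Finset V} {d : ℕ} (h : Env G K O d)
    (hd : 1 ≤ d) : 3 * Fintype.card V ≤ 4 * (Low G d).card := by
  have h1 := h.e2_le Finset.univ
  have h2 : e2 G Finset.univ = ∑ v, (nbd G v).card := e2_eq G _
  have h3 : (Finset.univ.filter (fun v => ¬ (nbd G v).card ≤ 8 * d)).card * (8 * d) ≤
      ∑ v ∈ Finset.univ.filter (fun v => ¬ (nbd G v).card ≤ 8 * d), (nbd G v).card := by
    rw [← smul_eq_mul]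
    apply Finset.card_nsmul_le_sum
    intro v hv
    have := (Finset.mem_filter.1 hv).2
    omega
  have h4 : ∑ v ∈ Finset.univ.filter (fun v => ¬ (nbd G v).card ≤ 8 * d), (nbd G v).card ≤ ∑ v, (nbd G v).card :=
    Finset.sum_le_sum_of_subset (Finset.filter_subset _ _)
  have h5 := Finset.card_filter_add_card_filter_not (s := (Finset.univ : Finset V)) (fun v => (nbd G v).card ≤ 8 * d)
  rw [Finset.card_univ] at h1 h5
  unfold Low
  have h6 : (Finset.univ.filter (fun v => ¬ (nbd G v).card ≤ 8 * d)).card * 8 * d ≤ 2 * Fintype.card V * d := by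
    nlinarith
  have h7 := Nat.le_of_mul_le_mul_right h6 (by omega)
  omega

lemma sum_tuple {V ι : Type} [Fintype V] (G : SimpleGraph V) (F : Finset ι) (β : ι → V) (j : ℕ) :
    ∑ x : Fin j → V, (F.filter (fun t => ∀ i, G.Adj (x i) (β t))).card = ∑ t ∈ F, (nbd G (β t)).card ^ j := by
  have h1 := Finset.sum_card_bipartiteAbove_eq_sum_card_bipartiteBelow (s := (Finset.univ : Finset (Fin j → V))) (t := F)
    (fun x t => ∀ i, G.Adj (x i) (β t))
  unfold Finset.bipartiteAbove Finset.bipartiteBelow at h1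
  rw [h1]
  apply Finset.sum_congr rfl
  intro t _
  rw [← card_pw]
  congr 1
  ext x
  simp [mem_pw, nbd]

lemma Bx_cons {V : Type} (G : SimpleGraph V) (L : Finset V) {j : ℕ} (y : V) (x : Fin j → V) :
    Bx G L (Fin.cons y x : Fin (j+1) → V) = (Bx G L x).filter (fun b => G.Adj b y) := by
  ext b
  simp only [Bx, Finset.mem_filter, Fin.forall_fin_succ, Fin.cons_zero, Fin.cons_succ, G.adj_comm b y]
  tauto

lemma sum_cons {V : Type} [Fintype V] {j : ℕ} (f : (Fin (j+1) → V) → ℝ) :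
    ∑ x, f x = ∑ x : Fin j → V, ∑ y : V, f (Fin.cons y x : Fin (j+1) → V) := by
  rw [← (Fin.consEquiv (fun _ : Fin (j+1) => V)).sum_comp, Fintype.sum_prod_type, Finset.sum_comm]
  rfl

def PP (K j : ℕ) : Prop := ∃ θ τ δ : ℝ, 0 < θ ∧ 0 < τ ∧ 0 < δ ∧ ∃ d0 : ℕ, ∀ (V : Type) [Fintype V] (G : SimpleGraph V)
    (O : V → Finset V) (d : ℕ), Env G K O d → d0 ≤ d → ((Tri G).card : ℝ) ≤ δ * Fintype.card V * d ^ 2 →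
    θ * Fintype.card V * d ^ j ≤ HH G (Low G d) j (τ * d)

lemma PP_one (K : ℕ) : PP K 1 := by
  refine ⟨1/2, 1/4, 1, by norm_num, by norm_num, by norm_num, 1, ?_⟩
  intro V _ G O d hE hd _
  unfold HH
  have h1 : ∀ x : Fin 1 → V, ((Bx G (Low G d) x).card : ℝ) - 1/4 * d ≤ hv (1/4 * d) (Bx G (Low G d) x).card := by
    intro x
    unfold hv
    split_ifs with h
    · have : (0:ℝ) ≤ d := by positivity
      linarith
    · linarith
  have h2 := Finset.sum_le_sum (fun x (_ : x ∈ (Finset.univ : Finset (Fin 1 → V))) => h1 x)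
  refine le_trans ?_ h2
  rw [Finset.sum_sub_distrib, ← Nat.cast_sum]
  have h3 := sum_tuple G (Low G d) (fun b => b) 1
  unfold Bx
  rw [h3]
  have h4 : (Low G d).card * d ≤ ∑ t ∈ Low G d, (nbd G t).card ^ 1 := by
    rw [← smul_eq_mul]
    apply Finset.card_nsmul_le_sum
    intro v _
    rw [pow_one]; exact hE.hdeg v
  have h5 := hE.low hd
  have h6 : ((Low G d).card * d : ℝ) ≤ ((∑ t ∈ Low G d, (nbd G t).card ^ 1 : ℕ):ℝ) := by exact_mod_cast h4
  have h7 : (3 * Fintype.card V : ℝ) ≤ 4 * (Low G d).card := by exact_mod_cast h5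
  have h8 : (0:ℝ) ≤ d := by positivity
  simp only [Finset.sum_const, Finset.card_univ, Fintype.card_fun, Fintype.card_fin, nsmul_eq_mul, pow_one] at h6 ⊢
  nlinarith

lemma hv_nonneg (T : ℝ) (n : ℕ) : 0 ≤ hv T n := by
  unfold hv; split_ifs <;> positivity

set_option maxHeartbeats 1000000 in
lemma PP_succ (K : ℕ) (hK : 1 ≤ K) (j : ℕ) (h : PP K (j + 1)) : PP K (j + 2) := by
  obtain ⟨θ, τ, δ, hθ, hτ, hδ, d0, hP⟩ := h
  obtain ⟨τ', ε, hτ', hε, d1, h8⟩ := lemma8 K hK (θ / (4 * 8 ^ j)) τ (by positivity) hτ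
  refine ⟨θ * ε / 16, τ', min δ (θ * ε / (4 * 8 * 8 ^ j)), by positivity, hτ', lt_min hδ (by positivity), d0 + d1 + 1, ?_⟩
  intro V _ G O d hE hd hTri
  have hdpos : (0:ℝ) < d := by
    have : 0 < d := by omega
    exact_mod_cast this
  obtain ⟨n, hn⟩ : ∃ n : ℝ, n = Fintype.card V := ⟨_, rfl⟩
  have hn0 : 0 ≤ n := by rw [hn]; positivity
  have hPP := hP V G O d hE (by omega) (hTri.trans (by gcongr; exact min_le_left _ _))
  have hTri2 : ((Tri G).card : ℝ) ≤ (θ * ε / (4 * 8 * 8 ^ j)) * n * d ^ 2 := by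
    rw [hn]
    exact (hTri.trans (by gcongr; exact min_le_right _ _))
  rw [← hn] at hPP ⊢
  obtain ⟨L, hL⟩ : ∃ L, L = Low G d := ⟨_, rfl⟩
  rw [← hL] at hPP ⊢
  have hLd : ∀ b ∈ L, (nbd G b).card ≤ 8 * d := by
    intro b hb
    rw [hL] at hb
    exact (Finset.mem_filter.1 hb).2
  -- pointwise
  have hpt : ∀ x : Fin j → V, ∑ y : V, hv (τ * d) (Bx G L (Fin.cons y x : Fin (j+1) → V)).card ≤
      θ / (4 * 8 ^ j) * d * (Bx G L x).card + 8 / (ε * d) *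
      (∑ z : V, ∑ y : V, hv (τ' * d) (Bx G L (Fin.cons y (Fin.cons z x : Fin (j+1) → V) : Fin (j+2) → V)).card +
       ((((Tri G).filter (fun t => t.1 ∈ L)).filter (fun t => ∀ i, G.Adj (x i) t.1)).card : ℝ)) := by
    intro x
    obtain ⟨B, hB⟩ : ∃ B, B = Bx G L x := ⟨_, rfl⟩
    have hBL : ∀ b ∈ B, (nbd G b).card ≤ 8 * d := by
      intro b hb
      rw [hB] at hb
      exact hLd b (Finset.mem_filter.1 hb).1
    simp only [Bx_cons, ← hB]
    obtain ⟨A, hA⟩ : ∃ A : Finset V, A = Finset.univ.filter (fun y => τ * d ≤ (B.filter (fun b => G.Adj b y)).card) := ⟨_, rfl⟩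
    have e1 : ∑ y : V, hv (τ * d) (B.filter (fun b => G.Adj b y)).card = ((∑ b ∈ B, (nb G A b).card : ℕ):ℝ) := by
      have h1 : ∑ y ∈ A, (B.filter (fun b => G.Adj b y)).card = ∑ b ∈ B, (nb G A b).card := by
        unfold nb
        exact (Finset.sum_card_bipartiteAbove_eq_sum_card_bipartiteBelow (s := B) (t := A) (fun b y => G.Adj b y)).symm
      rw [← h1, hA, Nat.cast_sum, Finset.sum_filter]
      rfl
    rw [e1]
    have hnb : ∀ b ∈ B, (nb G A b).card ≤ 8 * d := by
      intro b hb
      refine (Finset.card_le_card ?_).trans (hBL b hb)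
      intro y hy
      simp only [nb, nbd, Finset.mem_filter, Finset.mem_univ, true_and] at hy ⊢
      exact hy.2.symm
    obtain ⟨T, hT⟩ : ∃ T : Finset (V × V × V), T = ((Tri G).filter (fun t => t.1 ∈ L)).filter (fun t => ∀ i, G.Adj (x i) t.1) := ⟨_, rfl⟩
    rw [← hT]
    have memT : ∀ t : V × V × V, t ∈ T ↔ t.1 ∈ B ∧ G.Adj t.1 t.2.1 ∧ G.Adj t.1 t.2.2 ∧ G.Adj t.2.1 t.2.2 := by
      intro t
      rw [hT, hB]
      simp only [Tri, Bx, Finset.mem_filter, Finset.mem_univ, true_and]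
      tauto
    obtain ⟨Px, hPx⟩ : ∃ Px : ℝ, Px = ∑ z : V, ∑ y : V, hv (τ' * d) (((B.filter (fun b => G.Adj b z)).filter (fun b => G.Adj b y)).card) := ⟨_, rfl⟩
    rw [← hPx]
    have hPx0 : 0 ≤ Px := by
      rw [hPx]
      exact Finset.sum_nonneg (fun _ _ => Finset.sum_nonneg (fun _ _ => hv_nonneg _ _))
    have hNT : (NT G A B).card ≤ T.card := by
      apply Finset.card_le_card
      intro t ht
      rw [memT]
      simp only [NT, Finset.mem_filter, Finset.mem_product] at ht
      exact ⟨ht.1.1, ht.2.1, ht.2.2.1, ht.2.2.2⟩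
    have hNP : ((NP G A B (fun y z => τ' * d ≤ (B.filter (fun b => G.Adj b y ∧ G.Adj b z)).card)).card : ℝ) ≤ Px + T.card := by
      obtain ⟨Q, hQ⟩ : ∃ Q : Finset (V × V × V), Q = Finset.univ.filter (fun t => (t.1 ∈ B ∧ G.Adj t.1 t.2.1 ∧ G.Adj t.1 t.2.2) ∧
        τ' * d ≤ (B.filter (fun b => G.Adj b t.2.1 ∧ G.Adj b t.2.2)).card) := ⟨_, rfl⟩
      have s1 : NP G A B (fun y z => τ' * d ≤ (B.filter (fun b => G.Adj b y ∧ G.Adj b z)).card) ⊆ Q ∪ T := by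
        intro t ht
        rw [Finset.mem_union, memT, hQ]
        simp only [NP, Finset.mem_filter, Finset.mem_product, Finset.mem_univ, true_and] at ht ⊢
        tauto
      have s2 : (Q.card : ℝ) = Px := by
        rw [hPx, hQ, Finset.card_filter, Fintype.sum_prod_type, Nat.cast_sum]
        simp only [Fintype.sum_prod_type, Nat.cast_sum]
        rw [Finset.sum_comm]
        apply Finset.sum_congr rfl
        intro y _
        rw [Finset.sum_comm]
        apply Finset.sum_congr rfl
        intro z _
        rw [Finset.filter_filter]
        unfold hv
        by_cases hh : τ' * d ≤ (B.filter (fun b => G.Adj b y ∧ G.Adj b z)).card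
        · rw [if_pos hh]
          simp only [hh, and_true]
          rw [← Nat.cast_sum, ← Finset.card_filter]
          congr 2
          ext b; simp
        · rw [if_neg hh]
          simp only [hh, and_false]
          simp
      rw [← s2]
      exact_mod_cast (Finset.card_le_card s1).trans (Finset.card_union_le _ _)
    have hT0 : (0:ℝ) ≤ T.card := by positivity
    have hNTr : ((NT G A B).card : ℝ) ≤ T.card := by exact_mod_cast hNT
    by_cases hBn : B.Nonempty
    · by_contra hcon
      push Not at hcon
      have r1 : 0 ≤ 8 / (ε * d) * (Px + T.card) := by positivity
      have r2 : 0 ≤ θ / (4 * 8 ^ j) * d * B.card := by positivity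
      have hEle : ((∑ b ∈ B, (nb G A b).card : ℕ):ℝ) ≤ B.card * (8 * d) := by
        have : ∑ b ∈ B, (nb G A b).card ≤ B.card * (8 * d) := by
          rw [← smul_eq_mul]
          exact Finset.sum_le_card_nsmul _ _ _ hnb
        exact_mod_cast this
      have r3 : 8 / (ε * d) * (Px + T.card) < B.card * (8 * d) := by linarith
      rw [div_mul_eq_mul_div, div_lt_iff₀ (by positivity)] at r3
      have r4 : Px + T.card ≤ ε * d ^ 2 * B.card := by nlinarith
      refine h8 V G hE.nw O d (by omega) hE.hO hE.hOadj hE.hOd A B hBn hnb ?_ ?_ (hE.e2_le B) ?_ ?_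
      · intro y hy
        rw [hA] at hy
        exact (Finset.mem_filter.1 hy).2
      · linarith
      · linarith
      · linarith
    · rw [Finset.not_nonempty_iff_eq_empty] at hBn
      rw [hBn]
      simp only [Finset.sum_empty, Nat.cast_zero]
      positivity
  have hsum := Finset.sum_le_sum (fun x (_ : x ∈ (Finset.univ : Finset (Fin j → V))) => hpt x)
  rw [Finset.sum_add_distrib, ← Finset.mul_sum, ← Finset.mul_sum, Finset.sum_add_distrib, ← Nat.cast_sum, ← Nat.cast_sum,
    ← sum_cons (fun x => hv (τ * d) (Bx G L x).card)] at hsum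
  have hH2 : HH G L (j + 2) (τ' * d) = ∑ x : Fin j → V, ∑ z : V, ∑ y : V, hv (τ' * d) (Bx G L (Fin.cons y (Fin.cons z x : Fin (j+1) → V) : Fin (j+2) → V)).card := by
    unfold HH
    rw [sum_cons (fun x => hv (τ' * d) (Bx G L x).card), sum_cons]
  rw [← hH2] at hsum
  have m1 := sum_tuple G L (fun b => b) j
  have m2 : ∑ x : Fin j → V, (Bx G L x).card = ∑ t ∈ L, (nbd G t).card ^ j := m1
  have m3 : ∑ t ∈ L, (nbd G t).card ^ j ≤ Fintype.card V * (8 * d) ^ j := by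
    refine (Finset.sum_le_card_nsmul _ _ ((8 * d) ^ j) ?_).trans ?_
    · intro t ht; exact Nat.pow_le_pow_left (hLd t ht) _
    · rw [smul_eq_mul]; exact Nat.mul_le_mul_right _ (Finset.card_le_univ _)
  have m4 : ((∑ x : Fin j → V, (Bx G L x).card : ℕ):ℝ) ≤ n * (8 * d) ^ j := by
    rw [m2, hn]; exact_mod_cast m3
  have m5 := sum_tuple G ((Tri G).filter (fun t => t.1 ∈ L)) (fun t => t.1) j
  have m6 : ∑ t ∈ (Tri G).filter (fun t => t.1 ∈ L), (nbd G t.1).card ^ j ≤ (Tri G).card * (8 * d) ^ j := by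
    refine (Finset.sum_le_card_nsmul _ _ ((8 * d) ^ j) ?_).trans ?_
    · intro t ht; exact Nat.pow_le_pow_left (hLd t.1 (Finset.mem_filter.1 ht).2) _
    · rw [smul_eq_mul]; exact Nat.mul_le_mul_right _ (Finset.card_filter_le _ _)
  have m7 : ((∑ x : Fin j → V, (((Tri G).filter (fun t => t.1 ∈ L)).filter (fun t => ∀ i, G.Adj (x i) t.1)).card : ℕ):ℝ) ≤
      (θ * ε / (4 * 8 * 8 ^ j)) * n * d ^ 2 * (8 * d) ^ j := by
    rw [m5]
    refine le_trans (b := ((Tri G).card : ℝ) * (8 * d) ^ j) (by exact_mod_cast m6) ?_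
    gcongr
  have hfin : θ * n * d ^ (j + 1) ≤ θ / (4 * 8 ^ j) * d * (n * (8 * d) ^ j) + 8 / (ε * d) *
      (HH G L (j + 2) (τ' * d) + (θ * ε / (4 * 8 * 8 ^ j)) * n * d ^ 2 * (8 * d) ^ j) := by
    refine hPP.trans (hsum.trans ?_)
    gcongr
  have k1 : θ / (4 * 8 ^ j) * d * (n * (8 * d) ^ j) = θ * n * d ^ (j + 1) / 4 := by
    rw [mul_pow]; field_simp; ring
  have k2 : 8 / (ε * d) * ((θ * ε / (4 * 8 * 8 ^ j)) * n * d ^ 2 * (8 * d) ^ j) = θ * n * d ^ (j + 1) / 4 := by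
    rw [mul_pow]; field_simp; ring
  rw [mul_add, k1, k2] at hfin
  have k3 : θ * n * d ^ (j + 1) / 2 ≤ 8 / (ε * d) * HH G L (j + 2) (τ' * d) := by linarith
  rw [div_mul_eq_mul_div, le_div_iff₀ (by positivity)] at k3
  have k4 : θ * ε / 16 * n * (d:ℝ) ^ (j + 2) = (θ * n * d ^ (j + 1) / 2 * (ε * d)) / 8 := by ring
  rw [k4]
  linarith

lemma PP_all (K : ℕ) (hK : 1 ≤ K) (j : ℕ) : PP K (j + 1) := by
  induction j with
  | zero => exact PP_one K
  | succ j ih => exact PP_succ K hK j ih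


lemma tri_bound {V : Type} [Fintype V] (G : SimpleGraph V) (O : V → Finset V)
    (hT : ∀ u v w, G.Adj u v → G.Adj u w → G.Adj v w → (v ∈ O u ∧ w ∈ O u) ∨ (u ∈ O v ∧ w ∈ O v) ∨ (u ∈ O w ∧ v ∈ O w)) :
    (Tri G).card ≤ 3 * ∑ v, e2 G (O v) := by
  obtain ⟨S, hS⟩ : ∃ S : Finset (Σ _ : V, V × V), S = (Finset.univ : Finset V).sigma
    (fun v => (O v ×ˢ O v).filter (fun z => G.Adj z.1 z.2)) := ⟨_, rfl⟩
  have hSc : S.card = ∑ v, e2 G (O v) := by rw [hS, Finset.card_sigma]; rfl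
  have hsub : Tri G ⊆ S.image (fun z => (z.1, z.2.1, z.2.2)) ∪ (S.image (fun z => (z.2.1, z.1, z.2.2)) ∪
      S.image (fun z => (z.2.1, z.2.2, z.1))) := by
    rintro ⟨u, v, w⟩ ht
    simp only [Tri, Finset.mem_filter, Finset.mem_univ, true_and] at ht
    obtain ⟨h1, h2, h3⟩ := ht
    rw [Finset.mem_union, Finset.mem_union, Finset.mem_image, Finset.mem_image, Finset.mem_image]
    have memS : ∀ a b c, b ∈ O a → c ∈ O a → G.Adj b c → (⟨a, (b, c)⟩ : Σ _ : V, V × V) ∈ S := by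
      intro a b c hb hc hbc
      rw [hS]
      simp [hb, hc, hbc]
    rcases hT u v w h1 h2 h3 with h | h | h
    · left; exact ⟨_, memS u v w h.1 h.2 h3, rfl⟩
    · right; left; exact ⟨_, memS v u w h.1 h.2 h2, rfl⟩
    · right; right; exact ⟨_, memS w u v h.1 h.2 h1, rfl⟩
  have h3 := Finset.card_le_card hsub
  have h4 := Finset.card_union_le (S.image (fun z => (z.1, z.2.1, z.2.2))) (S.image (fun z => (z.2.1, z.1, z.2.2)) ∪
      S.image (fun z => (z.2.1, z.2.2, z.1)))
  have h5 := Finset.card_union_le (S.image (fun z => (z.2.1, z.1, z.2.2))) (S.image (fun z => (z.2.1, z.2.2, z.1)))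
  have i1 := Finset.card_image_le (s := S) (f := fun z => (z.1, z.2.1, z.2.2))
  have i2 := Finset.card_image_le (s := S) (f := fun z => (z.2.1, z.1, z.2.2))
  have i3 := Finset.card_image_le (s := S) (f := fun z => (z.2.1, z.2.2, z.1))
  omega

set_option maxHeartbeats 1000000 in
lemma main1 {K D q : ℕ} (P : Pat K D q) : ∃ g : ℕ → ℕ, PB g ∧ ∀ (V : Type) [Fintype V] [Nonempty V] (G : SimpleGraph V)
    (O : V → Finset V) (d s : ℕ), 1 ≤ s → Env G K O d → NoBic G s →
    (∀ u v w, G.Adj u v → G.Adj u w → G.Adj v w → (v ∈ O u ∧ w ∈ O u) ∨ (u ∈ O v ∧ w ∈ O v) ∨ (u ∈ O w ∧ v ∈ O w)) →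
    d < g s := by
  have hK : 1 ≤ K := by have := P.two; omega
  obtain ⟨θ, τ, δ, hθ, hτ, hδ, d0, hP⟩ := PP_all K hK D
  obtain ⟨h5, h5p, h5h⟩ := lemma5 P
  obtain ⟨h6, h6p, h6h⟩ := lemma6 P
  obtain ⟨M, hM⟩ := exists_nat_ge (1 + 3 / δ + 8 ^ (D + 1) / θ)
  obtain ⟨N, hN⟩ := exists_nat_ge (1 / τ)
  have q1 : 0 ≤ 3 / δ := by positivity
  have q2 : 0 ≤ 8 ^ (D + 1) / θ := by positivity
  have hM1 : 1 ≤ M := by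
    have : (1:ℝ) ≤ M := by linarith
    exact_mod_cast this
  have hMp : PB (fun s => M * s) := (PB.const M).mul PB.id
  have hM' : ∀ s, 1 ≤ s → 1 ≤ M * s := fun s hs => Nat.one_le_iff_ne_zero.2 (by positivity)
  refine ⟨fun s => (d0 + 1) + (M * s) * h5 (M * s) + (N + 1) * h6 (M * s), ?_, ?_⟩
  · exact ((PB.const (d0 + 1)).add (hMp.mul (h5p.comp hMp hM'))).add ((PB.const (N+1)).mul (h6p.comp hMp hM'))
  intro V _ _ G O d s hs hE hB hT
  by_contra hcon
  push Not at hcon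
  obtain ⟨x, hx⟩ : ∃ x, x = M * s := ⟨_, rfl⟩
  rw [← hx] at hcon
  have hx1 : 1 ≤ x := hx ▸ hM' s hs
  have hBx : NoBic G x := hB.mono (by rw [hx]; nlinarith)
  have d1 : d0 + 1 ≤ d := by
    have : 0 ≤ x * h5 x := Nat.zero_le _
    have : 0 ≤ (N + 1) * h6 x := Nat.zero_le _
    omega
  have d2 : x * h5 x ≤ d := by omega
  have d3 : (N + 1) * h6 x ≤ d := by omega
  have hMx : (M:ℝ) ≤ x := by
    rw [hx]; exact_mod_cast Nat.le_mul_of_pos_right _ hs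
  have hxp : (0:ℝ) < x := by exact_mod_cast hx1
  have hdp : (0:ℝ) < d := by
    have : 0 < d := by omega
    exact_mod_cast this
  have hnp : (0:ℝ) < Fintype.card V := by exact_mod_cast Fintype.card_pos
  have he : ∀ v, e2 G (O v) * x ≤ d ^ 2 := by
    intro v
    by_cases h : h5 x ≤ (O v).card
    · refine (h5h V G x hx1 hBx hE.nw (O v) h).le.trans (Nat.pow_le_pow_left (hE.hOd v) 2)
    · push Not at h
      have a1 : e2 G (O v) ≤ (O v).card * (O v).card := by
        unfold e2
        refine (Finset.card_filter_le _ _).trans ?_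
        rw [Finset.card_product]
      have a2 : (O v).card * (O v).card ≤ h5 x * h5 x := Nat.mul_le_mul h.le h.le
      calc e2 G (O v) * x ≤ (h5 x * h5 x) * x := Nat.mul_le_mul_right _ (a1.trans a2)
        _ ≤ (h5 x * h5 x) * x * x := Nat.le_mul_of_pos_right _ hx1
        _ = (x * h5 x) ^ 2 := by ring
        _ ≤ d ^ 2 := Nat.pow_le_pow_left d2 2
  have htri : (Tri G).card * x ≤ 3 * (Fintype.card V * d ^ 2) := by
    calc (Tri G).card * x ≤ 3 * (∑ v, e2 G (O v)) * x := Nat.mul_le_mul_right _ (tri_bound G O hT)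
      _ = 3 * ∑ v, e2 G (O v) * x := by rw [mul_assoc, Finset.sum_mul]
      _ ≤ 3 * ∑ v : V, d ^ 2 := Nat.mul_le_mul_left _ (Finset.sum_le_sum (fun v _ => he v))
      _ = _ := by simp
  have htri' : ((Tri G).card : ℝ) ≤ δ * Fintype.card V * d ^ 2 := by
    have t1 : ((Tri G).card : ℝ) * x ≤ 3 * (Fintype.card V * d ^ 2) := by exact_mod_cast htri
    have t2 : 3 ≤ x * δ := by
      have : 3 / δ ≤ x := by linarith
      rwa [div_le_iff₀ hδ] at this
    have t3 : ((Tri G).card : ℝ) * x ≤ (δ * Fintype.card V * d ^ 2) * x := by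
      calc ((Tri G).card : ℝ) * x ≤ 3 * (Fintype.card V * d ^ 2) := t1
        _ ≤ (x * δ) * (Fintype.card V * d ^ 2) := by gcongr
        _ = _ := by ring
    exact le_of_mul_le_mul_right t3 hxp
  have hH := hP V G O d hE (by omega) htri'
  obtain ⟨T, hTd⟩ : ∃ T : ℕ, T = ⌈τ * d⌉₊ := ⟨_, rfl⟩
  have hNτ : 1 ≤ N * τ := by rwa [div_le_iff₀ hτ] at hN
  have hTh : h6 x ≤ T := by
    have : (h6 x : ℝ) ≤ τ * d := by
      have e : ((N:ℝ) + 1) * h6 x ≤ d := by exact_mod_cast d3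
      have e0 : (0:ℝ) ≤ h6 x := by positivity
      calc (h6 x : ℝ) = 1 * h6 x := by ring
        _ ≤ (N * τ) * h6 x := by gcongr
        _ ≤ ((N + 1) * τ) * h6 x := by gcongr; linarith
        _ = τ * (((N:ℝ) + 1) * h6 x) := by ring
        _ ≤ τ * d := by gcongr
    rw [hTd]
    exact_mod_cast this.trans (Nat.le_ceil _)
  obtain ⟨L, hL⟩ : ∃ L, L = Low G d := ⟨_, rfl⟩
  rw [← hL] at hH
  have hHeq : HH G L (D + 1) (τ * d) = ((∑ b ∈ L, ((pw (nbd G b) (D+1)).filter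
      (fun y => T ≤ (L.filter (fun v => ∀ i, G.Adj (y i) v)).card)).card : ℕ):ℝ) := by
    have s1 : HH G L (D + 1) (τ * d) = ((∑ y ∈ (Finset.univ : Finset (Fin (D+1) → V)).filter (fun y => T ≤ (Bx G L y).card), (Bx G L y).card : ℕ):ℝ) := by
      unfold HH hv
      rw [Nat.cast_sum, Finset.sum_filter]
      apply Finset.sum_congr rfl
      intro y _
      have : (T ≤ (Bx G L y).card) ↔ τ * d ≤ (Bx G L y).card := by rw [hTd, Nat.ceil_le]
      simp only [this]
    rw [s1]
    congr 1
    have h1 := Finset.sum_card_bipartiteAbove_eq_sum_card_bipartiteBelow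
      (s := (Finset.univ : Finset (Fin (D+1) → V)).filter (fun y => T ≤ (Bx G L y).card)) (t := L)
      (fun x t => ∀ i, G.Adj (x i) t)
    unfold Finset.bipartiteAbove Finset.bipartiteBelow at h1
    refine h1.trans (Finset.sum_congr rfl ?_)
    intro b _
    congr 1
    ext y
    rw [Finset.mem_filter, Finset.mem_filter, Finset.mem_filter, mem_pw]
    simp only [nbd, Finset.mem_filter, Finset.mem_univ, true_and]
    exact and_comm
  have hup : (∑ b ∈ L, ((pw (nbd G b) (D+1)).filter
      (fun y => T ≤ (L.filter (fun v => ∀ i, G.Adj (y i) v)).card)).card) * x ≤ Fintype.card V * (8 * d) ^ (D + 1) := by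
    rw [Finset.sum_mul]
    refine (Finset.sum_le_card_nsmul _ _ ((8 * d) ^ (D + 1)) ?_).trans ?_
    · intro b hb
      have hd3 : h6 x ≤ d := by nlinarith
      refine (h6h V G x hx1 hBx hE.nw (nbd G b) L T (hd3.trans (hE.hdeg b)) hTh).trans ?_
      rw [hL] at hb
      exact Nat.pow_le_pow_left (Finset.mem_filter.1 hb).2 _
    · rw [smul_eq_mul]
      exact Nat.mul_le_mul_right _ (Finset.card_le_univ _)
  have hup' : HH G L (D + 1) (τ * d) * x ≤ Fintype.card V * (8 * d) ^ (D + 1) := by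
    rw [hHeq]; exact_mod_cast hup
  have f1 : θ * Fintype.card V * d ^ (D + 1) * x ≤ Fintype.card V * (8 * d) ^ (D + 1) :=
    (mul_le_mul_of_nonneg_right hH hxp.le).trans hup'
  have f2 : 8 ^ (D + 1) < θ * x := by
    have : 8 ^ (D + 1) / θ < x := by linarith
    rw [div_lt_iff₀ hθ] at this
    linarith
  have f3 : 8 ^ (D + 1) * (Fintype.card V * (d:ℝ) ^ (D + 1)) < θ * x * (Fintype.card V * (d:ℝ) ^ (D + 1)) :=
    mul_lt_mul_of_pos_right f2 (by positivity)
  rw [mul_pow] at f1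
  linarith


lemma affine_meet {p : ℕ} [Fact p.Prime] (l l' i i' : ZMod p × ZMod p) (hne : l ≠ l')
    (h1 : i.2 = l.1 * i.1 + l.2) (h2 : i.2 = l'.1 * i.1 + l'.2)
    (h3 : i'.2 = l.1 * i'.1 + l.2) (h4 : i'.2 = l'.1 * i'.1 + l'.2) : i = i' := by
  obtain ⟨m, c⟩ := l
  obtain ⟨m', c'⟩ := l'
  obtain ⟨a, b⟩ := i
  obtain ⟨a', b'⟩ := i'
  simp only at h1 h2 h3 h4
  have hm : m - m' ≠ 0 := by
    intro h0
    have h0 : m = m' := sub_eq_zero.1 h0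
    apply hne
    rw [h0] at h1 ⊢
    have : c = c' := by
      have := h1.symm.trans h2
      exact add_left_cancel this
    rw [this]
  have ha : a = a' := by
    have : (m - m') * (a - a') = 0 := by linear_combination h2 - h1 + h3 - h4
    rcases mul_eq_zero.1 this with h | h
    · exact absurd h hm
    · exact sub_eq_zero.1 h
  rw [ha] at h1 ⊢
  rw [h1, h3]

lemma pat_exists (K : ℕ) (hK : 2 ≤ K) : ∃ D q, Nonempty (Pat K D q) := by
  obtain ⟨p, hp, hpp⟩ := Nat.exists_infinite_primes K
  haveI : Fact p.Prime := ⟨hpp⟩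
  let e := Fintype.equivFin (ZMod p × ZMod p)
  refine ⟨Fintype.card (ZMod p × ZMod p), Fintype.card (ZMod p × ZMod p), ⟨?_⟩⟩
  refine { I := fun i l => (e.symm i).2 = (e.symm l).1 * (e.symm i).1 + (e.symm l).2
           two := hK, line := ?_, pt := ?_, meet := ?_, Dpos := Fintype.card_pos }
  · intro l
    refine hp.trans ?_
    have h1 : ((Finset.univ : Finset (ZMod p)).image (fun a => e (a, (e.symm l).1 * a + (e.symm l).2))).card = p := by
      rw [Finset.card_image_of_injective, Finset.card_univ, ZMod.card]
      intro a a' h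
      have := e.injective h
      exact (Prod.ext_iff.1 this).1
    refine h1.symm.le.trans (Finset.card_le_card ?_)
    intro i hi
    obtain ⟨a, -, rfl⟩ := Finset.mem_image.1 hi
    simp
  · intro i
    refine hp.trans ?_
    have h1 : ((Finset.univ : Finset (ZMod p)).image (fun m => e (m, (e.symm i).2 - m * (e.symm i).1))).card = p := by
      rw [Finset.card_image_of_injective, Finset.card_univ, ZMod.card]
      intro a a' h
      have := e.injective h
      exact (Prod.ext_iff.1 this).1
    refine h1.symm.le.trans (Finset.card_le_card ?_)
    intro l hl
    obtain ⟨a, -, rfl⟩ := Finset.mem_image.1 hl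
    simp
  · intro l l' hll
    rw [Finset.card_le_one]
    intro i hi i' hi'
    simp only [Finset.mem_filter, Finset.mem_univ, true_and] at hi hi'
    have hne : e.symm l ≠ e.symm l' := fun h => hll (e.symm.injective h)
    apply e.symm.injective
    exact affine_meet (e.symm l) (e.symm l') (e.symm i) (e.symm i') hne hi.1 hi.2 hi'.1 hi'.2

lemma rank_exists {V : Type} [Fintype V] (G : SimpleGraph V) (d : ℕ)
    (h : ∀ R : Finset V, R.Nonempty → ∃ v ∈ R, (R.filter (fun u => G.Adj u v)).card ≤ d) (R : Finset V) :
    ∃ r : V → ℕ, Set.InjOn r R ∧ ∀ v ∈ R, (R.filter (fun u => G.Adj u v ∧ r u < r v)).card ≤ d := by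
  induction R using Finset.strongInduction with
  | H R ih =>
    by_cases hR : R.Nonempty
    · obtain ⟨v, hv, hvd⟩ := h R hR
      obtain ⟨r', hr1, hr2⟩ := ih (R.erase v) (Finset.erase_ssubset hv)
      obtain ⟨N, hN⟩ : ∃ N, ∀ u, r' u < N := ⟨∑ u, r' u + 1, fun u => Nat.lt_succ_of_le (Finset.single_le_sum (fun _ _ => Nat.zero_le _) (Finset.mem_univ u))⟩
      refine ⟨fun u => if u = v then N else r' u, ?_, ?_⟩
      · intro a ha b hb hab
        have ha := Finset.mem_coe.1 ha
        have hb := Finset.mem_coe.1 hb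
        by_cases h1 : a = v <;> by_cases h2 : b = v
        · rw [h1, h2]
        · simp only [h1, h2, if_true, if_false] at hab
          have := hN b; omega
        · simp only [h1, h2, if_true, if_false] at hab
          have := hN a; omega
        · simp only [h1, h2, if_false] at hab
          exact hr1 (Finset.mem_coe.2 (Finset.mem_erase.2 ⟨h1, ha⟩)) (Finset.mem_coe.2 (Finset.mem_erase.2 ⟨h2, hb⟩)) hab
      · intro w hw
        by_cases h1 : w = v
        · subst h1
          refine (Finset.card_le_card ?_).trans hvd
          intro u hu
          rw [Finset.mem_filter] at hu ⊢
          exact ⟨hu.1, hu.2.1⟩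
        · refine (Finset.card_le_card ?_).trans (hr2 w (Finset.mem_erase.2 ⟨h1, hw⟩))
          intro u hu
          rw [Finset.mem_filter] at hu ⊢
          obtain ⟨hu1, hu2, hu3⟩ := hu
          simp only [h1, if_false] at hu3
          by_cases h2 : u = v
          · simp only [h2, if_true] at hu3
            have := hN w; omega
          · simp only [h2, if_false] at hu3
            exact ⟨Finset.mem_erase.2 ⟨h2, hu1⟩, hu2, hu3⟩
    · rw [Finset.not_nonempty_iff_eq_empty] at hR
      subst hR
      exact ⟨fun _ => 0, by simp, by simp⟩

lemma noBic_induce {V : Type} (G : SimpleGraph V) (S : Set V) (s : ℕ) (h : NoBic G s) : NoBic (G.induce S) s := by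
  rintro ⟨A, B, h1, h2, h3, h4⟩
  refine h ⟨A.map (Function.Embedding.subtype _), B.map (Function.Embedding.subtype _), ?_, by simpa using h2, by simpa using h3, ?_⟩
  · rw [Finset.disjoint_map]; exact h1
  · intro a ha b hb
    obtain ⟨a', ha', rfl⟩ := Finset.mem_map.1 ha
    obtain ⟨b', hb', rfl⟩ := Finset.mem_map.1 hb
    exact h4 a' ha' b' hb'

lemma noBic_succ {V : Type} [Fintype V] (G : SimpleGraph V) : NoBic G (bicliqueNum G + 1) := by
  intro h
  have hb : BddAbove {t | HasBicliqueSub G t} := by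
    refine ⟨Fintype.card V, ?_⟩
    rintro t ⟨A, B, -, hA, -⟩
    rw [← hA]; exact Finset.card_le_univ _
  have : bicliqueNum G + 1 ≤ bicliqueNum G := le_csSup hb h
  omega

lemma bic_le_one {V : Type} [Fintype V] (G : SimpleGraph V) (h : NoBic G 2) : bicliqueNum G ≤ 1 := by
  apply csSup_le
  · exact ⟨0, ∅, ∅, by simp, by simp, by simp, by simp⟩
  · intro t ht
    by_contra hc
    exact (h.mono (by omega : 2 ≤ t)) ht

lemma deg_ind {V : Type} [Fintype V] (G : SimpleGraph V) (S : Set V) (v : S) (C : Finset V) (hC : ∀ c ∈ C, c ∈ S ∧ G.Adj v c) :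
    C.card ≤ (G.induce S).degree v := by
  rw [← SimpleGraph.card_neighborFinset_eq_degree, ← Finset.card_map (Function.Embedding.subtype _)]
  apply Finset.card_le_card
  intro c hc
  rw [Finset.mem_map]
  refine ⟨⟨c, (hC c hc).1⟩, ?_, rfl⟩
  rw [SimpleGraph.mem_neighborFinset]
  exact (hC c hc).2

lemma nw_of (F : GraphClass) (hF : Hereditary F) (f : ℕ → ℕ)
    (hf : ∀ (V : Type) [Fintype V] (G : SimpleGraph V), F V G → minDeg G ≤ f (bicliqueNum G))
    (K : ℕ) (h0 : f 0 < K) (h1 : f 1 < K) (V : Type) [Fintype V] (G : SimpleGraph V) (hG : F V G) : NW G K := by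
  intro A B hdis hA hB hC hne
  by_contra hcon
  push Not at hcon
  obtain ⟨hcA, hcB⟩ := hcon
  obtain ⟨S, hS⟩ : ∃ S : Set V, ∀ v, v ∈ S ↔ v ∈ A ∪ B := ⟨_, fun _ => Finset.mem_coe⟩
  have hSne : S.Nonempty := hne.imp fun v hv => (hS v).2 hv
  haveI : Nonempty S := hSne.to_subtype
  have hH := hf S (G.induce S) (hF.2 V G S hSne hG)
  have hmin : K ≤ minDeg (G.induce S) := by
    unfold minDeg
    apply SimpleGraph.le_minDegree_of_forall_le_degree
    rintro ⟨v, hv⟩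
    have hv' : v ∈ A ∪ B := (hS v).1 hv
    rcases Finset.mem_union.1 hv' with h | h
    · refine (hcA v h).trans (deg_ind G S ⟨v, hv⟩ _ ?_)
      intro c hc
      rw [Finset.mem_filter] at hc
      exact ⟨(hS _).2 (Finset.mem_union_right _ hc.1), hc.2⟩
    · refine (hcB v h).trans (deg_ind G S ⟨v, hv⟩ _ ?_)
      intro c hc
      rw [Finset.mem_filter] at hc
      exact ⟨(hS _).2 (Finset.mem_union_left _ hc.1), hc.2.symm⟩
  have hno : NoBic (G.induce S) 2 := by
    rintro ⟨X, Y, hXY, hX, hY, hadj⟩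
    obtain ⟨x1, x2, hx, rfl⟩ := Finset.card_eq_two.1 hX
    obtain ⟨y1, y2, hy, rfl⟩ := Finset.card_eq_two.1 hY
    have a11 : G.Adj x1 y1 := hadj x1 (by simp) y1 (by simp)
    have a12 : G.Adj x1 y2 := hadj x1 (by simp) y2 (by simp)
    have a21 : G.Adj x2 y1 := hadj x2 (by simp) y1 (by simp)
    have a22 : G.Adj x2 y2 := hadj x2 (by simp) y2 (by simp)
    have hx' : (x1 : V) ≠ x2 := fun h => hx (Subtype.ext h)
    have hy' : (y1 : V) ≠ y2 := fun h => hy (Subtype.ext h)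
    have mem : ∀ z : S, (z : V) ∈ A ∨ (z : V) ∈ B := fun z => Finset.mem_union.1 ((hS _).1 z.2)
    have key : ∀ a b b' c : V, a ≠ c → b ≠ b' → a ∈ A → (b ∈ A ∨ b ∈ B) → (b' ∈ A ∨ b' ∈ B) → (c ∈ A ∨ c ∈ B) →
        G.Adj a b → G.Adj a b' → G.Adj c b → G.Adj c b' → False := by
      intro a b b' c hac hbb ha hb hb' hc e1 e2 e3 e4
      have hb : b ∈ B := hb.resolve_left (fun h => hA a ha b h e1)
      have hb' : b' ∈ B := hb'.resolve_left (fun h => hA a ha b' h e2)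
      have hc : c ∈ A := hc.resolve_right (fun h => hB c h b hb e3)
      have := Finset.card_le_one.1 (hC b hb b' hb' hbb) a (Finset.mem_filter.2 ⟨ha, e1, e2⟩) c (Finset.mem_filter.2 ⟨hc, e3, e4⟩)
      exact hac this
    rcases mem x1 with h | h
    · exact key x1 y1 y2 x2 hx' hy' h (mem _) (mem _) (mem _) a11 a12 a21 a22
    · have hy1 : (y1 : V) ∈ A := (mem y1).resolve_right (fun h' => hB _ h _ h' a11)
      exact key y1 x1 x2 y2 hy' hx' hy1 (mem _) (mem _) (mem _) a11.symm a21.symm a12.symm a22.symm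
  have hle := bic_le_one _ hno
  have : bicliqueNum (G.induce S) = 0 ∨ bicliqueNum (G.induce S) = 1 := by omega
  rcases this with h | h <;> rw [h] at hH <;> omega

lemma degen {V : Type} [Fintype V] [Nonempty V] (G : SimpleGraph V) : ∃ (S : Finset V) (d : ℕ), S.Nonempty ∧ minDeg G ≤ d ∧
    (∀ v ∈ S, d ≤ (S.filter (fun u => G.Adj u v)).card) ∧
    (∀ R : Finset V, R.Nonempty → ∃ v ∈ R, (R.filter (fun u => G.Adj u v)).card ≤ d) := by
  let p : ℕ → Prop := fun t => ∃ S : Finset V, S.Nonempty ∧ ∀ v ∈ S, t ≤ (S.filter (fun u => G.Adj u v)).card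
  have hp : p (minDeg G) := by
    refine ⟨Finset.univ, Finset.univ_nonempty, ?_⟩
    intro v _
    refine (G.minDegree_le_degree v).trans (le_of_eq ?_)
    rw [← SimpleGraph.card_neighborFinset_eq_degree]
    congr 1
    ext u
    simp [G.adj_comm]
  have hbd : ∀ t, p t → t ≤ Fintype.card V := by
    rintro t ⟨S, ⟨v, hv⟩, h⟩
    exact (h v hv).trans (Finset.card_le_univ _)
  have hg := Nat.findGreatest_spec (P := p) (hbd _ hp) hp
  obtain ⟨S, hS, hSd⟩ := hg
  refine ⟨S, Nat.findGreatest p (Fintype.card V), hS, Nat.le_findGreatest (hbd _ hp) hp, hSd, ?_⟩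
  intro R hR
  by_contra hc
  push Not at hc
  have : p (Nat.findGreatest p (Fintype.card V) + 1) := ⟨R, hR, fun v hv => hc v hv⟩
  have h2 := Nat.le_findGreatest (hbd _ this) this
  omega

theorem polynomial_degree_boundedness (F : GraphClass) (hF : Hereditary F) (hDB : DegBounded F) :
    ∃ p : Polynomial ℕ, ∀ (V : Type) [Fintype V] (G : SimpleGraph V),
      F V G → minDeg G ≤ p.eval (bicliqueNum G) := by
  obtain ⟨f, hf⟩ := hDB
  obtain ⟨D, q, ⟨P⟩⟩ := pat_exists (f 0 + f 1 + 2) (by omega)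
  obtain ⟨g, ⟨C, hC⟩, hg⟩ := main1 P
  refine ⟨Polynomial.C C * (Polynomial.X + 1) ^ C, ?_⟩
  intro V _ G hG
  by_cases hV : Nonempty V
  · obtain ⟨S, d, hS, hmd, hSd, hR⟩ := degen G
    obtain ⟨S', hS'⟩ : ∃ S' : Set V, ∀ v, v ∈ S' ↔ v ∈ S := ⟨_, fun _ => Finset.mem_coe⟩
    have hSne : S'.Nonempty := hS.imp fun v hv => (hS' v).2 hv
    haveI : Nonempty S' := hSne.to_subtype
    have hH := hF.2 V G S' hSne hG
    have hNW := nw_of F hF f hf (f 0 + f 1 + 2) (by omega) (by omega) _ (G.induce S') hH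
    have hcard : ∀ (R : Finset S') (v : S'),
        ((R.map (Function.Embedding.subtype _)).filter (fun u => G.Adj u v)).card =
        (R.filter (fun u => (G.induce S').Adj u v)).card := by
      intro R v
      rw [Finset.filter_map, Finset.card_map]
      rfl
    obtain ⟨r, hr1, hr2⟩ := rank_exists (G.induce S') d (by
      intro R hRn
      obtain ⟨v, hv, hvd⟩ := hR (R.map (Function.Embedding.subtype _)) (by simpa using hRn)
      obtain ⟨w, hw, rfl⟩ := Finset.mem_map.1 hv
      exact ⟨w, hw, (hcard R w).symm.le.trans hvd⟩) Finset.univ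
    have hinj : Function.Injective r := fun a b h => hr1 (by simp) (by simp) h
    have hmem : ∀ u v, u ∈ Finset.univ.filter (fun u => (G.induce S').Adj u v ∧ r u < r v) ↔
      (G.induce S').Adj u v ∧ r u < r v := by intro u v; simp
    have hlt := hg _ (G.induce S') (fun v => Finset.univ.filter (fun u => (G.induce S').Adj u v ∧ r u < r v)) d
      (bicliqueNum G + 1) (by omega) ?_ (noBic_induce G _ _ (noBic_succ G)) ?_
    · have := hC (bicliqueNum G + 1) (by omega)
      simp only [Polynomial.eval_mul, Polynomial.eval_C, Polynomial.eval_pow, Polynomial.eval_add, Polynomial.eval_X, Polynomial.eval_one]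
      omega
    · refine ⟨hNW, ?_, ?_, ?_, ?_⟩
      · intro u v huv
        rw [hmem, hmem]
        have : r u ≠ r v := fun h => huv.ne (hinj h)
        rcases lt_or_gt_of_ne this with h | h
        · left; exact ⟨huv, h⟩
        · right; exact ⟨huv.symm, h⟩
      · intro u v h
        rw [hmem] at h
        exact h.1.symm
      · intro v; exact hr2 v (Finset.mem_univ v)
      · intro v
        refine (hSd v.1 ((hS' _).1 v.2)).trans ?_
        have h1 := hcard Finset.univ v
        unfold nbd
        refine le_trans (le_of_eq ?_) h1.le
        congr 2
        ext u
        simp [hS']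
    · intro u v w h1 h2 h3
      simp only [hmem]
      have n1 : r u ≠ r v := fun h => h1.ne (hinj h)
      have n2 : r u ≠ r w := fun h => h2.ne (hinj h)
      have n3 : r v ≠ r w := fun h => h3.ne (hinj h)
      by_cases c1 : r v < r u ∧ r w < r u
      · left; exact ⟨⟨h1.symm, c1.1⟩, h2.symm, c1.2⟩
      · by_cases c2 : r u < r v ∧ r w < r v
        · right; left; exact ⟨⟨h1, c2.1⟩, h3.symm, c2.2⟩
        · right; right
          exact ⟨⟨h2, by omega⟩, h3, by omega⟩
  · have : minDeg G = 0 := by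
      haveI := not_nonempty_iff.1 hV
      unfold minDeg
      simp [SimpleGraph.minDegree]
    omega
end
end

section
/- There is a function f : ℕ → ℕ such that for every natural number d, every finite bipartite graph G with minimum degree δ(G) ≥ f(d) has a nonempty subgraph H (not necessarily induced) such that δ(H) ≥ d and H contains no subgraph isomorphic to the 4-cycle C₄. -/
open SimpleGraph
open scoped Classical

noncomputable section

/-- `G` is bipartite: the vertices can be partitioned into two independent sets. -/
def Bip {V : Type} (G : SimpleGraph V) : Prop :=
  ∃ A : Set V, ∀ ⦃a b : V⦄, G.Adj a b → (a ∈ A ↔ b ∉ A)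

/-- `G` contains `H` as a (not necessarily induced) subgraph. -/
def ContainsSub {V W : Type} (H : SimpleGraph V) (G : SimpleGraph W) : Prop :=
  ∃ f : V → W, Function.Injective f ∧ ∀ ⦃a b : V⦄, H.Adj a b → G.Adj (f a) (f b)

/-- The 4-cycle. -/
def C4 : SimpleGraph (Fin 4) := SimpleGraph.fromRel fun i j => j = i + 1

/-- No 4-cycle in a set of (left, right) edges. -/
def CF {V : Type} (E : Finset (V × V)) : Prop :=
  ∀ a a' b b', (a, b) ∈ E → (a', b) ∈ E → (a, b') ∈ E → (a', b') ∈ E → a = a' ∨ b = b'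

/-- There is a dense `C₄`-free set of edges inside `E`. -/
def Good {V : Type} (d : ℕ) (E : Finset (V × V)) : Prop :=
  ∃ F ⊆ E, CF F ∧ ∃ P Q : Finset V, F ⊆ P ×ˢ Q ∧ d * (P.card + Q.card) < F.card

/-- neighbours of a right vertex -/
def nbL {V : Type} (E : Finset (V × V)) (b : V) : Finset V :=
  (E.filter fun e => e.2 = b).image Prod.fst

/-- neighbours of a left vertex -/
def nbR {V : Type} (E : Finset (V × V)) (a : V) : Finset V :=
  (E.filter fun e => e.1 = a).image Prod.snd

theorem mem_nbL {V : Type} {E : Finset (V × V)} {a b : V} : a ∈ nbL E b ↔ (a, b) ∈ E := by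
  simp [nbL]

theorem mem_nbR {V : Type} {E : Finset (V × V)} {a b : V} : b ∈ nbR E a ↔ (a, b) ∈ E := by
  simp [nbR]

theorem card_nbL {V : Type} (E : Finset (V × V)) (b : V) :
    (nbL E b).card = (E.filter fun e => e.2 = b).card := by
  unfold nbL
  apply Finset.card_image_of_injOn
  rintro ⟨x, y⟩ hx ⟨x', y'⟩ hx' h
  simp at hx hx' h
  simp [hx.2, hx'.2, h]

theorem card_nbR {V : Type} (E : Finset (V × V)) (a : V) :
    (nbR E a).card = (E.filter fun e => e.1 = a).card := by
  unfold nbR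
  apply Finset.card_image_of_injOn
  rintro ⟨x, y⟩ hx ⟨x', y'⟩ hx' h
  simp at hx hx' h
  simp [hx.2, hx'.2, h]

theorem sum_nbL {V : Type} {E : Finset (V × V)} {Q : Finset V} (h : ∀ e ∈ E, e.2 ∈ Q) :
    ∑ b ∈ Q, (nbL E b).card = E.card := by
  rw [Finset.card_eq_sum_card_fiberwise (f := Prod.snd) (t := Q) h]
  exact Finset.sum_congr rfl fun b _ => card_nbL E b

theorem sum_nbR {V : Type} {E : Finset (V × V)} {P : Finset V} (h : ∀ e ∈ E, e.1 ∈ P) :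
    ∑ a ∈ P, (nbR E a).card = E.card := by
  rw [Finset.card_eq_sum_card_fiberwise (f := Prod.fst) (t := P) h]
  exact Finset.sum_congr rfl fun b _ => card_nbR E b

theorem Good.mono {V : Type} {d : ℕ} {E E' : Finset (V × V)} (h : E ⊆ E') (g : Good d E) :
    Good d E' := by
  obtain ⟨F, hF, r⟩ := g
  exact ⟨F, hF.trans h, r⟩

theorem CF.mono {V : Type} {E E' : Finset (V × V)} (h : E ⊆ E') (g : CF E') : CF E :=
  fun a a' b b' h1 h2 h3 h4 => g a a' b b' (h h1) (h h2) (h h3) (h h4)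

/-- passing to large minimum degree -/
theorem extract {V : Type} (d : ℕ) : ∀ (n : ℕ) (F : Finset (V × V)) (P Q : Finset V),
    P.card + Q.card = n → F ⊆ P ×ˢ Q → d * (P.card + Q.card) < F.card →
    ∃ F' ⊆ F, F'.Nonempty ∧ ∀ e ∈ F', d ≤ (nbR F' e.1).card ∧ d ≤ (nbL F' e.2).card := by
  intro n
  induction n with
  | zero =>
    intro F P Q h hF hc
    have : P = ∅ := Finset.card_eq_zero.mp (by omega)
    subst this
    simp at hF
    subst hF
    simp at hc
  | succ n ih =>
    intro F P Q h hF hc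
    by_cases hall : ∀ e ∈ F, d ≤ (nbR F e.1).card ∧ d ≤ (nbL F e.2).card
    · exact ⟨F, subset_rfl, Finset.card_pos.mp (by omega), hall⟩
    push Not at hall
    obtain ⟨e, he, hlow⟩ := hall
    have hePQ := Finset.mem_product.mp (hF he)
    by_cases h1 : d ≤ (nbR F e.1).card
    · have h2 := hlow h1
      have hq := Finset.card_erase_of_mem hePQ.2
      have hqp : 0 < Q.card := Finset.card_pos.mpr ⟨_, hePQ.2⟩
      have hs := Finset.card_filter_add_card_filter_not (s := F) (fun x => x.2 = e.2)
      rw [card_nbL] at h2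
      obtain ⟨F', hF', r⟩ := ih (F.filter fun x => ¬ x.2 = e.2) P (Q.erase e.2) (by omega)
        (by
          intro x hx
          simp only [Finset.mem_filter] at hx
          have := Finset.mem_product.mp (hF hx.1)
          simp [this.1, this.2, hx.2])
        (by
          have e1 : P.card + (Q.erase e.2).card + 1 = P.card + Q.card := by omega
          rw [← e1, Nat.mul_add] at hc
          omega)
      exact ⟨F', hF'.trans (Finset.filter_subset _ _), r⟩
    · have h2 := not_le.mp h1
      have hq := Finset.card_erase_of_mem hePQ.1
      have hqp : 0 < P.card := Finset.card_pos.mpr ⟨_, hePQ.1⟩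
      have hs := Finset.card_filter_add_card_filter_not (s := F) (fun x => x.1 = e.1)
      rw [card_nbR] at h2
      obtain ⟨F', hF', r⟩ := ih (F.filter fun x => ¬ x.1 = e.1) (P.erase e.1) Q (by omega)
        (by
          intro x hx
          simp only [Finset.mem_filter] at hx
          have := Finset.mem_product.mp (hF hx.1)
          simp [this.1, this.2, hx.2])
        (by
          have e1 : (P.erase e.1).card + Q.card + 1 = P.card + Q.card := by omega
          rw [← e1, Nat.mul_add] at hc
          omega)
      exact ⟨F', hF'.trans (Finset.filter_subset _ _), r⟩

/-- greedy `C₄`-free subgraph in graphs of bounded maximum degree -/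
theorem greedy {V : Type} (E : Finset (V × V)) (D m : ℕ) (hL : ∀ b, (nbL E b).card ≤ D)
    (hR : ∀ a, (nbR E a).card ≤ D) :
    ∃ F ⊆ E, CF F ∧ m * E.card ≤ F.card * (m + m ^ 3 + 2 * D) := by
  let S := E.powerset.filter fun F => CF F ∧ (∀ b, (nbL F b).card ≤ m) ∧ ∀ a, (nbR F a).card ≤ m
  have hS : S.Nonempty := ⟨∅, by
    simp only [S, Finset.mem_filter, Finset.mem_powerset]
    refine ⟨by simp, by simp [CF], ?_, ?_⟩
    · intro b; simp [nbL]
    · intro b; simp [nbR]⟩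
  obtain ⟨F, hFS, hmax⟩ := Finset.exists_max_image S Finset.card hS
  obtain ⟨hFE, hCF, hFL, hFR⟩ : F ⊆ E ∧ CF F ∧ (∀ b, (nbL F b).card ≤ m) ∧
      ∀ a, (nbR F a).card ≤ m := by simpa [S] using hFS
  refine ⟨F, hFE, hCF, ?_⟩
  let A1 := (F.image Prod.fst).filter fun a => m ≤ (nbR F a).card
  let B1 := (F.image Prod.snd).filter fun b => m ≤ (nbL F b).card
  have hA1 : m * A1.card ≤ F.card := by
    rw [← sum_nbR (E := F) (P := F.image Prod.fst) (fun e he => Finset.mem_image_of_mem _ he)]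
    calc m * A1.card = ∑ a ∈ A1, m := by simp [mul_comm]
      _ ≤ ∑ a ∈ A1, (nbR F a).card := Finset.sum_le_sum fun a ha => (Finset.mem_filter.mp ha).2
      _ ≤ _ := Finset.sum_le_sum_of_subset (Finset.filter_subset _ _)
  have hB1 : m * B1.card ≤ F.card := by
    rw [← sum_nbL (E := F) (Q := F.image Prod.snd) (fun e he => Finset.mem_image_of_mem _ he)]
    calc m * B1.card = ∑ a ∈ B1, m := by simp [mul_comm]
      _ ≤ ∑ a ∈ B1, (nbL F a).card := Finset.sum_le_sum fun a ha => (Finset.mem_filter.mp ha).2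
      _ ≤ _ := Finset.sum_le_sum_of_subset (Finset.filter_subset _ _)
  by_cases hm : m = 0
  · simp [hm]
  let X1 := A1.biUnion fun a => E.filter fun e => e.1 = a
  let X2 := B1.biUnion fun b => E.filter fun e => e.2 = b
  let X3 := F.biUnion fun e => (nbL F e.2) ×ˢ (nbR F e.1)
  have hX1 : X1.card ≤ A1.card * D :=
    Finset.card_biUnion_le_card_mul _ _ _ fun a _ => by rw [← card_nbR]; exact hR a
  have hX2 : X2.card ≤ B1.card * D :=
    Finset.card_biUnion_le_card_mul _ _ _ fun a _ => by rw [← card_nbL]; exact hL a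
  have hX3 : X3.card ≤ F.card * (m * m) :=
    Finset.card_biUnion_le_card_mul _ _ _ fun a _ => by
      rw [Finset.card_product]; exact Nat.mul_le_mul (hFL _) (hFR _)
  have hcov : E ⊆ F ∪ (X1 ∪ (X2 ∪ X3)) := by
    rintro ⟨a, b⟩ he
    by_contra hn
    simp only [Finset.mem_union, not_or] at hn
    obtain ⟨n0, n1, n2, n3⟩ := hn
    have l1 : (nbR F a).card < m := by
      by_contra hc
      apply n1
      push Not at hc
      have : 0 < (nbR F a).card := by omega
      obtain ⟨y, hy⟩ := Finset.card_pos.mp this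
      rw [mem_nbR] at hy
      refine Finset.mem_biUnion.mpr ⟨a, Finset.mem_filter.mpr ⟨?_, hc⟩, by simp [he]⟩
      exact Finset.mem_image.mpr ⟨_, hy, rfl⟩
    have l2 : (nbL F b).card < m := by
      by_contra hc
      apply n2
      push Not at hc
      have : 0 < (nbL F b).card := by omega
      obtain ⟨y, hy⟩ := Finset.card_pos.mp this
      rw [mem_nbL] at hy
      refine Finset.mem_biUnion.mpr ⟨b, Finset.mem_filter.mpr ⟨?_, hc⟩, by simp [he]⟩
      exact Finset.mem_image.mpr ⟨_, hy, rfl⟩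
    have l3 : ∀ a' b', (a, b') ∈ F → (a', b') ∈ F → (a', b) ∈ F → False := by
      intro a' b' h1 h2 h3
      apply n3
      exact Finset.mem_biUnion.mpr ⟨(a', b'), h2, by simp [mem_nbL, mem_nbR, h1, h3]⟩
    have hin : insert (a, b) F ∈ S := by
      simp only [S, Finset.mem_filter, Finset.mem_powerset]
      refine ⟨Finset.insert_subset he hFE, ?_, ?_, ?_⟩
      · intro x x' y y' h1 h2 h3 h4
        have := hCF x x' y y'
        simp only [Finset.mem_insert, Prod.mk.injEq] at h1 h2 h3 h4
        grind
      · intro y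
        by_cases hy : y = b
        · subst hy
          have : nbL (insert (a, y) F) y ⊆ insert a (nbL F y) := by
            intro z; simp [mem_nbL]
          have := Finset.card_le_card this
          have := Finset.card_insert_le a (nbL F y)
          omega
        · have : nbL (insert (a, b) F) y = nbL F y := by
            ext z; simp [mem_nbL, hy]
          rw [this]; exact hFL y
      · intro y
        by_cases hy : y = a
        · subst hy
          have : nbR (insert (y, b) F) y ⊆ insert b (nbR F y) := by
            intro z; simp [mem_nbR]
          have := Finset.card_le_card this
          have := Finset.card_insert_le b (nbR F y)
          omega
        · have : nbR (insert (a, b) F) y = nbR F y := by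
            ext z; simp [mem_nbR, hy]
          rw [this]; exact hFR y
    have := hmax _ hin
    rw [Finset.card_insert_of_notMem n0] at this
    omega
  have hE : E.card ≤ F.card + (X1.card + (X2.card + X3.card)) := by
    refine (Finset.card_le_card hcov).trans ((Finset.card_union_le _ _).trans ?_)
    gcongr
    refine (Finset.card_union_le _ _).trans ?_
    gcongr
    exact Finset.card_union_le _ _
  calc m * E.card ≤ m * (F.card + (A1.card * D + (B1.card * D + F.card * (m * m)))) := by
        gcongr; omega
    _ = m * F.card + (m * A1.card) * D + (m * B1.card) * D + F.card * m ^ 3 := by ring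
    _ ≤ m * F.card + F.card * D + F.card * D + F.card * m ^ 3 := by gcongr
    _ = _ := by ring

/-- large complete bipartite graphs are good -/
theorem good_complete {V : Type} (d x : ℕ)
    (hx : x = 2 * d * ((4 * d + 1) + (4 * d + 1) ^ 3) + 1) (E : Finset (V × V))
    (X Y : Finset V) (hX : X.card = x) (hY : Y.card = x) (h : X ×ˢ Y ⊆ E) : Good d E := by
  refine Good.mono h ?_
  have e1 : ∀ b, nbL (X ×ˢ Y) b ⊆ X := fun b a => by simp [mem_nbL]; tauto
  have e2 : ∀ b, nbR (X ×ˢ Y) b ⊆ Y := fun b a => by simp [mem_nbR]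
  obtain ⟨F, hF, hCF, hc⟩ := greedy (X ×ˢ Y) x (4 * d + 1)
    (fun b => hX ▸ Finset.card_le_card (e1 b)) (fun b => hY ▸ Finset.card_le_card (e2 b))
  refine ⟨F, hF, hCF, X, Y, hF, ?_⟩
  rw [Finset.card_product, hX, hY] at hc
  rw [hX, hY]
  by_contra hlt
  push Not at hlt
  have hx0 : 0 < x := by omega
  generalize hm : 4 * d + 1 = m at *
  have h3 : x * (m * x) ≤ x * (2 * d * (m + m ^ 3) + 4 * d * x) := by
    calc x * (m * x) = m * (x * x) := by ring
      _ ≤ F.card * (m + m ^ 3 + 2 * x) := hc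
      _ ≤ (d * (x + x)) * (m + m ^ 3 + 2 * x) := by gcongr
      _ = _ := by ring
  have h4 := Nat.le_of_mul_le_mul_left h3 hx0
  rw [← hm, Nat.add_mul] at h4
  rw [← hm] at hx
  omega

/-- greedy independent set -/
theorem indep {V : Type} (R : V → V → Prop) (hs : ∀ a b, R a b → R b a) (m : ℕ) (hm : 0 < m) :
    ∀ (k : ℕ) (N : Finset V), k * m ≤ N.card →
      (∀ a ∈ N, (N.filter fun b => b ≠ a ∧ R a b).card < m) →
      ∃ T ⊆ N, T.card = k ∧ ∀ a ∈ T, ∀ b ∈ T, a ≠ b → ¬ R a b := by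
  intro k
  induction k with
  | zero => intro N _ _; exact ⟨∅, by simp⟩
  | succ k ih =>
    intro N hN hd
    have hne : N.Nonempty := Finset.card_pos.mp (by
      have : 0 < (k + 1) * m := by positivity
      omega)
    obtain ⟨a, ha⟩ := hne
    have hda := hd a ha
    let N' := N.filter fun b => ¬ (b = a ∨ R a b)
    have hN' : k * m ≤ N'.card := by
      have h1 : N ⊆ insert a (N.filter fun b => b ≠ a ∧ R a b) ∪ N' := by
        intro b hb
        simp [N', hb]
        tauto
      have h2 := Finset.card_le_card h1
      have h3 := Finset.card_union_le (insert a (N.filter fun b => b ≠ a ∧ R a b)) N'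
      have h4 := Finset.card_insert_le a (N.filter fun b => b ≠ a ∧ R a b)
      rw [Nat.succ_mul] at hN
      omega
    have hsub : N' ⊆ N := Finset.filter_subset _ _
    obtain ⟨T, hT, hTc, hTi⟩ := ih N' hN' (fun b hb =>
      lt_of_le_of_lt (Finset.card_le_card (Finset.filter_subset_filter _ hsub)) (hd b (hsub hb)))
    have hTa : ∀ b ∈ T, b ≠ a ∧ ¬ R a b := by
      intro b hb
      have := (Finset.mem_filter.mp (hT hb)).2
      tauto
    refine ⟨insert a T, Finset.insert_subset ha (hT.trans hsub), ?_, ?_⟩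
    · rw [Finset.card_insert_of_notMem (fun h => (hTa a h).1 rfl), hTc]
    · intro u hu v hv huv
      rcases Finset.mem_insert.mp hu with rfl | hu' <;>
        rcases Finset.mem_insert.mp hv with h | hv'
      · exact absurd h.symm huv
      · exact (hTa v hv').2
      · exact fun h' => (hTa u hu').2 (hs _ _ (h ▸ h'))
      · exact hTi u hu' v hv' huv

/-- the unbalanced case, by induction on `x` -/
theorem unbal (d s : ℕ) (hs : 0 < s) : ∀ x : ℕ, ∃ r C : ℕ, 0 < r ∧
    ∀ (V : Type) (E : Finset (V × V)), ¬ Good d E → ∀ P Q : Finset V,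
      (∀ b ∈ Q, r ≤ (P ∩ nbL E b).card) →
      (¬ ∃ X ⊆ P, ∃ Y ⊆ Q, X.card = x ∧ Y.card = s ∧ X ×ˢ Y ⊆ E) →
      Q.card ≤ C * P.card := by
  intro x
  induction x with
  | zero =>
    refine ⟨1, s, one_pos, ?_⟩
    intro V E _ P Q hr hn
    rcases Q.eq_empty_or_nonempty with rfl | ⟨b, hb⟩
    · simp
    have hP : 0 < P.card := lt_of_lt_of_le (hr b hb) (Finset.card_le_card Finset.inter_subset_left)
    by_contra hc
    apply hn
    have : s ≤ Q.card := by nlinarith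
    obtain ⟨Y, hY, hYc⟩ := Finset.exists_subset_card_eq this
    exact ⟨∅, by simp, Y, hY, by simp, hYc, by simp⟩
  | succ x ih =>
    obtain ⟨r, C, hr, ih⟩ := ih
    let k := 2 * d + 1
    refine ⟨k * r, 1 + k * k * C, by positivity, ?_⟩
    intro V E hE P Q hdeg hn
    let S := (E.filter fun e => e.1 ∈ P ∧ e.2 ∈ Q).powerset.filter fun F =>
      CF F ∧ ∀ e ∈ F, (nbL F e.2).card = k
    have hS : S.Nonempty := ⟨∅, by simp [S, CF]⟩
    obtain ⟨F, hFS, hmax⟩ := Finset.exists_max_image S Finset.card hS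
    obtain ⟨hFE, hCF, hFk⟩ : F ⊆ (E.filter fun e => e.1 ∈ P ∧ e.2 ∈ Q) ∧ CF F ∧
      ∀ e ∈ F, (nbL F e.2).card = k := by
        simpa only [S, Finset.mem_filter, Finset.mem_powerset] using hFS
    have hF' : ∀ e ∈ F, e ∈ E ∧ e.1 ∈ P ∧ e.2 ∈ Q := fun e he => by
      simpa using hFE he
    let Q' := F.image Prod.snd
    have hFc : F.card = k * Q'.card := by
      rw [← sum_nbL (E := F) (Q := Q') (fun e he => Finset.mem_image_of_mem _ he)]
      rw [Finset.sum_congr rfl (g := fun _ => k)]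
      · simp [mul_comm]
      · intro b hb
        obtain ⟨e, he, rfl⟩ := Finset.mem_image.mp hb
        exact hFk e he
    have hQ' : Q'.card ≤ P.card := by
      by_contra hc
      push Not at hc
      apply hE
      refine ⟨F, fun e he => (hF' e he).1, hCF, P, Q', ?_, ?_⟩
      · intro e he
        exact Finset.mem_product.mpr ⟨(hF' e he).2.1, Finset.mem_image_of_mem _ he⟩
      · rw [hFc]
        have : d * (P.card + Q'.card) ≤ d * (Q'.card + Q'.card) := by gcongr
        simp only [k]
        nlinarith
    let R : V → V → Prop := fun a a' => ∃ b, (a, b) ∈ F ∧ (a', b) ∈ F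
    let NR : V → Finset V := fun a => P.filter fun a' => a' ≠ a ∧ R a a'
    have hsumR : ∑ a ∈ P, (NR a).card ≤ k * k * P.card := by
      have h1 : P.sigma NR ⊆ Q'.biUnion fun b =>
          ((nbL F b) ×ˢ (nbL F b)).image fun p => (⟨p.1, p.2⟩ : Σ _ : V, V) := by
        rintro ⟨a, a'⟩ h
        simp only [Finset.mem_sigma, NR, Finset.mem_filter] at h
        obtain ⟨_, _, _, b, h1, h2⟩ := h
        refine Finset.mem_biUnion.mpr ⟨b, Finset.mem_image.mpr ⟨_, h1, rfl⟩, ?_⟩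
        exact Finset.mem_image.mpr ⟨(a, a'), by simp [mem_nbL, h1, h2], rfl⟩
      rw [← Finset.card_sigma]
      refine (Finset.card_le_card h1).trans ?_
      refine (Finset.card_biUnion_le_card_mul _ _ (k * k) ?_).trans ?_
      · intro b hb
        obtain ⟨e, he, rfl⟩ := Finset.mem_image.mp hb
        refine Finset.card_image_le.trans ?_
        rw [Finset.card_product, hFk e he]
      · rw [mul_comm]; gcongr
    let QQ : V → Finset V := fun a =>
      Q.filter fun b => (a, b) ∈ E ∧ r ≤ (NR a ∩ nbL E b).card
    have hQQ : ∀ a ∈ P, (QQ a).card ≤ C * (NR a).card := by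
      intro a ha
      apply ih V E hE (NR a) (QQ a)
      · intro b hb
        exact (Finset.mem_filter.mp hb).2.2
      · rintro ⟨X, hX, Y, hY, hXc, hYc, hXY⟩
        apply hn
        have haX : a ∉ X := fun h => by
          have := (Finset.mem_filter.mp (hX h)).2.1
          exact this rfl
        refine ⟨insert a X, ?_, Y, hY.trans (Finset.filter_subset _ _), ?_, hYc, ?_⟩
        · exact Finset.insert_subset ha (hX.trans (Finset.filter_subset _ _))
        · rw [Finset.card_insert_of_notMem haX, hXc]
        · rintro ⟨u, v⟩ huv
          obtain ⟨hu, hv⟩ := Finset.mem_product.mp huv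
          rcases Finset.mem_insert.mp hu with h | h
          · simp only at h
            subst h
            exact (Finset.mem_filter.mp (hY hv)).2.1
          · exact hXY (Finset.mem_product.mpr ⟨h, hv⟩)
    have hcov : Q ⊆ Q' ∪ P.biUnion QQ := by
      intro b hb
      by_contra hnb
      simp only [Finset.mem_union, not_or] at hnb
      obtain ⟨n1, n2⟩ := hnb
      obtain ⟨T, hT, hTc, hTi⟩ := indep R (fun a a' ⟨b, h1, h2⟩ => ⟨b, h2, h1⟩) r hr k
        (P ∩ nbL E b) (hdeg b hb) (by
          intro a ha
          by_contra hc
          push Not at hc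
          apply n2
          have ha' := Finset.mem_inter.mp ha
          refine Finset.mem_biUnion.mpr ⟨a, ha'.1, Finset.mem_filter.mpr
            ⟨hb, mem_nbL.mp ha'.2, hc.trans (Finset.card_le_card ?_)⟩⟩
          intro z hz
          simp only [Finset.mem_filter, Finset.mem_inter, NR] at hz ⊢
          tauto)
      have hbF : ∀ a, (a, b) ∉ F := fun a h => n1 (Finset.mem_image.mpr ⟨_, h, rfl⟩)
      let F2 := F ∪ T ×ˢ {b}
      have hm2 : ∀ u v, (u, v) ∈ F2 ↔ (u, v) ∈ F ∨ (u ∈ T ∧ v = b) := by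
        intro u v; simp [F2, eq_comm]
      have hold : ∀ {u v}, ((u, v) ∈ F ∨ (u ∈ T ∧ v = b)) → v ≠ b → (u, v) ∈ F :=
        fun h hv => h.resolve_right fun h' => hv h'.2
      have hin : F2 ∈ S := by
        simp only [S, Finset.mem_filter, Finset.mem_powerset]
        refine ⟨?_, ?_, ?_⟩
        · apply Finset.union_subset hFE
          rintro ⟨u, v⟩ huv
          simp only [Finset.mem_product, Finset.mem_singleton] at huv
          obtain ⟨hu, rfl⟩ := huv
          have := Finset.mem_inter.mp (hT hu)
          simp [this.1, hb, mem_nbL.mp this.2]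
        · intro a a' v v' h1 h2 h3 h4
          rw [hm2] at h1 h2 h3 h4
          by_cases hv : v = b
          · by_cases hv' : v' = b
            · right; rw [hv, hv']
            · left
              subst hv
              by_contra hne
              have g1 : a ∈ T := (h1.resolve_left (hbF a)).1
              have g2 : a' ∈ T := (h2.resolve_left (hbF a')).1
              exact hTi a g1 a' g2 hne ⟨v', hold h3 hv', hold h4 hv'⟩
          · by_cases hv' : v' = b
            · left
              subst hv'
              by_contra hne
              have g1 : a ∈ T := (h3.resolve_left (hbF a)).1
              have g2 : a' ∈ T := (h4.resolve_left (hbF a')).1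
              exact hTi a g1 a' g2 hne ⟨v, hold h1 hv, hold h2 hv⟩
            · exact hCF a a' v v' (hold h1 hv) (hold h2 hv) (hold h3 hv') (hold h4 hv')
        · rintro ⟨u, v⟩ huv
          rw [hm2] at huv
          by_cases hv : v = b
          · subst hv
            have : nbL F2 v = T := by
              ext z; rw [mem_nbL, hm2]; simp [hbF]
            simp only [this, hTc]
          · have : nbL F2 v = nbL F v := by
              ext z; rw [mem_nbL, hm2, mem_nbL]; simp [hv]
            simp only [this]
            exact hFk (u, v) (hold huv hv)
      have hlt := hmax _ hin
      have hdis : Disjoint F (T ×ˢ {b}) := by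
        rw [Finset.disjoint_right]
        rintro ⟨u, v⟩ huv
        simp only [Finset.mem_product, Finset.mem_singleton] at huv
        rw [huv.2]; exact hbF u
      simp only [F2] at hlt
      rw [Finset.card_union_of_disjoint hdis, Finset.card_product, hTc] at hlt
      simp [k] at hlt
    calc Q.card ≤ Q'.card + (P.biUnion QQ).card :=
          (Finset.card_le_card hcov).trans (Finset.card_union_le _ _)
      _ ≤ P.card + ∑ a ∈ P, C * (NR a).card := by
          gcongr
          exact Finset.card_biUnion_le.trans (Finset.sum_le_sum hQQ)
      _ = P.card + C * ∑ a ∈ P, (NR a).card := by rw [Finset.mul_sum]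
      _ ≤ P.card + C * (k * k * P.card) := by gcongr
      _ = _ := by ring

/-- main combinatorial statement -/
theorem main_good (d : ℕ) : ∃ D : ℕ, 0 < D ∧ ∀ (V : Type) (E : Finset (V × V)) (P Q : Finset V),
    E ⊆ P ×ˢ Q → P.card ≤ Q.card → Q.Nonempty → (∀ b ∈ Q, D ≤ (nbL E b).card) → Good d E := by
  obtain ⟨s, hs⟩ : ∃ s, s = 2 * d * ((4 * d + 1) + (4 * d + 1) ^ 3) + 1 := ⟨_, rfl⟩
  obtain ⟨r, C, hr, hunb⟩ := unbal d s (by omega) s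
  obtain ⟨m, hm⟩ : ∃ m, m = 32 * d * (C + 1) + 1 := ⟨_, rfl⟩
  obtain ⟨D, hD⟩ : ∃ D, D = 4 * (r + 2 * d * (1 + m ^ 2)) + 1 := ⟨_, rfl⟩
  refine ⟨D, by omega, ?_⟩
  intro V E P Q hE hPQ hQ hdeg
  by_contra hbad
  have hch : ∀ b, ∃ N ⊆ nbL E b, b ∈ Q → N.card = D := by
    intro b
    by_cases hb : b ∈ Q
    · obtain ⟨N, h1, h2⟩ := Finset.exists_subset_card_eq (hdeg b hb)
      exact ⟨N, h1, fun _ => h2⟩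
    · exact ⟨∅, by simp, fun h => absurd h hb⟩
  choose N hN hNc using hch
  -- trimmed graph
  let E1 := E.filter fun e => e.1 ∈ N e.2
  have hE1 : E1 ⊆ E := Finset.filter_subset _ _
  have hmE1 : ∀ a b, (a, b) ∈ E1 ↔ a ∈ N b := by
    intro a b
    simp only [E1, Finset.mem_filter]
    exact ⟨fun h => h.2, fun h => ⟨mem_nbL.mp (hN b h), h⟩⟩
  have hn1 : ∀ b, nbL E1 b = N b := by
    intro b; ext a; rw [mem_nbL, hmE1]
  have hbad1 : ¬ Good d E1 := fun h => hbad (h.mono hE1)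
  have hE1P : ∀ e ∈ E1, e.1 ∈ P := fun e he => (Finset.mem_product.mp (hE (hE1 he))).1
  have hE1Q : ∀ e ∈ E1, e.2 ∈ Q := fun e he => (Finset.mem_product.mp (hE (hE1 he))).2
  have hE1c : E1.card = Q.card * D := by
    rw [← sum_nbL hE1Q, Finset.sum_congr rfl (g := fun _ => D)]
    · simp
    · intro b hb; rw [hn1, hNc b hb]
  let Δ := 2 * (C + 1) * D
  let Pb := P.filter fun a => Δ ≤ (nbR E1 a).card
  have hPb : 2 * (C * Pb.card) ≤ Q.card := by
    have h1 : Δ * Pb.card ≤ E1.card := by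
      rw [← sum_nbR hE1P]
      calc Δ * Pb.card = ∑ a ∈ Pb, Δ := by simp [mul_comm]
        _ ≤ ∑ a ∈ Pb, (nbR E1 a).card :=
          Finset.sum_le_sum fun a ha => (Finset.mem_filter.mp ha).2
        _ ≤ _ := Finset.sum_le_sum_of_subset (Finset.filter_subset _ _)
    rw [hE1c] at h1
    have h2 : D * (2 * (C + 1) * Pb.card) ≤ D * Q.card := by
      calc _ = Δ * Pb.card := by simp only [Δ]; ring
        _ ≤ _ := h1
        _ = _ := by ring
    have h3 := Nat.le_of_mul_le_mul_left h2 (by omega)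
    nlinarith
  let Q1 := Q.filter fun b => r ≤ (Pb ∩ nbL E1 b).card
  have hQ1 : Q1.card ≤ C * Pb.card := by
    apply hunb V E1 hbad1 Pb Q1
    · intro b hb; exact (Finset.mem_filter.mp hb).2
    · rintro ⟨X, _, Y, _, hXc, hYc, hXY⟩
      exact hbad1 (good_complete d s hs E1 X Y hXc hYc hXY)
  let Q2 := Q.filter fun b => ¬ r ≤ (Pb ∩ nbL E1 b).card
  have hQ2 : Q.card ≤ 2 * Q2.card := by
    have : Q1.card + Q2.card = Q.card :=
      Finset.card_filter_add_card_filter_not (s := Q) (fun b => r ≤ (Pb ∩ nbL E1 b).card)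
    omega
  let E2 := E1.filter fun e => e.2 ∈ Q2 ∧ e.1 ∉ Pb
  have hE2 : E2 ⊆ E1 := Finset.filter_subset _ _
  have hE2c : Q2.card * (D - r) ≤ E2.card := by
    rw [← sum_nbL (E := E2) (Q := Q2) (fun e he => (Finset.mem_filter.mp he).2.1)]
    rw [← smul_eq_mul]
    apply Finset.card_nsmul_le_sum
    intro b hb
    have hb' := Finset.mem_filter.mp hb
    have h1 : nbL E2 b = N b \ (Pb ∩ nbL E1 b) := by
      ext a
      rw [mem_nbL]
      simp only [E2, Finset.mem_filter, Finset.mem_sdiff, Finset.mem_inter, mem_nbL, hmE1, hb,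
        true_and]
      tauto
    have h2 := Finset.le_card_sdiff (Pb ∩ nbL E1 b) (N b)
    rw [h1]
    have := hNc b hb'.1
    omega
  obtain ⟨F, hF, hCF, hFc⟩ := greedy E2 Δ m
    (by
      intro b
      have h1 : nbL E2 b ⊆ N b := by
        intro a ha; rw [mem_nbL] at ha; exact (hmE1 a b).mp (hE2 ha)
      by_cases hb : b ∈ Q
      · refine (Finset.card_le_card h1).trans ?_
        rw [hNc b hb]
        simp only [Δ]; nlinarith
      · have : nbL E2 b = ∅ := by
          rw [Finset.eq_empty_iff_forall_notMem]
          intro a ha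
          rw [mem_nbL] at ha
          exact hb (hE1Q _ (hE2 ha))
        simp [this])
    (by
      intro a
      by_cases ha : a ∈ P ∧ a ∉ Pb
      · have h1 : ¬ Δ ≤ (nbR E1 a).card := fun h => ha.2 (Finset.mem_filter.mpr ⟨ha.1, h⟩)
        have h2 : nbR E2 a ⊆ nbR E1 a := by
          intro b hb; rw [mem_nbR] at hb ⊢; exact hE2 hb
        have := Finset.card_le_card h2
        omega
      · have : nbR E2 a = ∅ := by
          rw [Finset.eq_empty_iff_forall_notMem]
          intro b hb
          rw [mem_nbR] at hb
          exact ha ⟨hE1P _ (hE2 hb), (Finset.mem_filter.mp hb).2.2⟩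
        simp [this])
  have hFs : F.card ≤ d * (2 * Q.card) := by
    by_contra hc
    push Not at hc
    apply hbad
    refine ⟨F, (hF.trans hE2).trans hE1, hCF, P, Q, ((hF.trans hE2).trans hE1).trans hE, ?_⟩
    refine lt_of_le_of_lt ?_ hc
    gcongr
    omega
  have hq : 0 < Q.card := Finset.card_pos.mpr hQ
  have key : Q.card * (m * (D - r)) ≤ Q.card * (4 * d * (m + m ^ 3 + 2 * Δ)) := by
    calc Q.card * (m * (D - r)) ≤ (2 * Q2.card) * (m * (D - r)) := by gcongr
      _ = 2 * (m * (Q2.card * (D - r))) := by ring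
      _ ≤ 2 * (m * E2.card) := by gcongr
      _ ≤ 2 * (F.card * (m + m ^ 3 + 2 * Δ)) := by gcongr
      _ ≤ 2 * ((d * (2 * Q.card)) * (m + m ^ 3 + 2 * Δ)) := by gcongr
      _ = _ := by ring
  have key2 := Nat.le_of_mul_le_mul_left key hq
  obtain ⟨D', hD'⟩ : ∃ D', D = D' + r := ⟨D - r, by omega⟩
  have e1 : D - r = D' := by omega
  rw [e1] at key2
  have e2 : 2 * (4 * d * (2 * Δ)) ≤ m * D := by
    simp only [Δ]
    rw [hm]
    nlinarith
  have e3 : 2 * (m * D') ≤ m * (8 * d * (1 + m ^ 2)) + m * D := by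
    calc 2 * (m * D') ≤ 2 * (4 * d * (m + m ^ 3 + 2 * Δ)) := by gcongr
      _ = m * (8 * d * (1 + m ^ 2)) + 2 * (4 * d * (2 * Δ)) := by ring
      _ ≤ _ := by gcongr
  rw [← Nat.mul_add, ← Nat.mul_assoc, Nat.mul_comm 2 m, Nat.mul_assoc] at e3
  have e4 := Nat.le_of_mul_le_mul_left e3 (by omega)
  have e5 : 8 * d * (1 + m ^ 2) = 4 * (2 * d * (1 + m ^ 2)) := by ring
  omega

theorem final_aux (d D : ℕ)
    (hD : ∀ (V : Type) (E : Finset (V × V)) (P Q : Finset V),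
      E ⊆ P ×ˢ Q → P.card ≤ Q.card → Q.Nonempty → (∀ b ∈ Q, D ≤ (nbL E b).card) → Good d E)
    (V : Type) [Fintype V] [Nonempty V] (G : SimpleGraph V) (A : Set V)
    (hA : ∀ ⦃a b : V⦄, G.Adj a b → (a ∈ A ↔ b ∉ A)) (hdeg : D ≤ minDeg G)
    (hle : (Finset.univ.filter fun v => v ∈ A).card ≤ (Finset.univ.filter fun v => v ∉ A).card) :
      ∃ (s : Set V) (H : SimpleGraph s), s.Nonempty ∧ H ≤ G.induce s ∧
        d ≤ minDeg H ∧ ¬ ContainsSub C4 H := by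
  let E : Finset (V × V) := Finset.univ.filter fun e => e.1 ∈ A ∧ e.2 ∉ A ∧ G.Adj e.1 e.2
  have hQ : (Finset.univ.filter fun v => v ∉ A).Nonempty := by
    rw [Finset.nonempty_iff_ne_empty]
    intro h
    rw [h] at hle
    have h2 := Finset.card_filter_add_card_filter_not (s := (Finset.univ : Finset V))
      (fun v => v ∈ A)
    rw [h] at h2
    have : 0 < (Finset.univ : Finset V).card := Finset.card_pos.mpr Finset.univ_nonempty
    simp only [Finset.card_empty] at hle h2
    omega
  have hg := hD V E (Finset.univ.filter fun v => v ∈ A) (Finset.univ.filter fun v => v ∉ A)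
    (by intro e he; simp [E] at he ⊢; tauto) hle hQ
    (by
      intro b hb
      have hb' : b ∉ A := by simpa using hb
      have : nbL E b = G.neighborFinset b := by
        ext a
        rw [mem_nbL]
        simp only [E, Finset.mem_filter, Finset.mem_univ, true_and, mem_neighborFinset]
        constructor
        · intro h; exact h.2.2.symm
        · intro h; exact ⟨(hA h.symm).mpr hb', hb', h.symm⟩
      rw [this, card_neighborFinset_eq_degree]
      exact hdeg.trans (G.minDegree_le_degree b))
  obtain ⟨F0, hF0, hCF0, P, Q, hPQ, hc⟩ := hg
  obtain ⟨F, hF, ⟨e0, he0⟩, hmin⟩ := extract d _ F0 P Q rfl hPQ hc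
  have hCF := hCF0.mono hF
  have hFE : ∀ a b, (a, b) ∈ F → a ∈ A ∧ b ∉ A ∧ G.Adj a b := by
    intro a b h
    have := hF0 (hF h)
    simpa [E] using this
  obtain ⟨s, hs⟩ : ∃ s : Set V, ∀ v, v ∈ s ↔ ∃ e ∈ F, v = e.1 ∨ v = e.2 :=
    ⟨{v | ∃ e ∈ F, v = e.1 ∨ v = e.2}, fun v => Iff.rfl⟩
  obtain ⟨H, hadj⟩ : ∃ H : SimpleGraph s, ∀ u v : s,
      H.Adj u v ↔ (u.1, v.1) ∈ F ∨ (v.1, u.1) ∈ F :=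
    ⟨{ Adj := fun u v => (u.1, v.1) ∈ F ∨ (v.1, u.1) ∈ F
       symm := ⟨fun u v h => h.symm⟩
       loopless := ⟨fun u h => by
        have := hFE u.1 u.1 (by tauto)
        tauto⟩ }, fun u v => Iff.rfl⟩
  have hne : s.Nonempty := ⟨e0.1, (hs _).mpr ⟨e0, he0, Or.inl rfl⟩⟩
  refine ⟨s, H, hne, ?_, ?_, ?_⟩
  · intro u v h
    rw [hadj] at h
    rcases h with h | h
    · exact (hFE _ _ h).2.2
    · exact (hFE _ _ h).2.2.symm
  · have : Nonempty s := hne.to_subtype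
    unfold minDeg
    apply le_minDegree_of_forall_le_degree
    rintro ⟨v, hvs⟩
    obtain ⟨e, he, hv⟩ := (hs v).mp hvs
    rw [← card_neighborFinset_eq_degree, ← Finset.card_map (Function.Embedding.subtype _)]
    rcases hv with rfl | rfl
    · refine (hmin e he).1.trans (Finset.card_le_card ?_)
      intro w hw
      rw [mem_nbR] at hw
      refine Finset.mem_map.mpr ⟨⟨w, (hs w).mpr ⟨_, hw, Or.inr rfl⟩⟩, ?_, rfl⟩
      rw [mem_neighborFinset, hadj]
      exact Or.inl hw
    · refine (hmin e he).2.trans (Finset.card_le_card ?_)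
      intro w hw
      rw [mem_nbL] at hw
      refine Finset.mem_map.mpr ⟨⟨w, (hs w).mpr ⟨_, hw, Or.inl rfl⟩⟩, ?_, rfl⟩
      rw [mem_neighborFinset, hadj]
      exact Or.inr hw
  · rintro ⟨f, hf, hfa⟩
    have h01 := hfa (show C4.Adj 0 1 by simp [C4])
    have h12 := hfa (show C4.Adj 1 2 by simp [C4])
    have h23 := hfa (show C4.Adj 2 3 by simp [C4])
    have h30 := hfa (show C4.Adj 3 0 by simp [C4])
    rw [hadj] at h01 h12 h23 h30
    have n02 : (f 0).1 ≠ (f 2).1 := fun h => by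
      have := hf (Subtype.ext h); simp at this
    have n13 : (f 1).1 ≠ (f 3).1 := fun h => by
      have := hf (Subtype.ext h); simp at this
    generalize (f 0).1 = w at *
    generalize (f 1).1 = x at *
    generalize (f 2).1 = y at *
    generalize (f 3).1 = z at *
    have hl : ∀ {u v}, ((u, v) ∈ F ∨ (v, u) ∈ F) → u ∈ A → (u, v) ∈ F ∧ v ∉ A := by
      intro u v h hu
      rcases h with h | h
      · exact ⟨h, (hFE _ _ h).2.1⟩
      · exact absurd hu (hFE _ _ h).2.1
    have hr : ∀ {u v}, ((u, v) ∈ F ∨ (v, u) ∈ F) → u ∉ A → (v, u) ∈ F ∧ v ∈ A := by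
      intro u v h hu
      rcases h with h | h
      · exact absurd (hFE _ _ h).1 hu
      · exact ⟨h, (hFE _ _ h).1⟩
    by_cases hw : w ∈ A
    · obtain ⟨p1, m1⟩ := hl h01 hw
      obtain ⟨p2, m2⟩ := hr h12 m1
      obtain ⟨p3, m3⟩ := hl h23 m2
      obtain ⟨p4, m4⟩ := hr h30 m3
      rcases hCF w y x z p1 p2 p4 p3 with h | h
      · exact n02 h
      · exact n13 h
    · obtain ⟨p1, m1⟩ := hr h01 hw
      obtain ⟨p2, m2⟩ := hl h12 m1
      obtain ⟨p3, m3⟩ := hr h23 m2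
      obtain ⟨p4, m4⟩ := hl h30 m3
      rcases hCF x z w y p1 p4 p2 p3 with h | h
      · exact n13 h
      · exact n02 h

/-- Kühn–Osthus: bipartite graphs of huge minimum degree have `C₄`-free subgraphs of
large minimum degree. -/
theorem bipartite_C4free_subgraph :
    ∃ f : ℕ → ℕ, ∀ d : ℕ, ∀ (V : Type) [Fintype V] (G : SimpleGraph V),
      Bip G → f d ≤ minDeg G →
      ∃ (s : Set V) (H : SimpleGraph s), s.Nonempty ∧ H ≤ G.induce s ∧
        d ≤ minDeg H ∧ ¬ ContainsSub C4 H := by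
  choose D hD0 hD using main_good
  refine ⟨D, ?_⟩
  intro d V _ G ⟨A, hA⟩ hdeg
  have hV : Nonempty V := by
    by_contra hV
    rw [not_nonempty_iff] at hV
    have h1 : minDeg G = 0 := by
      unfold minDeg
      exact minDegree_of_subsingleton G
    have := hD0 d
    omega
  by_cases hle : (Finset.univ.filter fun v => v ∈ A).card ≤
      (Finset.univ.filter fun v => v ∉ A).card
  · exact final_aux d (D d) (hD d) V G A hA hdeg hle
  · refine final_aux d (D d) (hD d) V G Aᶜ ?_ hdeg ?_
    · intro a b hab
      have := hA hab
      simp only [Set.mem_compl_iff]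
      tauto
    · simp only [Set.mem_compl_iff, not_not]
      omega
end
end
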